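/- Let Δ ≥ 6 be an integer and set a = Δ² − 1, b = Δ⁶ − 3Δ⁴ − 2Δ³ + 3Δ² + 2Δ, c = Δ⁶ − Δ⁴ − 2Δ³ + 1. If {a, b, c, d} is a D(1)-quadruple, then d = 4Δ¹⁴ − 20Δ¹² − 16Δ¹¹ + 40Δ¹⁰ + 56Δ⁹ − 16Δ⁸ − 72Δ⁷ − 32Δ⁶ + 24Δ⁵ + 32Δ⁴ + 8Δ³ − 4Δ² − 4Δ. -/

import Mathlib

/-- `a, b, c, d` form a `D(1)`-quadruple: four distinct positive integers such that
the product of any two distinct elements increased by `1` is a perfect square. -/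
def IsDiophQuadruple (n a b c d : ℤ) : Prop :=
  0 < a ∧ 0 < b ∧ 0 < c ∧ 0 < d ∧
  a ≠ b ∧ a ≠ c ∧ a ≠ d ∧ b ≠ c ∧ b ≠ d ∧ c ≠ d ∧
  IsSquare (a * b + n) ∧ IsSquare (a * c + n) ∧ IsSquare (a * d + n) ∧
  IsSquare (b * c + n) ∧ IsSquare (b * d + n) ∧ IsSquare (c * d + n)

set_option exponentiation.threshold 300

/-- One step of the Pell recursion for `b x² - a y² = b - a`, where `ab + 1 = r²`. -/
def pellStep (a b r : ℤ) (p : ℤ × ℤ) : ℤ × ℤ := (r * p.1 + a * p.2, r * p.2 + b * p.1)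

lemma pellStep_iterate_eq (a b r : ℤ) (hr : a * b + 1 = r ^ 2) (x y : ℤ) (k : ℤ)
    (h : b * x ^ 2 - a * y ^ 2 = k) (m : ℕ) :
    b * ((pellStep a b r)^[m] (x, y)).1 ^ 2 - a * ((pellStep a b r)^[m] (x, y)).2 ^ 2 = k := by
  induction m with
  | zero => simpa using h
  | succ m ih =>
    rw [Function.iterate_succ_apply']
    set p := (pellStep a b r)^[m] (x, y)
    simp only [pellStep]
    rw [← ih]
    linear_combination (-b * p.1 ^ 2 + a * p.2 ^ 2) * hr

lemma pellStep_iterate_fst_modEq (a b r x y : ℤ) (m : ℕ) :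
    ((pellStep a b r)^[m] (x, y)).1 ≡ x * r ^ m [ZMOD a] := by
  induction m with
  | zero => simp [Int.ModEq.refl]
  | succ m ih =>
    rw [Function.iterate_succ_apply']
    simp only [pellStep]
    have h2 := (ih.mul_left r).add (Int.modEq_zero_iff_dvd.2 (dvd_mul_right a
      ((pellStep a b r)^[m] (x, y)).2))
    have h3 : r * (x * r ^ m) + 0 = x * r ^ (m + 1) := by ring
    rwa [h3] at h2

lemma pellStep_iterate_snd_modEq (a b r x y : ℤ) (m : ℕ) :
    ((pellStep a b r)^[m] (x, y)).2 ≡ y * r ^ m [ZMOD b] := by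
  induction m with
  | zero => simp [Int.ModEq.refl]
  | succ m ih =>
    rw [Function.iterate_succ_apply']
    simp only [pellStep]
    have h2 := (ih.mul_left r).add (Int.modEq_zero_iff_dvd.2 (dvd_mul_right b
      ((pellStep a b r)^[m] (x, y)).1))
    have h3 : r * (y * r ^ m) + 0 = y * r ^ (m + 1) := by ring
    rwa [h3] at h2

/-- Descent to a fundamental solution. -/
lemma exists_fundamental (a b r : ℤ) (ha : 0 < a) (hab : a < b) (hr0 : 1 < r)
    (hr : a * b + 1 = r ^ 2) (n : ℕ) : ∀ x y : ℤ, 0 < x → x ≤ n →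
    b * x ^ 2 - a * y ^ 2 = b - a → (0 ≤ y ∨ a * |y| ≤ (r - 1) * x) →
    ∃ (m : ℕ) (x₀ y₀ : ℤ), 0 < x₀ ∧ b * x₀ ^ 2 - a * y₀ ^ 2 = b - a ∧
      a * |y₀| ≤ (r - 1) * x₀ ∧ (x, y) = (pellStep a b r)^[m] (x₀, y₀) := by
  induction n with
  | zero => intro x y hx hn; simp at hn; omega
  | succ n ih =>
    intro x y hx hn h hy
    by_cases hs : a * |y| ≤ (r - 1) * x
    · exact ⟨0, x, y, hx, h, hs, rfl⟩
    · have hy0 : 0 ≤ y := by tauto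
      rw [abs_of_nonneg hy0] at hs
      push Not at hs
      have hx'pos : 0 < r * x - a * y := by
        by_contra! hneg
        have h1 : (r * x) ^ 2 ≤ (a * y) ^ 2 := by
          apply pow_le_pow_left₀ (by positivity); linarith
        have h2 : (r * x) ^ 2 - (a * y) ^ 2 = x ^ 2 + a * (b - a) := by
          linear_combination (-x ^ 2) * hr + a * h
        have : 0 < a * (b - a) := mul_pos ha (by linarith)
        nlinarith [sq_nonneg x]
      have heq : b * (r * x - a * y) ^ 2 - a * (r * y - b * x) ^ 2 = b - a := by
        rw [← h]; linear_combination (-b * x ^ 2 + a * y ^ 2) * hr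
      obtain ⟨m, x₀, y₀, h1, h2, h3, h4⟩ := ih (r * x - a * y) (r * y - b * x) hx'pos
        (by push_cast at hn; linarith) heq (by
          rcases le_or_gt 0 (r * y - b * x) with h0 | h0
          · exact Or.inl h0
          · right
            rw [abs_of_neg h0]
            have : x = r * (r * x - a * y) + a * (r * y - b * x) := by
              linear_combination x * hr
            linarith)
      refine ⟨m + 1, x₀, y₀, h1, h2, h3, ?_⟩
      rw [Function.iterate_succ_apply', ← h4]
      simp only [pellStep]
      ext
      · simp only; linear_combination x * hr
      · simp only; linear_combination y * hr

lemma fundamental_snd_le (a b r x y : ℤ) (ha : 0 < a) (hr0 : 1 < r)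
    (hr : a * b + 1 = r ^ 2) (h : b * x ^ 2 - a * y ^ 2 = b - a)
    (hy : a * |y| ≤ (r - 1) * x) : 2 * a * y ^ 2 ≤ (r - 1) * (b - a) := by
  have h1 : (a * |y|) ^ 2 ≤ ((r - 1) * x) ^ 2 := pow_le_pow_left₀ (by positivity) hy 2
  rw [mul_pow, sq_abs] at h1
  have h2 : (2 * (r - 1)) * (x ^ 2) ≤ a * (b - a) := by
    nlinarith
  have h3 : a * (2 * a * y ^ 2) ≤ a * ((r - 1) * (b - a)) := by nlinarith
  exact le_of_mul_le_mul_left h3 ha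

lemma pellStep_iterate_real (a b r : ℤ) (ha : 0 < a) (hb : 0 < b) (x y : ℤ) (m : ℕ) (σ : ℝ)
    (hσ : σ ^ 2 = 1) :
    ((((pellStep a b r)^[m] (x, y)).1 : ℝ) * √b + σ * ((pellStep a b r)^[m] (x, y)).2 * √a) =
      (x * √b + σ * y * √a) * (r + σ * √(a * b)) ^ m := by
  induction m with
  | zero => simp
  | succ m ih =>
    rw [Function.iterate_succ_apply', pow_succ, ← mul_assoc, ← ih]
    set p := (pellStep a b r)^[m] (x, y)
    simp only [pellStep]
    have ha' : (0 : ℝ) < a := by exact_mod_cast ha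
    have hb' : (0 : ℝ) < b := by exact_mod_cast hb
    rw [Real.sqrt_mul ha'.le]
    have h1 := Real.sq_sqrt ha'.le
    have h2 := Real.sq_sqrt hb'.le
    push_cast
    linear_combination (-(p.2 : ℝ) * √b * σ ^ 2) * h1 - (p.1 * σ * √a) * h2
      - (p.2 * a * √b) * hσ

namespace Triple

/-- The smallest element of the triple. -/
def a (Δ : ℤ) : ℤ := Δ ^ 2 - 1
/-- The middle element of the triple. -/
def b (Δ : ℤ) : ℤ := Δ ^ 6 - 3 * Δ ^ 4 - 2 * Δ ^ 3 + 3 * Δ ^ 2 + 2 * Δ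
/-- The largest element of the triple. -/
def c (Δ : ℤ) : ℤ := Δ ^ 6 - Δ ^ 4 - 2 * Δ ^ 3 + 1
/-- The square root of `ab + 1`. -/
def r (Δ : ℤ) : ℤ := Δ ^ 4 - 2 * Δ ^ 2 - Δ + 1
/-- The square root of `ac + 1`. -/
def s (Δ : ℤ) : ℤ := Δ ^ 4 - Δ ^ 2 - Δ
/-- The square root of `bc + 1`. -/
def t (Δ : ℤ) : ℤ := Δ ^ 6 - 2 * Δ ^ 4 - 2 * Δ ^ 3 + Δ ^ 2 + Δ + 1

lemma ab_add_one (Δ : ℤ) : a Δ * b Δ + 1 = r Δ ^ 2 := by simp only [a, b, r]; ring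
lemma ac_add_one (Δ : ℤ) : a Δ * c Δ + 1 = s Δ ^ 2 := by simp only [a, c, s]; ring
lemma bc_add_one (Δ : ℤ) : b Δ * c Δ + 1 = t Δ ^ 2 := by simp only [b, c, t]; ring
lemma s_eq (Δ : ℤ) : s Δ = a Δ + r Δ := by simp only [a, r, s]; ring
lemma t_eq (Δ : ℤ) : t Δ = b Δ + r Δ := by simp only [b, r, t]; ring
lemma c_eq (Δ : ℤ) : c Δ = s Δ + t Δ := by simp only [c, s, t]; ring

lemma a_ge {Δ : ℤ} (h : 6 ≤ Δ) : 35 ≤ a Δ := by simp only [a]; nlinarith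
lemma r_ge {Δ : ℤ} (h : 6 ≤ Δ) : 33 * a Δ ≤ r Δ := by
  obtain ⟨k, rfl⟩ : ∃ k, Δ = k + 6 := ⟨Δ - 6, by ring⟩
  have hk : 0 ≤ k := by linarith
  simp only [a, r]
  rw [← sub_nonneg]; ring_nf; positivity
lemma b_ge {Δ : ℤ} (h : 6 ≤ Δ) : 33 * r Δ ≤ b Δ := by
  obtain ⟨k, rfl⟩ : ∃ k, Δ = k + 6 := ⟨Δ - 6, by ring⟩
  have hk : 0 ≤ k := by linarith
  simp only [b, r]
  rw [← sub_nonneg]; ring_nf; positivity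
lemma s_sub_one_mul_lt {Δ : ℤ} (h : 6 ≤ Δ) : (s Δ - 1) * (c Δ - a Δ) < 2 * a Δ * s Δ ^ 2 := by
  have h1 : c Δ - a Δ < 2 * a Δ * s Δ := by
    obtain ⟨k, rfl⟩ : ∃ k, Δ = k + 6 := ⟨Δ - 6, by ring⟩
    have hk : 0 ≤ k := by linarith
    simp only [a, c, s]
    rw [← sub_pos]; ring_nf; positivity
  have := s_eq Δ; have := a_ge h; have := r_ge h
  nlinarith
lemma r_sub_one_mul_lt {Δ : ℤ} (h : 6 ≤ Δ) : (r Δ - 1) * (b Δ - a Δ) < 2 * a Δ * r Δ ^ 2 := by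
  have h1 : b Δ - a Δ < 2 * a Δ * r Δ := by
    obtain ⟨k, rfl⟩ : ∃ k, Δ = k + 6 := ⟨Δ - 6, by ring⟩
    have hk : 0 ≤ k := by linarith
    simp only [a, b, r]
    rw [← sub_pos]; ring_nf; positivity
  have := a_ge h; have := r_ge h
  nlinarith

/-- The fourth element of the regular quadruple is `4rst`. -/
lemma four_mul_rst (Δ : ℤ) : 4 * (r Δ * s Δ * t Δ) = 4 * Δ ^ 14 - 20 * Δ ^ 12 - 16 * Δ ^ 11
      + 40 * Δ ^ 10 + 56 * Δ ^ 9 - 16 * Δ ^ 8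
      - 72 * Δ ^ 7 - 32 * Δ ^ 6 + 24 * Δ ^ 5 + 32 * Δ ^ 4 + 8 * Δ ^ 3 - 4 * Δ ^ 2 - 4 * Δ := by
  simp only [r, s, t]; ring

lemma eq_of_dvd_sub {u v c : ℤ} (h : c ∣ u - v) (hlt : |u| + |v| < c) : u = v := by
  have := Int.eq_zero_of_abs_lt_dvd h (lt_of_le_of_lt (abs_sub u v) hlt)
  linarith

lemma pow_modEq_or (c s : ℤ) (hs : s ^ 2 ≡ 1 [ZMOD c]) (m : ℕ) :
    s ^ m ≡ 1 [ZMOD c] ∨ s ^ m ≡ s [ZMOD c] := by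
  induction m with
  | zero => left; simp [Int.ModEq.refl]
  | succ m ih =>
    rcases ih with h | h
    · right; have := h.mul_right s; rwa [one_mul, ← pow_succ] at this
    · left; have := h.mul_right s; rw [← pow_succ, ← sq] at this; exact this.trans hs

/-- If `s² ≡ 1` and `u sᵐ ≡ v sⁿ` modulo `c`, then `u ≡ v` or `u ≡ v s`. -/
lemma modEq_or_of_mul_pow (c s u v : ℤ) (hs : s ^ 2 ≡ 1 [ZMOD c]) (m n : ℕ)
    (h : u * s ^ m ≡ v * s ^ n [ZMOD c]) : u ≡ v [ZMOD c] ∨ u ≡ v * s [ZMOD c] := by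
  have h1 : u ≡ v * s ^ (n + m) [ZMOD c] := by
    have h2 := h.mul_right (s ^ m)
    have h3 : s ^ m * s ^ m ≡ 1 [ZMOD c] := by
      have := hs.pow m; rw [one_pow, ← pow_mul, mul_comm 2 m, pow_mul, sq] at this; exact this
    have h4 := h3.mul_left u
    rw [mul_one, ← mul_assoc] at h4
    rw [pow_add, ← mul_assoc]
    exact h4.symm.trans h2
  rcases pow_modEq_or c s hs (n + m) with h3 | h3
  · left; have := h1.trans (h3.mul_left v); rwa [mul_one] at this
  · right; exact h1.trans (h3.mul_left v)

lemma eq_one_of_mul_sq_eq {c x : ℤ} (hc : 0 < c) (hx : 0 < x) (h : c * x ^ 2 = c) : x = 1 := by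
  have h1 : x ^ 2 = 1 := mul_left_cancel₀ hc.ne' (by rw [h, mul_one])
  rcases sq_eq_one_iff.1 h1 with h | h <;> linarith

lemma sq_modEq_one {a c s : ℤ} (h : a * c + 1 = s ^ 2) : s ^ 2 ≡ 1 [ZMOD c] := by
  rw [← h]; exact (Int.modEq_iff_dvd.2 ⟨-a, by ring⟩)

/-- In an extension of the triple, the Pellian sequences start at `±1`. -/
lemma exists_pell_exponents {Δ d : ℤ} (hΔ : 6 ≤ Δ)
    {x y z : ℤ} (hx0 : 0 < x) (hy0 : 0 < y) (hz0 : 0 < z)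
    (hx : a Δ * d + 1 = x ^ 2) (hy : b Δ * d + 1 = y ^ 2) (hz : c Δ * d + 1 = z ^ 2) :
    ∃ (m l : ℕ) (ε : ℤ), (ε = 1 ∨ ε = -1) ∧
      (x, y) = (pellStep (a Δ) (b Δ) (r Δ))^[m] (1, 1) ∧
      (x, z) = (pellStep (a Δ) (c Δ) (s Δ))^[l] (1, ε) := by
  have ha := a_ge hΔ
  have hr := r_ge hΔ
  have hb := b_ge hΔ
  have hab := ab_add_one Δ
  have hac := ac_add_one Δ
  have hbc := bc_add_one Δ
  have hse := s_eq Δ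
  have hte := t_eq Δ
  have hce := c_eq Δ
  have hslt := s_sub_one_mul_lt hΔ
  have hrlt := r_sub_one_mul_lt hΔ
  generalize a Δ = a at *
  generalize b Δ = b at *
  generalize c Δ = c at *
  generalize r Δ = r at *
  generalize s Δ = s at *
  generalize t Δ = t at *
  obtain ⟨n, y₁, z₁, hy₁, e₁, f₁, g₁⟩ := exists_fundamental b c t (by linarith) (by linarith)
    (by linarith) hbc y.toNat y z hy0 (by omega)
    (by linear_combination (-c) * hy + b * hz) (Or.inl hz0.le)
  obtain ⟨l, x₂, z₂, hx₂, e₂, f₂, g₂⟩ := exists_fundamental a c s (by linarith) (by linarith)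
    (by linarith) hac x.toNat x z hx0 (by omega)
    (by linear_combination (-c) * hx + a * hz) (Or.inl hz0.le)
  obtain ⟨m, x₃, y₃, hx₃, e₃, f₃, g₃⟩ := exists_fundamental a b r (by linarith) (by linarith)
    (by linarith) hab x.toNat x y hx0 (by omega)
    (by linear_combination (-b) * hx + a * hy) (Or.inl hy0.le)
  have b₁ := fundamental_snd_le b c t y₁ z₁ (by linarith) (by linarith) hbc e₁ f₁
  have b₂ := fundamental_snd_le a c s x₂ z₂ (by linarith) (by linarith) hac e₂ f₂
  have b₃ := fundamental_snd_le a b r x₃ y₃ (by linarith) (by linarith) hab e₃ f₃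
  have sqz := sq_modEq_one hbc
  have sqs := sq_modEq_one hac
  have sqr := sq_modEq_one hab
  have c₁ : z ≡ z₁ * t ^ n [ZMOD c] := by
    have := pellStep_iterate_snd_modEq b c t y₁ z₁ n; rwa [← g₁] at this
  have c₁' : y ≡ y₁ * t ^ n [ZMOD b] := by
    have := pellStep_iterate_fst_modEq b c t y₁ z₁ n; rwa [← g₁] at this
  have c₂ : z ≡ z₂ * s ^ l [ZMOD c] := by
    have := pellStep_iterate_snd_modEq a c s x₂ z₂ l; rwa [← g₂] at this
  have c₃ : y ≡ y₃ * r ^ m [ZMOD b] := by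
    have := pellStep_iterate_snd_modEq a b r x₃ y₃ m; rwa [← g₃] at this
  -- the pair `(b, c)`
  have hz₁ : z₁ ^ 2 = 1 := by
    have h1 : z₁ ^ 2 ≡ 1 [ZMOD c] := by
      have h2 := c₁.pow 2
      rw [mul_pow, ← pow_mul, mul_comm n 2, pow_mul] at h2
      have h3 := ((sqz.pow n).mul_left (z₁ ^ 2))
      rw [one_pow, mul_one] at h3
      have h4 : z ^ 2 ≡ 1 [ZMOD c] := by
        rw [← hz]; exact (Int.modEq_iff_dvd.2 ⟨-d, by ring⟩)
      exact (h3.symm.trans h2.symm).trans h4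
    have h2 : z₁ ^ 2 < c - 1 := by
      have h5 : (t - 1) * (c - b) ≤ 2 * b * (c - b) :=
        mul_le_mul_of_nonneg_right (by linarith) (by linarith)
      have h6 : 2 * b * (c - b) < 2 * b * (c - 1) :=
        mul_lt_mul_of_pos_left (by linarith) (by linarith)
      exact lt_of_mul_lt_mul_left ((b₁.trans h5).trans_lt h6) (by linarith)
    refine eq_of_dvd_sub h1.symm.dvd ?_
    rw [abs_of_nonneg (sq_nonneg _), abs_one]; linarith
  have hy₁1 : y₁ = 1 := by
    rw [hz₁] at e₁
    exact eq_one_of_mul_sq_eq (c := c) (by linarith) hy₁ (by linear_combination e₁)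
  -- the pair `(a, c)`
  have hts : t ≡ -s [ZMOD c] := Int.modEq_iff_dvd.2 ⟨-1, by rw [hce]; ring⟩
  have hz₂s : |z₂| < s := abs_lt_of_sq_lt_sq
    (lt_of_mul_lt_mul_left (b₂.trans_lt hslt) (by linarith)) (by linarith)
  have hz₁a : |z₁| = 1 := by
    rcases sq_eq_one_iff.1 hz₁ with h | h <;> simp [h]
  have hz₂ : z₂ = 1 ∨ z₂ = -1 := by
    have h1 : z₂ * s ^ l ≡ (z₁ * (-1) ^ n) * s ^ n [ZMOD c] := by
      have h2 := (c₂.symm.trans c₁).trans ((hts.pow n).mul_left z₁)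
      rwa [neg_pow, ← mul_assoc] at h2
    have hu : |z₁ * (-1) ^ n| = 1 := by simp [abs_mul, hz₁a]
    rcases modEq_or_of_mul_pow c s _ _ sqs l n h1 with h2 | h2
    · have := eq_of_dvd_sub h2.symm.dvd (by rw [hu]; linarith)
      rw [← this] at hu
      exact eq_or_eq_neg_of_abs_eq hu
    · have := eq_of_dvd_sub h2.symm.dvd (by
        rw [abs_mul, hu, abs_of_pos (by linarith : 0 < s)]; linarith)
      rw [this, abs_mul, hu, abs_of_pos (by linarith : 0 < s)] at hz₂s
      linarith
  have hx₂1 : x₂ = 1 := by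
    have hz₂q : z₂ ^ 2 = 1 := by rcases hz₂ with h | h <;> simp [h]
    rw [hz₂q] at e₂
    exact eq_one_of_mul_sq_eq (c := c) (by linarith) hx₂ (by linear_combination e₂)
  -- the pair `(a, b)`
  have htr : t ≡ r [ZMOD b] := Int.modEq_iff_dvd.2 ⟨-1, by rw [hte]; ring⟩
  have hy₃r : |y₃| < r := abs_lt_of_sq_lt_sq
    (lt_of_mul_lt_mul_left (b₃.trans_lt hrlt) (by linarith)) (by linarith)
  have hy₃ : y₃ = 1 := by
    have h1 : y₃ * r ^ m ≡ 1 * r ^ n [ZMOD b] := by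
      have h2 := (c₃.symm.trans c₁').trans ((htr.pow n).mul_left y₁)
      rwa [hy₁1] at h2
    rcases modEq_or_of_mul_pow b r _ _ sqr m n h1 with h2 | h2
    · exact eq_of_dvd_sub h2.symm.dvd (by rw [abs_one]; linarith)
    · have := eq_of_dvd_sub h2.symm.dvd (by
        rw [one_mul, abs_of_pos (by linarith : 0 < r)]; linarith)
      rw [this, one_mul, abs_of_pos (by linarith : 0 < r)] at hy₃r
      linarith
  have hx₃1 : x₃ = 1 := by
    rw [hy₃] at e₃
    exact eq_one_of_mul_sq_eq (c := b) (by linarith) hx₃ (by linear_combination e₃)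
  subst hy₃ hx₃1 hx₂1
  exact ⟨m, l, z₂, hz₂, g₃, g₂⟩

lemma pellStep_iterate_fst_rec (a b r : ℤ) (hr : a * b + 1 = r ^ 2) (p : ℤ × ℤ) (n : ℕ) :
    ((pellStep a b r)^[n + 2] p).1 =
      2 * r * ((pellStep a b r)^[n + 1] p).1 - ((pellStep a b r)^[n] p).1 := by
  rw [Function.iterate_succ_apply', Function.iterate_succ_apply']
  simp only [pellStep]
  linear_combination ((pellStep a b r)^[n] p).1 * hr

lemma rec_lt_of_lt {r s : ℤ} (hr : 1 < r) (hrs : r < s) (u v : ℕ → ℤ)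
    (hu : ∀ n, u (n + 2) = 2 * r * u (n + 1) - u n)
    (hv : ∀ n, v (n + 2) = 2 * s * v (n + 1) - v n) (k : ℕ) (h0 : 0 < u (k + 1))
    (h1 : u (k + 1) ≤ v (k + 1)) (h2 : 0 ≤ u (k + 1) - u k)
    (h3 : u (k + 1) - u k ≤ v (k + 1) - v k) (n : ℕ) :
    u (k + 1 + n) ≤ u (k + 1 + (n + 1)) ∧ u (k + 1 + (n + 1)) < v (k + 1 + (n + 1)) := by
  have key : ∀ n, 0 < u (k + 1 + n) ∧ u (k + 1 + n) ≤ v (k + 1 + n) ∧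
      0 ≤ u (k + 1 + n) - u (k + n) ∧
      u (k + 1 + n) - u (k + n) ≤ v (k + 1 + n) - v (k + n) := by
    intro n
    induction n with
    | zero => exact ⟨h0, h1, h2, h3⟩
    | succ n ih =>
      obtain ⟨i0, i1, i2, i3⟩ := ih
      have e1 := hu (k + n)
      have e2 := hv (k + n)
      rw [show k + n + 2 = k + 1 + (n + 1) by ring, show k + n + 1 = k + 1 + n by ring] at e1 e2
      rw [show k + (n + 1) = k + 1 + n by ring]
      have e3 : r * u (k + 1 + n) ≤ s * v (k + 1 + n) :=
        mul_le_mul hrs.le i1 i0.le (by linarith)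
      have e4 : u (k + 1 + n) < r * u (k + 1 + n) := by nlinarith
      have e5 : (r - 1) * u (k + 1 + n) ≤ (s - 1) * v (k + 1 + n) :=
        mul_le_mul (by linarith) i1 i0.le (by linarith)
      refine ⟨by linarith, by linarith, by linarith, by linarith⟩
  obtain ⟨i0, i1, i2, i3⟩ := key n
  obtain ⟨j0, j1, j2, j3⟩ := key (n + 1)
  rw [show k + (n + 1) = k + 1 + n by ring] at j2 j3
  refine ⟨by linarith, ?_⟩
  have e1 := hu (k + n)
  have e2 := hv (k + n)
  rw [show k + n + 2 = k + 1 + (n + 1) by ring, show k + n + 1 = k + 1 + n by ring] at e1 e2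
  have e5 : (r - 1) * u (k + 1 + n) < (s - 1) * v (k + 1 + n) :=
    mul_lt_mul (by linarith) i1 i0 (by linarith)
  linarith

lemma exponent_bounds {Δ d : ℤ} (hΔ : 6 ≤ Δ) (hd : 0 < d) (hdc : c Δ ≠ d)
    (hd' : d ≠ 4 * (r Δ * s Δ * t Δ)) {x y z ε : ℤ} (hx : a Δ * d + 1 = x ^ 2) {m l : ℕ}
    (hε : ε = 1 ∨ ε = -1)
    (h1 : (x, y) = (pellStep (a Δ) (b Δ) (r Δ))^[m] (1, 1))
    (h2 : (x, z) = (pellStep (a Δ) (c Δ) (s Δ))^[l] (1, ε)) : 3 ≤ m ∧ l < m := by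
  have ha := a_ge hΔ
  have hr := r_ge hΔ
  have hab := ab_add_one Δ
  have hac := ac_add_one Δ
  have hse := s_eq Δ
  have hte := t_eq Δ
  have hce := c_eq Δ
  have hb := b_ge hΔ
  set u : ℕ → ℤ := fun n => ((pellStep (a Δ) (b Δ) (r Δ))^[n] (1, 1)).1 with hu
  set v : ℕ → ℤ := fun n => ((pellStep (a Δ) (c Δ) (s Δ))^[n] (1, ε)).1 with hv
  have xu : x = u m := by simp only [hu, ← h1]
  have xv : x = v l := by simp only [hv, ← h2]
  have u0 : u 0 = 1 := by simp [hu]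
  have u1 : u 1 = s Δ := by simp [hu, pellStep, hse]; ring
  have ru : ∀ n, u (n + 2) = 2 * r Δ * u (n + 1) - u n :=
    fun n => pellStep_iterate_fst_rec _ _ _ hab _ n
  have rv : ∀ n, v (n + 2) = 2 * s Δ * v (n + 1) - v n :=
    fun n => pellStep_iterate_fst_rec _ _ _ hac _ n
  have u2 : u 2 = 2 * r Δ * s Δ - 1 := by rw [ru 0]; simp only [zero_add, u0, u1]
  have v0 : v 0 = 1 := by simp [hv]
  have v1 : v 1 = s Δ + ε * a Δ := by simp [hv, pellStep]; ring
  have v2 : v 2 = 2 * s Δ * (s Δ + ε * a Δ) - 1 := by rw [rv 0]; simp only [zero_add, v0, v1]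
  have a0 : a Δ ≠ 0 := by linarith
  have hm : 3 ≤ m := by
    by_contra! hm
    interval_cases m
    · rw [xu, u0] at hx
      have : a Δ * d = 0 := by linarith
      rcases mul_eq_zero.1 this with h | h <;> linarith
    · rw [xu, u1, ← hac] at hx
      exact hdc (mul_left_cancel₀ a0 (by linarith)).symm
    · apply hd'
      apply mul_left_cancel₀ a0
      rw [xu, u2] at hx
      rw [hte]
      have e : a Δ = s Δ - r Δ := by linarith
      linear_combination hx - 4 * r Δ * s Δ * hab - 4 * r Δ ^ 2 * s Δ * e
  refine ⟨hm, ?_⟩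
  by_contra! hlm
  have key : ∀ n, u (n + 2) ≤ u (n + 3) ∧ u (n + 3) < v (n + 3) := by
    intro n
    rcases hε with rfl | rfl
    · have := rec_lt_of_lt (by linarith) (by linarith : r Δ < s Δ) u v ru rv 0
        (by simp only [zero_add, u1]; linarith) (by simp only [zero_add, u1, v1]; linarith)
        (by simp only [zero_add, u0, u1]; linarith)
        (by simp only [zero_add, u0, u1, v0, v1]; linarith) (n + 1)
      simpa only [show 0 + 1 + (n + 1) = n + 2 by ring,
        show 0 + 1 + (n + 1 + 1) = n + 3 by ring] using this
    · have hp : 0 < r Δ * s Δ := mul_pos (by linarith) (by linarith)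
      have e : s Δ + -1 * a Δ = r Δ := by linarith
      have hrs : s Δ < r Δ * s Δ := by nlinarith
      have := rec_lt_of_lt (by linarith) (by linarith : r Δ < s Δ) u v ru rv 1
        (by simp only [Nat.reduceAdd, u2]; linarith)
        (by simp only [Nat.reduceAdd, u2, v2, e]; linarith)
        (by simp only [Nat.reduceAdd, u2, u1]; linarith)
        (by simp only [Nat.reduceAdd, u2, u1, v1, v2, e]; linarith) n
      simpa only [show 1 + 1 + n = n + 2 by ring, show 1 + 1 + (n + 1) = n + 3 by ring] using this
  have mono : ∀ k, u m ≤ u (m + k) := by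
    intro k
    induction k with
    | zero => simp
    | succ k ih =>
      have := (key (m + k - 2)).1
      rw [show m + k - 2 + 2 = m + k by omega, show m + k - 2 + 3 = m + (k + 1) by omega] at this
      exact ih.trans this
  have h3 := mono (l - m)
  rw [show m + (l - m) = l by omega] at h3
  have h4 := (key (l - 3)).2
  rw [show l - 3 + 3 = l by omega] at h4
  linarith

end Triple

lemma log_two_mul_sub_mem {b k x Y : ℝ} (hb : 0 < b) (hk : 0 ≤ k) (hkb : k ≤ b) (hx : 0 < x)
    (hY : 0 ≤ Y) (h : b * x ^ 2 - Y ^ 2 = k) :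
    0 ≤ Real.log (2 * x * √b) - Real.log (x * √b + Y) ∧
      Real.log (2 * x * √b) - Real.log (x * √b + Y) ≤ 1 / x ^ 2 := by
  have hsb : 0 < √b := Real.sqrt_pos.2 hb
  have hsq := Real.sq_sqrt hb.le
  have hxb : 0 < x * √b := mul_pos hx hsb
  have hp : 0 < x * √b + Y := by linarith
  have hYx : Y ≤ x * √b := by
    refine (pow_le_pow_iff_left₀ hY hxb.le two_ne_zero).1 ?_
    nlinarith
  rw [← Real.log_div (by positivity) (by positivity)]
  constructor
  · apply Real.log_nonneg
    rw [le_div_iff₀ hp]; linarith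
  · have h1 : 2 * x * √b / (x * √b + Y) = 1 + k / (x * √b + Y) ^ 2 := by
      field_simp
      rw [← h]; linear_combination (x ^ 2) * hsq
    have h2 : Real.log (2 * x * √b / (x * √b + Y)) ≤ k / (x * √b + Y) ^ 2 := by
      have := Real.log_le_sub_one_of_pos (show 0 < 2 * x * √b / (x * √b + Y) by positivity)
      linarith
    refine h2.trans ?_
    rw [div_le_div_iff₀ (by positivity) (by positivity)]
    have h3 : (x * √b) ^ 2 ≤ (x * √b + Y) ^ 2 := pow_le_pow_left₀ hxb.le (by linarith) 2
    have h4 : (x * √b) ^ 2 = b * x ^ 2 := by rw [mul_pow, hsq]; ring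
    nlinarith [sq_nonneg x]

namespace Triple

/-- The fundamental unit attached to the pair `(a, c)`. -/
noncomputable def α (Δ : ℤ) : ℝ := s Δ + √(a Δ * c Δ)
/-- The fundamental unit attached to the pair `(a, b)`. -/
noncomputable def ρ (Δ : ℤ) : ℝ := r Δ + √(a Δ * b Δ)
/-- The numerator of the algebraic number comparing the two initial solutions. -/
noncomputable def num (Δ ε : ℤ) : ℝ := √(b Δ * c Δ) + ε * √(a Δ * b Δ)
/-- The denominator of the algebraic number comparing the two initial solutions. -/
noncomputable def den (Δ : ℤ) : ℝ := √(b Δ * c Δ) + √(a Δ * c Δ)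

/-- The linear form in logarithms attached to an extension of the triple. -/
noncomputable def form (Δ ε : ℤ) (l m : ℕ) : ℝ :=
  l * Real.log (α Δ) - m * Real.log (ρ Δ) + (Real.log (num Δ ε) - Real.log (den Δ))

lemma order_chain {Δ : ℤ} (hΔ : 6 ≤ Δ) : (35 : ℝ) ≤ a Δ ∧ (33 : ℝ) * a Δ ≤ r Δ ∧
    (33 : ℝ) * r Δ ≤ b Δ ∧ (s Δ : ℝ) = a Δ + r Δ ∧ (t Δ : ℝ) = b Δ + r Δ ∧
    (c Δ : ℝ) = s Δ + t Δ := by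
  refine ⟨by exact_mod_cast a_ge hΔ, by exact_mod_cast r_ge hΔ, by exact_mod_cast b_ge hΔ,
    by exact_mod_cast s_eq Δ, by exact_mod_cast t_eq Δ, by exact_mod_cast c_eq Δ⟩

lemma abs_form_le {Δ : ℤ} (hΔ : 6 ≤ Δ) {x y z ε : ℤ} {m l : ℕ} (hx0 : 0 < x) (hy0 : 0 < y)
    (hz0 : 0 < z) (hε : ε = 1 ∨ ε = -1)
    (h1 : (x, y) = (pellStep (a Δ) (b Δ) (r Δ))^[m] (1, 1))
    (h2 : (x, z) = (pellStep (a Δ) (c Δ) (s Δ))^[l] (1, ε)) :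
    |form Δ ε l m| ≤ 4 / ρ Δ ^ (2 * m) := by
  obtain ⟨ha, hr, hb, hs, ht, hc⟩ := order_chain hΔ
  have ha0 : (0 : ℝ) < a Δ := by linarith
  have hb0 : (0 : ℝ) < b Δ := by linarith
  have hc0 : (0 : ℝ) < c Δ := by linarith
  have hba : (a Δ : ℝ) < b Δ := by linarith
  have hca : (a Δ : ℝ) < c Δ := by linarith
  have hx : (0 : ℝ) < x := by exact_mod_cast hx0
  have hy : (0 : ℝ) < y := by exact_mod_cast hy0
  have hz : (0 : ℝ) < z := by exact_mod_cast hz0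
  have E1 : (b Δ : ℝ) * x ^ 2 - a Δ * y ^ 2 = b Δ - a Δ := by
    have := pellStep_iterate_eq (a Δ) (b Δ) (r Δ) (ab_add_one Δ) 1 1 (b Δ - a Δ) (by ring) m
    rw [← h1] at this
    exact_mod_cast this
  have E2 : (c Δ : ℝ) * x ^ 2 - a Δ * z ^ 2 = c Δ - a Δ := by
    have := pellStep_iterate_eq (a Δ) (c Δ) (s Δ) (ac_add_one Δ) 1 ε (c Δ - a Δ)
      (by rcases hε with rfl | rfl <;> ring) l
    rw [← h2] at this
    exact_mod_cast this
  have R1 : (x * √(b Δ) + y * √(a Δ) : ℝ) = (√(b Δ) + √(a Δ)) * ρ Δ ^ m := by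
    have := pellStep_iterate_real (a Δ) (b Δ) (r Δ) (by exact_mod_cast ha0)
      (by exact_mod_cast hb0) 1 1 m 1 (by norm_num)
    rw [← h1] at this
    simpa [ρ] using this
  have R2 : (x * √(c Δ) + z * √(a Δ) : ℝ) = (√(c Δ) + ε * √(a Δ)) * α Δ ^ l := by
    have := pellStep_iterate_real (a Δ) (c Δ) (s Δ) (by exact_mod_cast ha0)
      (by exact_mod_cast hc0) 1 ε l 1 (by norm_num)
    rw [← h2] at this
    simpa [α] using this
  have sa := Real.sqrt_pos.2 ha0
  have sb := Real.sqrt_pos.2 hb0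
  have sc := Real.sqrt_pos.2 hc0
  have sab : √(a Δ : ℝ) < √(b Δ) := Real.sqrt_lt_sqrt ha0.le hba
  have sac : √(a Δ : ℝ) < √(c Δ) := Real.sqrt_lt_sqrt ha0.le hca
  have hρ : 0 < ρ Δ := by
    have : (0 : ℝ) < r Δ := by linarith
    unfold ρ; positivity
  have hα : 0 < α Δ := by
    have : (0 : ℝ) < s Δ := by linarith
    unfold α; positivity
  have hce : 0 < √(c Δ : ℝ) + ε * √(a Δ) := by
    rcases hε with rfl | rfl <;> push_cast <;> linarith
  obtain ⟨I1, I2⟩ := log_two_mul_sub_mem (k := b Δ - a Δ) (Y := y * √(a Δ)) hb0 (by linarith)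
    (by linarith) hx (by positivity) (by
      rw [mul_pow, Real.sq_sqrt ha0.le, ← E1]; ring)
  obtain ⟨J1, J2⟩ := log_two_mul_sub_mem (k := c Δ - a Δ) (Y := z * √(a Δ)) hc0 (by linarith)
    (by linarith) hx (by positivity) (by
      rw [mul_pow, Real.sq_sqrt ha0.le, ← E2]; ring)
  have hform : form Δ ε l m =
      (Real.log (2 * x * √(b Δ)) - Real.log (x * √(b Δ) + y * √(a Δ))) -
      (Real.log (2 * x * √(c Δ)) - Real.log (x * √(c Δ) + z * √(a Δ))) := by
    have n1 : num Δ ε = √(b Δ) * (√(c Δ) + ε * √(a Δ)) := by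
      rw [num, Real.sqrt_mul hb0.le, Real.sqrt_mul ha0.le]; ring
    have n2 : den Δ = √(c Δ) * (√(b Δ) + √(a Δ)) := by
      rw [den, Real.sqrt_mul hb0.le, Real.sqrt_mul ha0.le]; ring
    have l1 := Real.log_mul (x := 2 * (x : ℝ)) (by positivity) sb.ne'
    have l2 := Real.log_mul (x := 2 * (x : ℝ)) (by positivity) sc.ne'
    have l3 := Real.log_mul (x := √(b Δ : ℝ) + √(a Δ)) (y := ρ Δ ^ m) (by positivity)
      (by positivity)
    have l4 := Real.log_mul (y := α Δ ^ l) hce.ne' (by positivity)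
    rw [R1, R2, form, n1, n2, Real.log_mul sb.ne' hce.ne', Real.log_mul sc.ne' (by positivity),
      l1, l2, l3, l4, Real.log_pow, Real.log_pow]
    ring
  have hxρ : ρ Δ ^ m ≤ 2 * x := by
    have h3 : (y * √(a Δ)) ≤ x * √(b Δ) := by
      refine (pow_le_pow_iff_left₀ (by positivity) (by positivity) two_ne_zero).1 ?_
      rw [mul_pow, mul_pow, Real.sq_sqrt ha0.le, Real.sq_sqrt hb0.le]; linarith
    have h4 : √(b Δ) * ρ Δ ^ m ≤ √(b Δ) * (2 * x) := by
      have : 0 ≤ √(a Δ) * ρ Δ ^ m := by positivity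
      linarith
    exact le_of_mul_le_mul_left h4 sb
  have hle : |form Δ ε l m| ≤ 1 / (x : ℝ) ^ 2 := by
    rw [hform, abs_le]; constructor <;> linarith
  refine hle.trans ?_
  rw [div_le_div_iff₀ (by positivity) (by positivity), mul_comm 2 m, pow_mul]
  have := pow_le_pow_left₀ (by positivity) hxρ 2
  linarith

end Triple

lemma eq_zero_of_sq_eq_mul_sq {k r p q : ℤ} (hk : 0 < k) (h : k + 1 = r ^ 2)
    (hpq : p ^ 2 = k * q ^ 2) : q = 0 := by
  by_contra hq
  obtain ⟨j, rfl⟩ : q ∣ p := (Int.pow_dvd_pow_iff two_ne_zero).1 ⟨k, by rw [hpq]; ring⟩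
  have hj : j ^ 2 = k := by
    refine mul_right_cancel₀ (pow_ne_zero 2 hq) ?_
    rw [← hpq]; ring
  have h1 : |j| < |r| := sq_lt_sq.1 (by omega)
  have h2 : |r| < |j| + 1 := by
    rw [← abs_of_nonneg (show 0 ≤ |j| + 1 by positivity), ← sq_lt_sq]
    have : 0 < |j| := abs_pos.2 (by rintro rfl; simp at hj; omega)
    nlinarith [sq_abs j]
  omega

/-- The signs of the square roots of `ab` under the four real embeddings. -/
def sgnAB : Fin 4 → ℝ := ![1, 1, -1, -1]
/-- The signs of the square roots of `ac` under the four real embeddings. -/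
def sgnAC : Fin 4 → ℝ := ![1, -1, 1, -1]

/-- The image of `p + q √(ab) + r √(ac) + u √(bc)` under the four real embeddings. -/
noncomputable def biquad (a b c p q r u : ℤ) (i : Fin 4) : ℝ :=
  p + q * (sgnAB i * √(a * b)) + r * (sgnAC i * √(a * c)) + u * (sgnAB i * sgnAC i * √(b * c))

lemma sgnAB_mul_self (i : Fin 4) : sgnAB i * sgnAB i = 1 := by fin_cases i <;> simp [sgnAB]
lemma sgnAC_mul_self (i : Fin 4) : sgnAC i * sgnAC i = 1 := by fin_cases i <;> simp [sgnAC]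

section biquad

variable {a b c : ℤ}

lemma sqrt_mul_sqrt_mul (a b c : ℤ) (ha : 0 < a) (hb : 0 < b) :
    √(a * b : ℝ) * √(a * c) = a * √(b * c) := by
  have ha' : (0 : ℝ) ≤ a := by exact_mod_cast ha.le
  have hb' : (0 : ℝ) ≤ b := by exact_mod_cast hb.le
  rw [Real.sqrt_mul ha', Real.sqrt_mul ha', mul_mul_mul_comm, Real.mul_self_sqrt ha',
    Real.sqrt_mul hb']

/-- The ring of integral combinations of `1, √(ab), √(ac), √(bc)`, as a ring of vectors of
conjugates. -/
noncomputable def biquadRing (a b c : ℤ) (ha : 0 < a) (hb : 0 < b) (hc : 0 < c) :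
    Subring (Fin 4 → ℝ) where
  carrier := {f | ∃ p q r u : ℤ, f = biquad a b c p q r u}
  zero_mem' := ⟨0, 0, 0, 0, by ext; simp [biquad]⟩
  one_mem' := ⟨1, 0, 0, 0, by ext; simp [biquad]⟩
  add_mem' := by
    rintro _ _ ⟨p, q, r, u, rfl⟩ ⟨p', q', r', u', rfl⟩
    exact ⟨p + p', q + q', r + r', u + u', by ext; simp [biquad]; ring⟩
  neg_mem' := by
    rintro _ ⟨p, q, r, u, rfl⟩
    exact ⟨-p, -q, -r, -u, by ext; simp [biquad]; ring⟩
  mul_mem' := by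
    rintro _ _ ⟨p, q, r, u, rfl⟩ ⟨p', q', r', u', rfl⟩
    refine ⟨p * p' + a * b * (q * q') + a * c * (r * r') + b * c * (u * u'),
      p * q' + q * p' + c * (r * u' + u * r'), p * r' + r * p' + b * (q * u' + u * q'),
      p * u' + u * p' + a * (q * r' + r * q'), ?_⟩
    ext i
    have ha' : (0 : ℝ) ≤ a := by exact_mod_cast ha.le
    have hb' : (0 : ℝ) ≤ b := by exact_mod_cast hb.le
    have hc' : (0 : ℝ) ≤ c := by exact_mod_cast hc.le
    have e1 := Real.mul_self_sqrt (mul_nonneg ha' hb')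
    have e2 := Real.mul_self_sqrt (mul_nonneg ha' hc')
    have e3 := Real.mul_self_sqrt (mul_nonneg hb' hc')
    have f1 := sqrt_mul_sqrt_mul a b c ha hb
    have f2 := sqrt_mul_sqrt_mul b a c hb ha
    have f3 := sqrt_mul_sqrt_mul c a b hc ha
    rw [mul_comm (b : ℝ) a] at f2
    rw [mul_comm (c : ℝ) a, mul_comm (c : ℝ) b] at f3
    have s1 := sgnAB_mul_self i
    have s2 := sgnAC_mul_self i
    simp only [biquad, Pi.mul_apply]
    push_cast
    generalize √(a * b : ℝ) = x at *
    generalize √(a * c : ℝ) = y at *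
    generalize √(b * c : ℝ) = z at *
    generalize sgnAB i = e at *
    generalize sgnAC i = f at *
    have g1 : (e * x) * (e * x) = a * b := by rw [mul_mul_mul_comm, s1, e1, one_mul]
    have g2 : (f * y) * (f * y) = a * c := by rw [mul_mul_mul_comm, s2, e2, one_mul]
    have g3 : (e * f * z) * (e * f * z) = b * c := by
      rw [mul_mul_mul_comm, mul_mul_mul_comm e f, s1, s2, e3, one_mul, one_mul]
    have h1 : (e * x) * (f * y) = a * (e * f * z) := by
      rw [mul_mul_mul_comm, f1]; ring
    have h2 : (e * x) * (e * f * z) = b * (f * y) := by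
      rw [mul_mul_mul_comm, ← mul_assoc e e f, s1, f2]; ring
    have h3 : (f * y) * (e * f * z) = c * (e * x) := by
      rw [mul_mul_mul_comm, mul_comm e f, ← mul_assoc f f e, s2, f3]; ring
    linear_combination (q * q' : ℝ) * g1 + (r * r' : ℝ) * g2 + (u * u' : ℝ) * g3 +
      (q * r' + r * q' : ℝ) * h1 + (q * u' + u * q' : ℝ) * h2 + (r * u' + u * r' : ℝ) * h3

/-- Square roots of `ab`, `ac`, `bc` and `1` are linearly independent. -/
lemma coeff_eq_zero (ha : 0 < a) (hb : 0 < b) (hc : 0 < c)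
    (hab : ∀ p q : ℤ, p ^ 2 = a * b * q ^ 2 → q = 0)
    (hac : ∀ p q : ℤ, p ^ 2 = a * c * q ^ 2 → q = 0)
    (hbc : ∀ p q : ℤ, p ^ 2 = b * c * q ^ 2 → q = 0) (p q r u : ℤ)
    (h : (p + q * √(a * b) + r * √(a * c) + u * √(b * c) : ℝ) = 0) :
    p = 0 ∧ q = 0 ∧ r = 0 ∧ u = 0 := by
  have ha' : (0 : ℝ) ≤ a := by exact_mod_cast ha.le
  have hb' : (0 : ℝ) ≤ b := by exact_mod_cast hb.le
  have hc' : (0 : ℝ) ≤ c := by exact_mod_cast hc.le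
  have e1 := Real.mul_self_sqrt (mul_nonneg ha' hb')
  have e2 := Real.mul_self_sqrt (mul_nonneg ha' hc')
  have e3 := Real.mul_self_sqrt (mul_nonneg hb' hc')
  have f3 := sqrt_mul_sqrt_mul c a b hc ha
  rw [mul_comm (c : ℝ) a, mul_comm (c : ℝ) b] at f3
  have key : (p ^ 2 + a * b * q ^ 2 - a * c * r ^ 2 - b * c * u ^ 2 : ℝ) +
      2 * (p * q - c * (r * u)) * √(a * b) = 0 := by
    have : (p + q * √(a * b) : ℝ) ^ 2 = (r * √(a * c) + u * √(b * c)) ^ 2 := by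
      have : (p + q * √(a * b) : ℝ) = -(r * √(a * c) + u * √(b * c)) := by linarith
      rw [this, neg_sq]
    linear_combination this + (-q ^ 2 : ℝ) * e1 + (r ^ 2 : ℝ) * e2 + (u ^ 2 : ℝ) * e3 +
      (2 * r * u : ℝ) * f3
  have hpq : p * q - c * (r * u) = 0 := by
    have h1 : (p ^ 2 + a * b * q ^ 2 - a * c * r ^ 2 - b * c * u ^ 2 : ℤ) ^ 2 =
        a * b * (2 * (p * q - c * (r * u))) ^ 2 := by
      have h2 : (p ^ 2 + a * b * q ^ 2 - a * c * r ^ 2 - b * c * u ^ 2 : ℝ) =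
        -(2 * (p * q - c * (r * u)) * √(a * b)) := by linarith
      have h3 : (p ^ 2 + a * b * q ^ 2 - a * c * r ^ 2 - b * c * u ^ 2 : ℝ) ^ 2 =
          a * b * (2 * (p * q - c * (r * u))) ^ 2 := by
        rw [h2]; linear_combination (2 * (p * q - c * (r * u)) : ℝ) ^ 2 * e1
      exact_mod_cast h3
    have := hab _ _ h1
    linarith
  have h0 : p ^ 2 + a * b * q ^ 2 - a * c * r ^ 2 - b * c * u ^ 2 = 0 := by
    have h1 : (p * q - c * (r * u) : ℝ) = 0 := by exact_mod_cast hpq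
    rw [h1] at key
    have : (p ^ 2 + a * b * q ^ 2 - a * c * r ^ 2 - b * c * u ^ 2 : ℝ) = 0 := by linarith
    exact_mod_cast this
  have hprod : (p ^ 2 - a * c * r ^ 2) * (p ^ 2 - b * c * u ^ 2) = 0 := by
    linear_combination p ^ 2 * h0 - a * b * (p * q + c * (r * u)) * hpq
  have hp : ∀ {x y k : ℤ}, x ^ 2 = k * y ^ 2 → y = 0 → x = 0 := by
    rintro x y k h rfl; simpa using h
  rcases mul_eq_zero.1 hprod with h1 | h1
  · have hr : r = 0 := hac p r (by linarith)
    have hp0 : p = 0 := hp (k := a * c) (y := r) (by linarith) hr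
    subst hr hp0
    have hu : u = 0 := hac (a * q) u (by
      have : a * q ^ 2 = c * u ^ 2 := mul_left_cancel₀ hb.ne' (by linarith)
      linear_combination a * this)
    have hq : q = 0 := by
      subst hu
      have : a * b * q ^ 2 = 0 := by linarith
      simpa [ha.ne', hb.ne'] using this
    exact ⟨rfl, hq, rfl, hu⟩
  · have hu : u = 0 := hbc p u (by linarith)
    have hp0 : p = 0 := hp (k := b * c) (y := u) (by linarith) hu
    subst hu hp0
    have hr : r = 0 := hbc (b * q) r (by
      have : b * q ^ 2 = c * r ^ 2 := mul_left_cancel₀ ha.ne' (by linarith)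
      linear_combination b * this)
    have hq : q = 0 := by
      subst hr
      have : a * b * q ^ 2 = 0 := by linarith
      simpa [ha.ne', hb.ne'] using this
    exact ⟨rfl, hq, hr, rfl⟩

/-- Liouville's inequality: a nonzero integer of the biquadratic ring has norm at least one. -/
lemma one_le_prod_abs (ha : 0 < a) (hb : 0 < b) (hc : 0 < c)
    (hab : ∀ p q : ℤ, p ^ 2 = a * b * q ^ 2 → q = 0)
    (hac : ∀ p q : ℤ, p ^ 2 = a * c * q ^ 2 → q = 0)
    (hbc : ∀ p q : ℤ, p ^ 2 = b * c * q ^ 2 → q = 0)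
    {f : Fin 4 → ℝ} (hf : f ∈ biquadRing a b c ha hb hc) (h0 : f 0 ≠ 0) :
    1 ≤ ∏ i, |f i| := by
  obtain ⟨p, q, r, u, rfl⟩ := hf
  have ha' : (0 : ℝ) ≤ a := by exact_mod_cast ha.le
  have hb' : (0 : ℝ) ≤ b := by exact_mod_cast hb.le
  have hc' : (0 : ℝ) ≤ c := by exact_mod_cast hc.le
  have e1 := Real.mul_self_sqrt (mul_nonneg ha' hb')
  have e2 := Real.mul_self_sqrt (mul_nonneg ha' hc')
  have e3 := Real.mul_self_sqrt (mul_nonneg hb' hc')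
  have f3 := sqrt_mul_sqrt_mul c a b hc ha
  rw [mul_comm (c : ℝ) a, mul_comm (c : ℝ) b] at f3
  have hne : ∏ i, biquad a b c p q r u i ≠ 0 := by
    refine Finset.prod_ne_zero_iff.2 fun i _ hi => h0 ?_
    have key : p = 0 ∧ q = 0 ∧ r = 0 ∧ u = 0 := by
      have := coeff_eq_zero ha hb hc hab hac hbc
      fin_cases i
      · exact this p q r u (by simpa [biquad, sgnAB, sgnAC] using hi)
      · have := this p q (-r) (-u) (by push_cast; simpa [biquad, sgnAB, sgnAC] using hi)
        omega
      · have := this p (-q) r (-u) (by push_cast; simpa [biquad, sgnAB, sgnAC] using hi)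
        omega
      · have := this p (-q) (-r) u (by push_cast; simpa [biquad, sgnAB, sgnAC] using hi)
        omega
    obtain ⟨rfl, rfl, rfl, rfl⟩ := key
    simp [biquad]
  have hnorm : ∏ i, biquad a b c p q r u i =
      (((p ^ 2 + a * b * q ^ 2 - a * c * r ^ 2 - b * c * u ^ 2) ^ 2 -
        4 * (a * b) * (p * q - c * (r * u)) ^ 2 : ℤ) : ℝ) := by
    have e0 : (p + q * √(a * b) + (r * √(a * c) + u * √(b * c)) : ℝ) *
        (p + q * √(a * b) - (r * √(a * c) + u * √(b * c))) =
        (p ^ 2 + a * b * q ^ 2 - a * c * r ^ 2 - b * c * u ^ 2) +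
          2 * (p * q - c * (r * u)) * √(a * b) := by
      linear_combination (q ^ 2 : ℝ) * e1 - (r ^ 2 : ℝ) * e2 - (u ^ 2 : ℝ) * e3 -
        (2 * r * u : ℝ) * f3
    have e0' : (p - q * √(a * b) + (r * √(a * c) - u * √(b * c)) : ℝ) *
        (p - q * √(a * b) - (r * √(a * c) - u * √(b * c))) =
        (p ^ 2 + a * b * q ^ 2 - a * c * r ^ 2 - b * c * u ^ 2) -
          2 * (p * q - c * (r * u)) * √(a * b) := by
      linear_combination (q ^ 2 : ℝ) * e1 - (r ^ 2 : ℝ) * e2 - (u ^ 2 : ℝ) * e3 +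
        (2 * r * u : ℝ) * f3
    have : ∏ i, biquad a b c p q r u i =
        ((p + q * √(a * b) + (r * √(a * c) + u * √(b * c)) : ℝ) *
        (p + q * √(a * b) - (r * √(a * c) + u * √(b * c)))) *
        ((p - q * √(a * b) + (r * √(a * c) - u * √(b * c)) : ℝ) *
        (p - q * √(a * b) - (r * √(a * c) - u * √(b * c)))) := by
      simp [Fin.prod_univ_four, biquad, sgnAB, sgnAC]; ring
    rw [this, e0, e0']
    push_cast
    linear_combination (-4 * (p * q - c * (r * u)) ^ 2 : ℝ) * e1
  rw [← Finset.abs_prod, hnorm]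
  rw [hnorm] at hne
  exact_mod_cast Int.one_le_abs (by exact_mod_cast hne)

end biquad

lemma abs_det_le_of_row_bound {n : Type*} [Fintype n] [DecidableEq n] (A : Matrix n n ℝ)
    (B : n → ℝ) (h : ∀ i j, |A i j| ≤ B i) :
    |A.det| ≤ (Fintype.card n).factorial * ∏ i, B i := by
  rw [← Matrix.det_transpose, Matrix.det_apply]
  refine (Finset.abs_sum_le_sum_abs _ _).trans ?_
  have : ∀ σ ∈ (Finset.univ : Finset (Equiv.Perm n)),
      |Equiv.Perm.sign σ • ∏ i, A.transpose (σ i) i| ≤ ∏ i, B i := by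
    intro σ _
    rw [Units.smul_def, abs_zsmul, ← Int.cast_smul_eq_zsmul ℤ]
    have hs : |((Equiv.Perm.sign σ : ℤˣ) : ℤ)| = 1 := by
      rcases Int.units_eq_one_or (Equiv.Perm.sign σ) with h | h <;> simp [h]
    rw [hs]
    simp only [Int.cast_one, one_smul, Finset.abs_prod]
    exact Finset.prod_le_prod (fun _ _ => abs_nonneg _) fun i _ => h i (σ i)
  refine (Finset.sum_le_sum this).trans ?_
  simp [Fintype.card_perm]

/-- The order of vanishing attached to a term of the expansion of a row; `none` is the error. -/
def termOrder {M : ℕ} : Option (Fin M) → ℕ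
  | none => M
  | some n => n

lemma sum_range_le_sum_termOrder {M : ℕ} (f : Fin M → Option (Fin M))
    (hf : ∀ i j n, f i = some n → f j = some n → i = j) :
    ∑ n ∈ Finset.range M, n ≤ ∑ i, termOrder (f i) := by
  classical
  set Q := Finset.univ.filter fun i => f i ≠ none with hQ
  set O := Q.image f with hO
  set X := (Finset.univ : Finset (Fin M)).map Function.Embedding.some with hX
  have hinj : Set.InjOn f Q := by
    intro i hi j hj hij
    obtain ⟨n, hn⟩ := Option.ne_none_iff_exists'.1 (Finset.mem_filter.1 hi).2
    exact hf i j n hn (hij ▸ hn)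
  have hOX : O ⊆ X := by
    intro o ho
    obtain ⟨i, hi, rfl⟩ := Finset.mem_image.1 ho
    obtain ⟨n, hn⟩ := Option.ne_none_iff_exists'.1 (Finset.mem_filter.1 hi).2
    simp [hX, hn]
  have h1 : ∑ n ∈ Finset.range M, n = ∑ o ∈ X, termOrder o := by
    rw [hX, Finset.sum_map, ← Fin.sum_univ_eq_sum_range (fun n => n)]
    rfl
  have h2 : ∑ i, termOrder (f i) = ∑ o ∈ O, termOrder o + (M - Q.card) * M := by
    rw [hO, Finset.sum_image hinj, ← Finset.sum_add_sum_compl Q]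
    congr 1
    have : ∀ i ∈ Qᶜ, termOrder (f i) = M := by
      intro i hi
      have : f i = none := by simpa [hQ] using hi
      rw [this]; rfl
    rw [Finset.sum_congr rfl this, Finset.sum_const, Finset.card_compl]
    simp
  have h3 : (X \ O).card = M - Q.card := by
    rw [Finset.card_sdiff_of_subset hOX, hO, Finset.card_image_of_injOn hinj]
    simp [hX]
  rw [h1, h2, ← Finset.sum_sdiff hOX, add_comm, ← h3]
  refine Nat.add_le_add_left ?_ _
  rw [← smul_eq_mul]
  refine Finset.sum_le_card_nsmul _ _ _ fun o ho => ?_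
  obtain ⟨n, -, rfl⟩ := Finset.mem_map.1 (Finset.mem_sdiff.1 ho).1
  exact n.2.le

/-- Upper bound for an interpolation determinant: the rows are polynomials in the nodes, up to
a small error. -/
lemma abs_interpolation_det_le {M : ℕ} (w : Matrix (Fin M) (Fin M) ℝ) (x : Fin M → ℝ)
    (c : Fin M → Fin M → ℝ) (G F : Fin M → ℝ) {E Z : ℝ} (hE : 1 ≤ E) (hx : ∀ j, |x j| ≤ Z)
    (hw : ∀ i j, |w i j - ∑ n : Fin M, c i n * x j ^ (n : ℕ)| ≤ G i)
    (hF : ∀ i, ∑ n : Fin M, |c i n| * (E * Z) ^ (n : ℕ) + E ^ M * G i ≤ F i) :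
    |w.det| * E ^ (∑ n ∈ Finset.range M, n) ≤ M.factorial * ∏ i, F i := by
  classical
  have hE0 : 0 < E := by linarith
  rcases Nat.eq_zero_or_pos M with rfl | hM
  · simp
  have hZ : 0 ≤ Z := (abs_nonneg _).trans (hx ⟨0, hM⟩)
  have hG : ∀ i, 0 ≤ G i := fun i => (abs_nonneg _).trans (hw i ⟨0, hM⟩)
  let sc : Fin M → Option (Fin M) → ℝ := fun i o => o.elim 1 fun n => c i n
  let v : Fin M → Option (Fin M) → Fin M → ℝ := fun i o =>
    o.elim (fun j => w i j - ∑ n : Fin M, c i n * x j ^ (n : ℕ)) fun n j => x j ^ (n : ℕ)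
  let B : Fin M → Option (Fin M) → ℝ := fun i o => o.elim (G i) fun n => Z ^ (n : ℕ)
  let H : Fin M → Option (Fin M) → ℝ := fun i o =>
    o.elim (E ^ M * G i) fun n => |c i n| * (E * Z) ^ (n : ℕ)
  have hwsum : w = fun i => ∑ o : Option (Fin M), sc i o • v i o := by
    funext i; funext j
    simp [sc, v, Fintype.sum_option, Finset.sum_apply]
  have hdet : w.det = ∑ f : Fin M → Option (Fin M),
      Matrix.det (fun i => sc i (f i) • v i (f i)) := by
    have := (Matrix.detRowAlternating (n := Fin M) (R := ℝ)).toMultilinearMap.map_sum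
      (fun i o => sc i o • v i o)
    rw [hwsum]
    exact this
  have hterm : ∀ f : Fin M → Option (Fin M),
      |Matrix.det (fun i => sc i (f i) • v i (f i))| * E ^ (∑ n ∈ Finset.range M, n) ≤
        M.factorial * ∏ i, H i (f i) := by
    intro f
    have hH : ∀ i, H i (f i) = |sc i (f i)| * B i (f i) * E ^ termOrder (f i) := by
      intro i
      rcases f i with _ | n
      · simp [H, sc, B, termOrder, mul_comm]
      · simp [H, sc, B, termOrder, mul_pow]; ring
    have hB : ∀ i o, 0 ≤ B i o := by
      intro i o
      rcases o with _ | n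
      · exact hG i
      · exact pow_nonneg hZ _
    have hrhs : 0 ≤ ∏ i, H i (f i) := Finset.prod_nonneg fun i _ => by
      rw [hH]; have := hB i (f i); positivity
    by_cases hf : ∀ i j n, f i = some n → f j = some n → i = j
    · have h1 := abs_det_le_of_row_bound (fun i => sc i (f i) • v i (f i))
        (fun i => |sc i (f i)| * B i (f i)) (by
          intro i j
          simp only [Pi.smul_apply, smul_eq_mul, abs_mul]
          refine mul_le_mul_of_nonneg_left ?_ (abs_nonneg _)
          rcases f i with _ | n
          · exact hw i j
          · simp only [v, B, Option.elim, abs_pow]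
            exact pow_le_pow_left₀ (abs_nonneg _) (hx j) _)
      rw [Fintype.card_fin] at h1
      have h2 := pow_le_pow_right₀ hE (sum_range_le_sum_termOrder f hf)
      calc _ ≤ (M.factorial * ∏ i, |sc i (f i)| * B i (f i)) * E ^ (∑ i, termOrder (f i)) := by
            refine mul_le_mul h1 h2 (by positivity) ?_
            exact (abs_nonneg _).trans h1
        _ = _ := by
            rw [← Finset.prod_pow_eq_pow_sum, mul_assoc, ← Finset.prod_mul_distrib]
            simp_rw [hH]
    · push Not at hf
      obtain ⟨i, j, n, hi, hj, hij⟩ := hf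
      have : Matrix.det (fun i => sc i (f i) • v i (f i)) = 0 := by
        have h1 := Matrix.det_mul_column (fun i => sc i (f i)) (Matrix.of fun i => v i (f i))
        have h2 : (Matrix.of fun i => v i (f i)).det = 0 :=
          Matrix.det_zero_of_row_eq hij (by funext k; simp [v, hi, hj])
        rw [h2, mul_zero] at h1
        exact h1
      rw [this]
      simpa using mul_nonneg (Nat.cast_nonneg _) hrhs
  calc |w.det| * E ^ (∑ n ∈ Finset.range M, n)
      ≤ ∑ f : Fin M → Option (Fin M), |Matrix.det (fun i => sc i (f i) • v i (f i))| *
          E ^ (∑ n ∈ Finset.range M, n) := by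
        rw [hdet, ← Finset.sum_mul]
        exact mul_le_mul_of_nonneg_right (Finset.abs_sum_le_sum_abs _ _) (by positivity)
    _ ≤ ∑ f : Fin M → Option (Fin M), M.factorial * ∏ i, H i (f i) :=
        Finset.sum_le_sum fun f _ => hterm f
    _ = M.factorial * ∏ i, ∑ o, H i o := by
        rw [← Finset.mul_sum, Finset.prod_univ_sum, Fintype.piFinset_univ]
    _ ≤ _ := by
        refine mul_le_mul_of_nonneg_left (Finset.prod_le_prod ?_ ?_) (Nat.cast_nonneg _)
        · intro i _
          refine Finset.sum_nonneg fun o _ => ?_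
          rcases o with _ | n
          · have := hG i; simp only [H, Option.elim]; positivity
          · simp only [H, Option.elim]; positivity
        · intro i _
          rw [Fintype.sum_option, add_comm]
          exact hF i

/-- `φ` has a power series whose coefficients have weighted sum at most `F` at radius `R`. -/
def HasExpansion (φ : ℝ → ℝ) (R F : ℝ) : Prop :=
  ∃ c : ℕ → ℝ, Summable (fun n => |c n| * R ^ n) ∧ ∑' n, |c n| * R ^ n ≤ F ∧
    ∀ z, |z| ≤ R → HasSum (fun n => c n * z ^ n) (φ z)

lemma hasExpansion_exp (β : ℝ) {R : ℝ} : HasExpansion (fun z => Real.exp (β * z)) R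
    (Real.exp (|β| * R)) := by
  have key : ∀ y : ℝ, HasSum (fun n : ℕ => y ^ n / n.factorial) (Real.exp y) := by
    intro y
    have := NormedSpace.expSeries_div_hasSum_exp y
    rwa [← Real.exp_eq_exp_ℝ] at this
  have h1 : (fun n : ℕ => |β ^ n / n.factorial| * R ^ n) =
      fun n : ℕ => (|β| * R) ^ n / n.factorial := by
    funext n
    rw [abs_div, abs_pow, Nat.abs_cast, mul_pow]; ring
  refine ⟨fun n => β ^ n / n.factorial, ?_, ?_, ?_⟩
  · rw [h1]; exact (key _).summable
  · rw [h1]; exact (key _).tsum_eq.le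
  · intro z _
    convert key (β * z) using 2 with n
    rw [mul_pow]; ring

lemma HasExpansion.linear_mul {φ : ℝ → ℝ} {R F A a : ℝ} (hR : 0 ≤ R) (ha : |a| ≤ A)
    (h : HasExpansion φ R F) : HasExpansion (fun z => (z + a) * φ z) R ((R + A) * F) := by
  obtain ⟨c, hs, hF, hc⟩ := h
  set sh : ℕ → ℝ := fun n => Nat.casesOn n 0 c with hsh
  have hsh0 : sh 0 = 0 := rfl
  have hsh1 : ∀ n, sh (n + 1) = c n := fun n => rfl
  have hsum : HasSum (fun n => |sh n| * R ^ n) (R * ∑' n, |c n| * R ^ n) := by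
    rw [← hasSum_nat_add_iff' 1]
    simp only [hsh1, Finset.range_one, Finset.sum_singleton, hsh0, abs_zero, zero_mul, sub_zero]
    have e : (fun n => |c n| * R ^ (n + 1)) = fun n => R * (|c n| * R ^ n) := by
      funext n; ring
    rw [e]; exact hs.hasSum.mul_left R
  have hle : ∀ n, |sh n + a * c n| * R ^ n ≤ |sh n| * R ^ n + |a| * (|c n| * R ^ n) := by
    intro n
    have := abs_add_le (sh n) (a * c n)
    rw [abs_mul] at this
    nlinarith [pow_nonneg hR n]
  have hs2 := hsum.add (hs.hasSum.mul_left |a|)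
  have hs1 : Summable (fun n => |sh n + a * c n| * R ^ n) :=
    Summable.of_nonneg_of_le (fun n => by positivity) hle hs2.summable
  have hnn : 0 ≤ ∑' n, |c n| * R ^ n := tsum_nonneg fun n => by positivity
  refine ⟨fun n => sh n + a * c n, hs1, ?_, ?_⟩
  · refine (hs1.tsum_le_tsum hle hs2.summable).trans ?_
    rw [hs2.tsum_eq]
    have : 0 ≤ A := (abs_nonneg _).trans ha
    nlinarith
  · intro z hz
    have h1 : HasSum (fun n => sh n * z ^ n) (z * φ z) := by
      rw [← hasSum_nat_add_iff' 1]
      simp only [hsh1, Finset.range_one, Finset.sum_singleton, hsh0, zero_mul, sub_zero]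
      have e : (fun n => c n * z ^ (n + 1)) = fun n => z * (c n * z ^ n) := by
        funext n; ring
      rw [e]; exact (hc z hz).mul_left z
    have e : (fun n => (sh n + a * c n) * z ^ n) = fun n => sh n * z ^ n + a * (c n * z ^ n) := by
      funext n; ring
    rw [e, show (fun z => (z + a) * φ z) z = z * φ z + a * φ z from add_mul _ _ _]
    exact h1.add ((hc z hz).mul_left a)

lemma HasExpansion.const_mul {φ : ℝ → ℝ} {R F a : ℝ} (ha : 0 ≤ a)
    (h : HasExpansion φ R F) : HasExpansion (fun z => a * φ z) R (a * F) := by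
  obtain ⟨c, hs, hF, hc⟩ := h
  have h1 : (fun n => |a * c n| * R ^ n) = fun n => a * (|c n| * R ^ n) := by
    funext n; rw [abs_mul, abs_of_nonneg ha, mul_assoc]
  refine ⟨fun n => a * c n, ?_, ?_, fun z hz => ?_⟩
  · rw [h1]; exact hs.mul_left a
  · rw [h1, tsum_mul_left]; exact mul_le_mul_of_nonneg_left hF ha
  · simp only [mul_assoc]; exact (hc z hz).mul_left a

lemma hasExpansion_prod_mul_exp (β : ℝ) {R A : ℝ} (hR : 0 ≤ R) (k : ℕ) (a : ℕ → ℝ)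
    (ha : ∀ i < k, |a i| ≤ A) :
    HasExpansion (fun z => (∏ i ∈ Finset.range k, (z + a i)) * Real.exp (β * z)) R
      ((R + A) ^ k * Real.exp (|β| * R)) := by
  induction k with
  | zero => simpa using hasExpansion_exp β
  | succ k ih =>
    have := (ih fun i hi => ha i (by omega)).linear_mul hR (ha k (by omega))
    convert this using 1
    · funext z; rw [Finset.prod_range_succ]; ring
    · rw [pow_succ]; ring

/-- Truncation of an expansion at order `M` on the disc of radius `Z`. -/
lemma HasExpansion.exists_truncation {φ : ℝ → ℝ} {E Z F : ℝ} (hE : 1 ≤ E) (hZ : 0 ≤ Z)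
    (h : HasExpansion φ (E * Z) F) (M : ℕ) :
    ∃ (c : Fin M → ℝ) (G : ℝ), (∀ z, |z| ≤ Z → |φ z - ∑ n : Fin M, c n * z ^ (n : ℕ)| ≤ G) ∧
      (∑ n : Fin M, |c n| * (E * Z) ^ (n : ℕ)) + E ^ M * G ≤ F := by
  obtain ⟨c, hs, hF, hc⟩ := h
  have hE0 : 0 < E := by linarith
  have hs' : Summable fun n => |c (n + M)| * (E * Z) ^ (n + M) :=
    (summable_nat_add_iff (f := fun n => |c n| * (E * Z) ^ n) M).2 hs
  refine ⟨fun n => c n, (E ^ M)⁻¹ * ∑' n, |c (n + M)| * (E * Z) ^ (n + M), ?_, ?_⟩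
  · intro z hz
    have hz' : |z| ≤ E * Z := hz.trans (le_mul_of_one_le_left hZ hE)
    have h1 := (hasSum_nat_add_iff' M).2 (hc z hz')
    rw [Fin.sum_univ_eq_sum_range (fun n => c n * z ^ n)]
    rw [← h1.tsum_eq, ← Real.norm_eq_abs]
    refine tsum_of_norm_bounded (hs'.hasSum.mul_left (E ^ M)⁻¹) fun n => ?_
    rw [Real.norm_eq_abs, abs_mul, abs_pow]
    have h2 : |z| ^ (n + M) ≤ Z ^ (n + M) := pow_le_pow_left₀ (abs_nonneg _) hz _
    have h3 : Z ^ (n + M) ≤ (E ^ M)⁻¹ * (E * Z) ^ (n + M) := by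
      rw [inv_mul_eq_div, le_div_iff₀ (by positivity), mul_pow, pow_add E, mul_comm]
      have : 1 ≤ E ^ n := one_le_pow₀ hE
      have : 0 ≤ E ^ M * Z ^ (n + M) := by positivity
      nlinarith
    calc _ ≤ |c (n + M)| * ((E ^ M)⁻¹ * (E * Z) ^ (n + M)) :=
          mul_le_mul_of_nonneg_left (h2.trans h3) (abs_nonneg _)
      _ = _ := by ring
  · rw [mul_inv_cancel_left₀ (by positivity),
      Fin.sum_univ_eq_sum_range (fun n => |c n| * (E * Z) ^ n), hs.sum_add_tsum_nat_add]
    exact hF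

lemma exists_minor_ne_zero {n m : Type*} [Fintype n] [DecidableEq n] (W : Matrix n m ℝ)
    (h : ∀ c : n → ℝ, (∀ j, ∑ i, c i * W i j = 0) → c = 0) :
    ∃ g : n → m, (W.submatrix id g).det ≠ 0 := by
  obtain ⟨κ, f, hf, hsp, hli⟩ := exists_linearIndependent' ℝ (fun j i => W i j)
  have htop : Submodule.span ℝ (Set.range (fun j i => W i j)) = ⊤ := by
    by_contra hne
    obtain ⟨φ, hφ0, hφ⟩ := Submodule.exists_le_ker_of_lt_top _ (lt_top_iff_ne_top.2 hne)
    refine hφ0 ?_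
    have h1 : (fun i => φ (Pi.single i 1)) = 0 := by
      refine h _ fun j => ?_
      have h2 : φ (fun i => W i j) = 0 := hφ (Submodule.subset_span ⟨j, rfl⟩)
      rw [← h2]
      conv_rhs => rw [← Finset.univ_sum_single (fun i => W i j), map_sum]
      refine Finset.sum_congr rfl fun i _ => ?_
      have h3 : (Pi.single i (W i j) : n → ℝ) = W i j • Pi.single i 1 := by
        rw [← Pi.single_smul, smul_eq_mul, mul_one]
      rw [h3, map_smul, smul_eq_mul, mul_comm]
    refine LinearMap.pi_ext' fun i => LinearMap.ext_ring ?_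
    simpa using congrFun h1 i
  rw [htop] at hsp
  have hb := Module.Basis.mk hli hsp.ge
  have : Finite κ := Module.Finite.finite_basis hb
  have := Fintype.ofFinite κ
  have hcard : Fintype.card n = Fintype.card κ := by
    rw [← Module.finrank_eq_card_basis hb, Module.finrank_fintype_fun_eq_card]
  let e := Fintype.equivOfCardEq hcard
  refine ⟨f ∘ e, ?_⟩
  have h1 : LinearIndependent ℝ (W.submatrix id (f ∘ e)).col :=
    hli.comp e e.injective
  rw [Matrix.linearIndependent_cols_iff_isUnit, Matrix.isUnit_iff_isUnit_det] at h1
  exact h1.ne_zero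

open Polynomial in
lemma tendsto_eval_add_div_eval (A : ℝ[X]) (hA : A ≠ 0) (i : ℝ) :
    Filter.Tendsto (fun x => A.eval (x + i) / A.eval x) Filter.atTop (nhds 1) := by
  have hd : (A.comp (X + C i)).natDegree = A.natDegree := by simp [natDegree_comp]
  have hl : (A.comp (X + C i)).leadingCoeff = A.leadingCoeff := by
    rw [leadingCoeff_comp (by simp), leadingCoeff_X_add_C]; simp
  have hne : A.comp (X + C i) ≠ 0 := by
    rw [← leadingCoeff_ne_zero, hl]; exact leadingCoeff_ne_zero.2 hA
  have := div_tendsto_atTop_leadingCoeff_div_of_degree_eq (A.comp (X + C i)) A (by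
    rw [degree_eq_natDegree hne, degree_eq_natDegree hA, hd])
  rw [hl, div_self (leadingCoeff_ne_zero.2 hA)] at this
  simpa using this

open Polynomial in
/-- Zero estimate for polynomials in `z` and a function multiplied by `α` under `z ↦ z + 1`. -/
lemma poly_eq_zero_of_zeros {L R S q D : ℕ} {α : ℝ} (hα : 0 < α) (hα1 : α ≠ 1)
    (A : Fin L → ℝ[X]) (hD : ∀ j, (A j).natDegree ≤ D) (w : ℕ → ℕ → ℝ)
    (hw : ∀ r s i, w (r + i) s = α ^ i * w r s) (hw0 : ∀ r s, w r s ≠ 0)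
    (hRq : R ≤ q) (hcard : D * L < R * S)
    (h : ∀ r s, r + 1 < R + L → s < S → ∑ j, (A j).eval ((r : ℝ) + s * q) * w r s ^ (j : ℕ) = 0) :
    ∀ j, A j = 0 := by
  classical
  by_contra! hne
  obtain ⟨j₀, hj₀⟩ := hne
  let T := {j : Fin L // A j ≠ 0}
  obtain ⟨n, hn⟩ : ∃ n, Fintype.card T = n := ⟨_, rfl⟩
  let e : Fin n ≃ T := (Fintype.equivFinOfCardEq hn).symm
  have hnL : n ≤ L := by
    rw [← hn]; exact (Fintype.card_subtype_le _).trans (by simp)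
  have hn0 : 0 < n := by rw [← hn]; exact Fintype.card_pos_iff.2 ⟨⟨j₀, hj₀⟩⟩
  let Q : Matrix (Fin n) (Fin n) ℝ[X] := Matrix.of fun i j =>
    C (α ^ ((i : ℕ) * ((e j).1 : ℕ))) * (A (e j).1).comp (X + C (i : ℝ))
  have hQe : ∀ x : ℝ, Q.det.eval x = (Matrix.of fun i j : Fin n =>
      α ^ ((i : ℕ) * ((e j).1 : ℕ)) * (A (e j).1).eval (x + i)).det := by
    intro x
    rw [← coe_evalRingHom, RingHom.map_det]
    congr 1
    ext i j
    simp [Q]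
  have hdeg : Q.det.natDegree ≤ D * L := by
    rw [Matrix.det_apply]
    refine natDegree_sum_le_of_forall_le _ _ fun σ _ => ?_
    refine (natDegree_smul_le _ _).trans ?_
    refine (natDegree_prod_le _ _).trans ?_
    calc ∑ i, (Q (σ i) i).natDegree ≤ ∑ i : Fin n, D := by
          refine Finset.sum_le_sum fun i _ => ?_
          have h1 : (Q (σ i) i).natDegree ≤
              ((A (e i).1).comp (X + C ((σ i : ℕ) : ℝ))).natDegree := natDegree_C_mul_le _ _
          refine h1.trans ?_
          rw [natDegree_comp, natDegree_X_add_C, mul_one]; exact hD _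
      _ = n * D := by simp
      _ ≤ D * L := by rw [mul_comm]; exact Nat.mul_le_mul_left _ hnL
  have hzero : ∀ r < R, ∀ s < S, Q.det.eval ((r : ℝ) + s * q) = 0 := by
    intro r hr s hs
    rw [hQe, ← Matrix.exists_mulVec_eq_zero_iff]
    refine ⟨fun j => w r s ^ ((e j).1 : ℕ), ?_, ?_⟩
    · intro h0
      exact pow_ne_zero _ (hw0 r s) (congrFun h0 ⟨0, hn0⟩)
    · funext i
      have h1 := h (r + i) s (by have := i.2; omega) hs
      have h2 : ∑ j, (A j).eval (((r + i : ℕ) : ℝ) + s * q) * w (r + i) s ^ (j : ℕ) =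
          ∑ j : T, (A j.1).eval (((r + i : ℕ) : ℝ) + s * q) * w (r + i) s ^ (j.1 : ℕ) := by
        rw [← Finset.sum_subtype (Finset.univ.filter fun j => A j ≠ 0) (by simp)
          (fun j => (A j).eval (((r + i : ℕ) : ℝ) + s * q) * w (r + i) s ^ (j : ℕ))]
        symm
        apply Finset.sum_filter_of_ne
        intro j _ hj h0
        apply hj
        rw [h0, eval_zero, zero_mul]
      rw [h2, ← e.sum_comp] at h1
      simp only [Matrix.mulVec, dotProduct, Matrix.of_apply, Pi.zero_apply]
      rw [← h1]
      refine Finset.sum_congr rfl fun j _ => ?_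
      rw [hw, mul_pow, ← pow_mul]
      push_cast
      rw [show (r : ℝ) + i + s * q = r + s * q + i by ring]
      ring
  have hQ0 : Q.det = 0 := by
    have hinj : Function.Injective fun p : Fin R × Fin S => ((p.1 : ℕ) : ℝ) + (p.2 : ℕ) * q := by
      rintro ⟨r, s⟩ ⟨r', s'⟩ hp
      have hp' : (r : ℕ) + s * q = r' + s' * q := by
        simp only at hp
        exact_mod_cast hp
      have hr := r.2
      have hr' := r'.2
      have h1 : (s : ℕ) = s' := by
        have : ((r : ℕ) + s * q) / q = ((r' : ℕ) + s' * q) / q := congrArg (· / q) hp'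
        rwa [Nat.add_mul_div_right _ _ (by omega), Nat.add_mul_div_right _ _ (by omega),
          Nat.div_eq_of_lt (by omega), Nat.div_eq_of_lt (by omega), zero_add, zero_add] at this
      have h2 : (r : ℕ) = r' := by rw [h1] at hp'; omega
      ext <;> assumption
    refine eq_zero_of_natDegree_lt_card_of_eval_eq_zero _ hinj ?_ ?_
    · rintro ⟨r, s⟩
      exact hzero r r.2 s s.2
    · simpa using hdeg.trans_lt hcard
  have hlim : Filter.Tendsto (fun x : ℝ => (Matrix.of fun i j : Fin n =>
      α ^ ((i : ℕ) * ((e j).1 : ℕ)) * ((A (e j).1).eval (x + i) / (A (e j).1).eval x)).det)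
      Filter.atTop (nhds (Matrix.of fun i j : Fin n => α ^ ((i : ℕ) * ((e j).1 : ℕ))).det) := by
    refine (Continuous.matrix_det continuous_id).continuousAt.tendsto.comp ?_
    refine tendsto_pi_nhds.2 fun i => tendsto_pi_nhds.2 fun j => ?_
    simpa using (tendsto_eval_add_div_eval _ (e j).2 (i : ℝ)).const_mul
      (α ^ ((i : ℕ) * ((e j).1 : ℕ)))
  have hev : ∀ x : ℝ, (Matrix.of fun i j : Fin n =>
      α ^ ((i : ℕ) * ((e j).1 : ℕ)) * ((A (e j).1).eval (x + i) / (A (e j).1).eval x)).det = 0 := by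
    intro x
    have h1 := Matrix.det_mul_row (fun j => ((A (e j).1).eval x)⁻¹) (Matrix.of fun i j : Fin n =>
      α ^ ((i : ℕ) * ((e j).1 : ℕ)) * (A (e j).1).eval (x + i))
    rw [← hQe, hQ0, eval_zero, mul_zero] at h1
    rw [← h1]
    congr 1
    ext i j
    simp only [Matrix.of_apply]
    ring
  have hvan : (Matrix.of fun i j : Fin n => α ^ ((i : ℕ) * ((e j).1 : ℕ))).det ≠ 0 := by
    rw [← Matrix.det_transpose]
    have : (Matrix.of fun i j : Fin n => α ^ ((i : ℕ) * ((e j).1 : ℕ))).transpose =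
        Matrix.vandermonde fun i : Fin n => α ^ ((e i).1 : ℕ) := by
      ext i j
      simp [Matrix.vandermonde, ← pow_mul, mul_comm]
    rw [this, Matrix.det_vandermonde_ne_zero_iff]
    intro i j hij
    have := pow_right_injective₀ hα hα1 hij
    exact e.injective (Subtype.ext (Fin.ext this))
  simp only [hev] at hlim
  exact hvan (tendsto_nhds_unique hlim tendsto_const_nhds)

open Polynomial in
/-- The zero estimate in the binomial basis. -/
lemma coeff_eq_zero_of_zeros {K L R S q : ℕ} {α : ℝ} (hα : 0 < α) (hα1 : α ≠ 1)
    (c : Fin K → Fin L → ℝ) (w : ℕ → ℕ → ℝ)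
    (hw : ∀ r s i, w (r + i) s = α ^ i * w r s) (hw0 : ∀ r s, w r s ≠ 0)
    (hRq : R ≤ q) (hcard : (K - 1) * L < R * S)
    (h : ∀ r s, r + 1 < R + L → s < S →
      ∑ k, ∑ j, c k j * ((r + s * q).choose k * w r s ^ (j : ℕ)) = 0) : c = 0 := by
  let A : Fin L → ℝ[X] := fun j => ∑ k, C (c k j / (k : ℕ).factorial) * descPochhammer ℝ k
  have hAe : ∀ j (n : ℕ), (A j).eval (n : ℝ) = ∑ k, c k j * n.choose k := by
    intro j n
    rw [eval_finsetSum]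
    refine Finset.sum_congr rfl fun k _ => ?_
    rw [eval_mul, eval_C, descPochhammer_eval_eq_descFactorial,
      Nat.descFactorial_eq_factorial_mul_choose]
    have : ((k : ℕ).factorial : ℝ) ≠ 0 := by positivity
    push_cast
    field_simp
  have hA : ∀ j, A j = 0 := by
    refine poly_eq_zero_of_zeros (R := R) (S := S) (q := q) (D := K - 1) hα hα1 A ?_ w hw hw0 hRq
      hcard ?_
    · intro j
      refine natDegree_sum_le_of_forall_le _ _ fun k _ => ?_
      refine (natDegree_C_mul_le _ _).trans ?_
      rw [descPochhammer_natDegree]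
      have := k.2; omega
    · intro r s hr hs
      rw [← h r s hr hs, Finset.sum_comm]
      refine Finset.sum_congr rfl fun j _ => ?_
      have := hAe j (r + s * q)
      push_cast at this
      rw [this, Finset.sum_mul]
      exact Finset.sum_congr rfl fun k _ => by ring
  funext k j
  obtain ⟨k, hk⟩ := k
  induction k using Nat.strong_induction_on with
  | _ k ih =>
    have h1 := hAe j k
    rw [hA, eval_zero, Finset.sum_eq_single (⟨k, hk⟩ : Fin K)] at h1
    · simpa using h1.symm
    · rintro ⟨i, hi⟩ - hne
      rcases lt_trichotomy i k with hlt | rfl | hlt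
      · rw [ih i hlt hi]; simp
      · exact absurd rfl hne
      · simp [Nat.choose_eq_zero_of_lt hlt]
    · simp

lemma zpow_le_exp_abs_log {x : ℝ} (hx : 0 < x) {e : ℤ} {δ : ℕ} (he : |e| ≤ δ) :
    x ^ e ≤ Real.exp (δ * |Real.log x|) := by
  rw [← Real.exp_log (zpow_pos hx e), Real.log_zpow, Real.exp_le_exp]
  refine (le_abs_self _).trans ?_
  rw [abs_mul]
  refine mul_le_mul_of_nonneg_right ?_ (abs_nonneg _)
  exact_mod_cast he

lemma prod_zpow_eq_zpow_sum {P : Type*} (s : Finset P) {x : ℝ} (hx : x ≠ 0) (f : P → ℤ) :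
    ∏ p ∈ s, x ^ f p = x ^ ∑ p ∈ s, f p := by
  classical
  induction s using Finset.induction_on with
  | empty => simp
  | insert p s hp ih => rw [Finset.prod_insert hp, Finset.sum_insert hp, zpow_add₀ hx, ih]

/-- Arithmetic lower bound for an interpolation determinant with entries in a ring satisfying
Liouville's inequality. -/
lemma one_le_abs_det_mul {P : Type*} [Fintype P] [DecidableEq P] (S : Subring (Fin 4 → ℝ))
    (hS : ∀ f ∈ S, f 0 ≠ 0 → 1 ≤ ∏ i, |f i|)
    {X U A B : Fin 4 → ℝ} (hX : X ∈ S) (hX' : X⁻¹ ∈ S) (hU : U ∈ S) (hU' : U⁻¹ ∈ S)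
    (hA : A ∈ S) (hB : B ∈ S) (hX0 : ∀ i, 0 < X i) (hU0 : ∀ i, 0 < U i)
    (hA0 : 0 < A 0) (hB0 : 0 < B 0) {h : ℝ} (hAh : ∀ i, |A i| ≤ Real.exp h)
    (hBh : ∀ i, |B i| ≤ Real.exp h)
    (n k : P → ℕ) (l r s : P → ℤ) {N R' S' δ : ℕ} (hn : ∀ p, n p ≤ N)
    (hr : ∀ p, |r p| ≤ R') (hs : ∀ p, |s p| ≤ S') (hl : ∑ p, |l p| ≤ δ)
    (hdet : (Matrix.of fun p p' => ((n p').choose (k p) : ℝ) *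
      (X 0 ^ (l p * r p') * (U 0 * A 0 / B 0) ^ (l p * s p'))).det ≠ 0) :
    1 ≤ |(Matrix.of fun p p' => ((n p').choose (k p) : ℝ) *
      (X 0 ^ (l p * r p') * (U 0 * A 0 / B 0) ^ (l p * s p'))).det| *
        Real.exp (2 * (S' * δ) * h) *
      ∏ i : Fin 3, ((Fintype.card P).factorial * (∏ p, (N : ℝ) ^ k p / (k p).factorial) *
        Real.exp (R' * δ * |Real.log (X i.succ)| + S' * δ * |Real.log (U i.succ)| +
          2 * (S' * δ) * h)) := by
  set W := Matrix.of fun p p' => ((n p').choose (k p) : ℝ) *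
      (X 0 ^ (l p * r p') * (U 0 * A 0 / B 0) ^ (l p * s p')) with hW
  let e₁ : Equiv.Perm P → ℤ := fun π => ∑ p, l (π p) * r p
  let e₂ : Equiv.Perm P → ℤ := fun π => ∑ p, l (π p) * s p
  have hsum : ∀ (π : Equiv.Perm P) (v : P → ℤ) (V : ℕ), (∀ p, |v p| ≤ V) →
      |∑ p, l (π p) * v p| ≤ (V * δ : ℕ) := by
    intro π v V hv
    refine (Finset.abs_sum_le_sum_abs _ _).trans ?_
    calc ∑ p, |l (π p) * v p| ≤ ∑ p, |l (π p)| * V := by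
          refine Finset.sum_le_sum fun p _ => ?_
          rw [abs_mul]; exact mul_le_mul_of_nonneg_left (hv p) (abs_nonneg _)
      _ = (∑ p, |l p|) * V := by rw [← Finset.sum_mul, Equiv.sum_comp π (fun p => |l p|)]
      _ ≤ δ * V := mul_le_mul_of_nonneg_right hl (by positivity)
      _ = _ := by push_cast; ring
  have he₁ : ∀ π, |e₁ π| ≤ (R' * δ : ℕ) := fun π => hsum π r R' hr
  have he₂ : ∀ π, |e₂ π| ≤ (S' * δ : ℕ) := fun π => hsum π s S' hs
  let f₁ : Equiv.Perm P → ℕ := fun π => ((S' * δ : ℕ) + e₂ π).toNat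
  let f₂ : Equiv.Perm P → ℕ := fun π => ((S' * δ : ℕ) - e₂ π).toNat
  have hf₁ : ∀ π, (f₁ π : ℤ) = (S' * δ : ℕ) + e₂ π := fun π =>
    Int.toNat_of_nonneg (by have := (abs_le.1 (he₂ π)).1; linarith)
  have hf₂ : ∀ π, (f₂ π : ℤ) = (S' * δ : ℕ) - e₂ π := fun π =>
    Int.toNat_of_nonneg (by have := (abs_le.1 (he₂ π)).2; linarith)
  have hff : ∀ π, f₁ π + f₂ π = 2 * (S' * δ) := by
    intro π
    have h1 := hf₁ π
    have h2 := hf₂ π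
    have : (f₁ π + f₂ π : ℤ) = (2 * (S' * δ) : ℕ) := by rw [h1, h2]; push_cast; ring
    exact_mod_cast this
  let D : Fin 4 → ℝ := ∑ π : Equiv.Perm P, ((Equiv.Perm.sign π : ℤˣ) : ℤ) •
    (((∏ p, (n p).choose (k (π p)) : ℕ) : Fin 4 → ℝ) * (X ^ e₁ π * U ^ e₂ π *
      (A ^ f₁ π * B ^ f₂ π)))
  have hzp : ∀ {Y : Fin 4 → ℝ}, Y ∈ S → Y⁻¹ ∈ S → ∀ e : ℤ, Y ^ e ∈ S := by
    intro Y hY hY' e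
    rcases e with m | m
    · simpa using S.pow_mem hY m
    · rw [zpow_negSucc, ← inv_pow]; exact S.pow_mem hY' _
  have hDS : D ∈ S := by
    refine S.sum_mem fun π _ => S.zsmul_mem ?_ _
    exact S.mul_mem (natCast_mem _ _) (S.mul_mem (S.mul_mem (hzp hX hX' _) (hzp hU hU' _))
      (S.mul_mem (S.pow_mem hA _) (S.pow_mem hB _)))
  have hDi : ∀ i, D i = ∑ π : Equiv.Perm P, (((Equiv.Perm.sign π : ℤˣ) : ℤ) : ℝ) *
      ((∏ p, ((n p).choose (k (π p)) : ℝ)) * (X i ^ e₁ π * U i ^ e₂ π *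
      (A i ^ f₁ π * B i ^ f₂ π))) := by
    intro i
    simp [D, Finset.sum_apply]
  have hD0 : D 0 = W.det * (A 0 * B 0) ^ (S' * δ) := by
    rw [hDi, Matrix.det_apply, Finset.sum_mul]
    refine Finset.sum_congr rfl fun π _ => ?_
    rw [Units.smul_def, zsmul_eq_mul]
    simp only [hW, Matrix.of_apply]
    rw [Finset.prod_mul_distrib, mul_assoc ((_ : ℤ) : ℝ)]
    refine congrArg _ ?_
    rw [mul_assoc (∏ p, _)]
    refine congrArg _ ?_
    rw [Finset.prod_mul_distrib, prod_zpow_eq_zpow_sum _ (hX0 0).ne',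
      prod_zpow_eq_zpow_sum _ (by have := hU0 0; positivity)]
    change X 0 ^ e₁ π * U 0 ^ e₂ π * _ = X 0 ^ e₁ π * _ ^ e₂ π * _
    rw [div_zpow, mul_zpow, ← zpow_natCast (A 0), ← zpow_natCast (B 0), hf₁, hf₂,
      zpow_add₀ hA0.ne', zpow_sub₀ hB0.ne', ← zpow_natCast (A 0 * B 0), mul_zpow]
    have : B 0 ^ e₂ π ≠ 0 := zpow_ne_zero _ hB0.ne'
    field_simp
  have hbound : ∀ i, |D i| ≤ (Fintype.card P).factorial *
      (∏ p, (N : ℝ) ^ k p / (k p).factorial) *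
        Real.exp (R' * δ * |Real.log (X i)| + S' * δ * |Real.log (U i)| +
          2 * (S' * δ) * h) := by
    intro i
    rw [hDi]
    refine (Finset.abs_sum_le_sum_abs _ _).trans ?_
    have hterm : ∀ π ∈ (Finset.univ : Finset (Equiv.Perm P)),
        |(((Equiv.Perm.sign π : ℤˣ) : ℤ) : ℝ) *
      ((∏ p, ((n p).choose (k (π p)) : ℝ)) * (X i ^ e₁ π * U i ^ e₂ π *
      (A i ^ f₁ π * B i ^ f₂ π)))| ≤ (∏ p, (N : ℝ) ^ k p / (k p).factorial) *
        Real.exp (R' * δ * |Real.log (X i)| + S' * δ * |Real.log (U i)| +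
          2 * (S' * δ) * h) := by
      intro π _
      have hsg : |(((Equiv.Perm.sign π : ℤˣ) : ℤ) : ℝ)| = 1 := by
        rcases Int.units_eq_one_or (Equiv.Perm.sign π) with h | h <;> simp [h]
      rw [abs_mul, hsg, one_mul, abs_mul, Real.exp_add, Real.exp_add]
      have hc : |∏ p, ((n p).choose (k (π p)) : ℝ)| ≤ ∏ p, (N : ℝ) ^ k p / (k p).factorial := by
        rw [abs_of_nonneg (Finset.prod_nonneg fun _ _ => by positivity),
          ← Equiv.prod_comp π fun p => (N : ℝ) ^ k p / (k p).factorial]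
        refine Finset.prod_le_prod (fun _ _ => by positivity) fun p _ => ?_
        refine (Nat.choose_le_pow_div _ _).trans ?_
        gcongr
        exact hn p
      refine mul_le_mul hc ?_ (abs_nonneg _) (Finset.prod_nonneg fun _ _ => by positivity)
      rw [abs_mul, abs_mul, abs_of_pos (zpow_pos (hX0 i) _), abs_of_pos (zpow_pos (hU0 i) _)]
      have h1 := zpow_le_exp_abs_log (hX0 i) (he₁ π)
      have h2 := zpow_le_exp_abs_log (hU0 i) (he₂ π)
      have h3 : |A i ^ f₁ π * B i ^ f₂ π| ≤ Real.exp (2 * (S' * δ) * h) := by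
        rw [abs_mul, abs_pow, abs_pow]
        calc _ ≤ Real.exp h ^ f₁ π * Real.exp h ^ f₂ π :=
              mul_le_mul (pow_le_pow_left₀ (abs_nonneg _) (hAh i) _)
                (pow_le_pow_left₀ (abs_nonneg _) (hBh i) _) (by positivity) (by positivity)
          _ = _ := by
              rw [← pow_add, hff, ← Real.exp_nat_mul]; push_cast; rfl
      push_cast at h1 h2
      refine mul_le_mul (mul_le_mul h1 h2 ?_ (by positivity)) h3 (abs_nonneg _) (by positivity)
      exact (zpow_pos (hU0 i) _).le
    refine (Finset.sum_le_sum hterm).trans ?_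
    rw [Finset.sum_const, Finset.card_univ, Fintype.card_perm, nsmul_eq_mul]
    exact (mul_assoc _ _ _).ge
  have hne : D 0 ≠ 0 := by
    rw [hD0]; positivity
  have h1 := hS D hDS hne
  rw [Fin.prod_univ_succ] at h1
  refine h1.trans (mul_le_mul ?_ ?_ (Finset.prod_nonneg fun _ _ => abs_nonneg _)
    (by positivity))
  · rw [hD0, abs_mul]
    refine mul_le_mul_of_nonneg_left ?_ (abs_nonneg _)
    rw [abs_pow, abs_mul]
    calc _ ≤ (Real.exp h * Real.exp h) ^ (S' * δ) := by
          refine pow_le_pow_left₀ (by positivity) ?_ _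
          exact mul_le_mul (hAh 0) (hBh 0) (abs_nonneg _) (by positivity)
      _ = _ := by
          rw [← Real.exp_add, ← Real.exp_nat_mul]; push_cast; ring_nf
  · exact Finset.prod_le_prod (fun _ _ => abs_nonneg _) fun i _ => hbound i.succ

lemma cast_choose_eq_prod (n k : ℕ) :
    (n.choose k : ℝ) = (1 / (k.factorial : ℝ)) * ∏ i ∈ Finset.range k, ((n : ℝ) - i) := by
  have h := Nat.descFactorial_eq_factorial_mul_choose n k
  have h2 : (n.descFactorial k : ℝ) = ∏ i ∈ Finset.range k, ((n : ℝ) - i) := by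
    rw [← descPochhammer_eval_eq_descFactorial ℝ n k, descPochhammer_eval_eq_prod_range]
  rw [← h2, h]
  have : (k.factorial : ℝ) ≠ 0 := by positivity
  push_cast
  field_simp

/-- Analytic upper bound for an interpolation determinant in two multiplicatively almost
dependent numbers. -/
lemma abs_det_mul_le {P : Type*} [Fintype P] [DecidableEq P] {α₁ α₂ E : ℝ} (h₁ : 0 < α₁)
    (h₂ : 0 < α₂) (hE : 1 ≤ E) (n k : P → ℕ) (l r s : P → ℤ) {L' S' Z q M : ℕ}
    (hM : Fintype.card P = M)
    (hn : ∀ p, (n p : ℤ) = r p + s p * q + Z) (hx : ∀ p, |r p + s p * q| ≤ Z)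
    (hk : ∀ p, k p ≤ Z) (hl : ∀ p, |l p| ≤ L') (hs : ∀ p, |s p| ≤ S')
    (hΛ : 2 * (L' * S' * |q * Real.log α₁ - Real.log α₂|) * E ^ M ≤ 1) :
    |(Matrix.of fun p p' => ((n p').choose (k p) : ℝ) *
      (α₁ ^ (l p * r p') * α₂ ^ (l p * s p'))).det| * E ^ ∑ i ∈ Finset.range M, i ≤
    M.factorial * ∏ p, (2 * (((E + 1) * Z) ^ k p / (k p).factorial *
      Real.exp (|(l p : ℝ)| * |Real.log α₁| * (E * Z)))) := by
  set Λ := q * Real.log α₁ - Real.log α₂ with hΛ'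
  have hZ : (0 : ℝ) ≤ Z := by positivity
  have hE0 : 0 < E := by linarith
  let F : P → ℝ := fun p => ((E + 1) * Z) ^ k p / (k p).factorial *
      Real.exp (|(l p : ℝ)| * |Real.log α₁| * (E * Z))
  let φ : P → ℝ → ℝ := fun p z => (1 / ((k p).factorial : ℝ)) *
    ((∏ i ∈ Finset.range (k p), (z + ((Z : ℝ) - i))) * Real.exp (l p * Real.log α₁ * z))
  have hφ : ∀ p, HasExpansion (φ p) (E * Z) (F p) := by
    intro p
    have := (hasExpansion_prod_mul_exp (l p * Real.log α₁) (R := E * Z) (A := Z) (by positivity)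
      (k p) (fun i => (Z : ℝ) - i) ?_).const_mul (a := 1 / ((k p).factorial : ℝ)) (by positivity)
    · convert this using 1
      simp only [F, abs_mul]
      ring
    · intro i hi
      have h1 : (i : ℝ) ≤ Z := by exact_mod_cast hi.le.trans (hk p)
      have h2 : (0 : ℝ) ≤ i := by positivity
      rw [abs_le]; constructor <;> linarith
  choose c G hG hcF using fun p => (hφ p).exists_truncation hE hZ M
  let e : Fin M ≃ P := (finCongr hM.symm).trans (Fintype.equivFin P).symm
  let W := (Matrix.of fun p p' => ((n p').choose (k p) : ℝ) *
      (α₁ ^ (l p * r p') * α₂ ^ (l p * s p')))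
  let x : P → ℝ := fun p => r p + s p * q
  have hxn : ∀ p, (n p : ℝ) = x p + Z := fun p => by
    simp only [x]; exact_mod_cast hn p
  have hxZ : ∀ p, |x p| ≤ Z := fun p => by
    simp only [x]; exact_mod_cast hx p
  have hF0 : ∀ p, 0 ≤ F p := fun p => by positivity
  have hW : ∀ p p', W p p' = φ p (x p') * Real.exp (-(l p * s p' * Λ)) := by
    intro p p'
    have h1 : α₁ ^ (l p * r p') * α₂ ^ (l p * s p') =
        Real.exp (l p * Real.log α₁ * x p') * Real.exp (-(l p * s p' * Λ)) := by
      rw [← Real.exp_add, ← Real.exp_log (zpow_pos h₁ (l p * r p')),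
        ← Real.exp_log (zpow_pos h₂ (l p * s p')), ← Real.exp_add, Real.log_zpow, Real.log_zpow]
      congr 1
      simp only [hΛ', x]
      push_cast
      ring
    simp only [W, Matrix.of_apply, φ, h1, cast_choose_eq_prod, hxn]
    rw [show ∀ u v : ℝ, (fun i : ℕ => u + v - (i : ℝ)) = fun i : ℕ => u + (v - i) by
      intros; funext i; ring]
    ring
  have hφF : ∀ p p', |φ p (x p')| ≤ F p := by
    intro p p'
    simp only [φ, F]
    rw [abs_mul, abs_mul, abs_of_pos (by positivity : (0 : ℝ) < 1 / (k p).factorial),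
      Real.abs_exp, Finset.abs_prod, div_mul_eq_mul_div, div_mul_eq_mul_div,
      one_mul]
    refine div_le_div_of_nonneg_right (mul_le_mul ?_ (Real.exp_le_exp.2 ?_) (by positivity)
      (by positivity)) (by positivity)
    · calc _ ≤ ∏ i ∈ Finset.range (k p), ((E + 1) * Z) := by
            refine Finset.prod_le_prod (fun _ _ => abs_nonneg _) fun i hi => ?_
            have hi' := Finset.mem_range.1 hi
            have h1 : (i : ℝ) ≤ Z := by exact_mod_cast hi'.le.trans (hk p)
            have h2 : (0 : ℝ) ≤ i := by positivity
            refine (abs_add_le _ _).trans ?_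
            have h3 : |(Z : ℝ) - i| ≤ Z := by rw [abs_le]; constructor <;> linarith
            nlinarith [hxZ p']
        _ = _ := by simp
    · refine (le_abs_self _).trans ?_
      rw [abs_mul, abs_mul]
      refine mul_le_mul_of_nonneg_left ?_ (by positivity)
      nlinarith [hxZ p']
  have hexp : ∀ p p', |Real.exp (-(l p * s p' * Λ)) - 1| * E ^ M ≤ 1 := by
    intro p p'
    have h1 : |-(l p * s p' * Λ)| ≤ L' * S' * |Λ| := by
      rw [abs_neg, abs_mul, abs_mul]
      have h3 : |(l p : ℝ)| ≤ L' := by exact_mod_cast hl p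
      have h4 : |(s p' : ℝ)| ≤ S' := by exact_mod_cast hs p'
      gcongr
    have hEM : 1 ≤ E ^ M := one_le_pow₀ hE
    have h0 : 0 ≤ L' * S' * |Λ| := by positivity
    have h2 := Real.abs_exp_sub_one_le (x := -(l p * s p' * Λ)) (by nlinarith)
    calc _ ≤ (2 * (L' * S' * |Λ|)) * E ^ M := by
            refine mul_le_mul_of_nonneg_right ?_ (by positivity)
            linarith
      _ ≤ 1 := hΛ
  have hmain := abs_interpolation_det_le (W.submatrix e e) (fun j => x (e j)) (fun i => c (e i))
    (fun i => G (e i) + F (e i) / E ^ M) (fun i => 2 * F (e i)) (Z := Z) hE (fun j => hxZ _) ?_ ?_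
  · rw [Matrix.det_submatrix_equiv_self] at hmain
    refine hmain.trans (le_of_eq ?_)
    rw [Equiv.prod_comp e fun p => 2 * F p]
  · intro i j
    have h1 := hG (e i) (x (e j)) (hxZ _)
    have h2 : |W (e i) (e j) - φ (e i) (x (e j))| ≤ F (e i) / E ^ M := by
      rw [hW, le_div_iff₀ (by positivity)]
      have : ∀ u v : ℝ, u * v - u = u * (v - 1) := fun u v => by ring
      rw [this, abs_mul, mul_assoc]
      calc _ ≤ F (e i) * 1 := mul_le_mul (hφF _ _) (hexp _ _) (by positivity) (hF0 _)
        _ = _ := mul_one _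
    simp only [Matrix.submatrix_apply]
    have h3 := abs_add_le (W (e i) (e j) - φ (e i) (x (e j)))
      (φ (e i) (x (e j)) - ∑ n : Fin M, c (e i) n * x (e j) ^ (n : ℕ))
    rw [sub_add_sub_cancel] at h3
    linarith
  · intro i
    have h1 := hcF (e i)
    have : E ^ M * (G (e i) + F (e i) / E ^ M) = E ^ M * G (e i) + F (e i) := by
      field_simp
    linarith

lemma sum_range_cast (n : ℕ) : ((∑ i ∈ Finset.range n, i : ℕ) : ℝ) = n * (n - 1) / 2 := by
  induction n with
  | zero => simp
  | succ n ih => rw [Finset.sum_range_succ, Nat.cast_add, ih]; push_cast; ring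

lemma sum_abs_sub_center (L : ℕ) :
    ∑ j : Fin (2 * L + 1), |((j : ℕ) : ℤ) - L| = L * (L + 1) := by
  rw [Fin.sum_univ_eq_sum_range (fun j : ℕ => |(j : ℤ) - L|),
    show 2 * L + 1 = L + (L + 1) by ring, Finset.sum_range_add]
  have h1 : ∑ j ∈ Finset.range L, |(j : ℤ) - L| = L * L - ∑ j ∈ Finset.range L, (j : ℤ) := by
    rw [Finset.sum_congr rfl (g := fun j : ℕ => (L : ℤ) - j) fun j hj => ?_]
    · simp
    · have := Finset.mem_range.1 hj
      rw [abs_sub_comm, abs_of_nonneg]; omega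
  have h2 : ∑ j ∈ Finset.range (L + 1), |((L + j : ℕ) : ℤ) - L| =
      (∑ j ∈ Finset.range L, (j : ℤ)) + L := by
    rw [← Finset.sum_range_succ]
    refine Finset.sum_congr rfl fun j _ => ?_
    push_cast
    simp
  rw [h1, h2]; ring

lemma pow_div_factorial_le {X T : ℝ} {K : ℕ} (hX : 0 ≤ X) (hT : 0 ≤ T) (h : X ≤ T * K) (k : ℕ) :
    X ^ k / k.factorial ≤ T ^ k * Real.exp K := by
  calc X ^ k / k.factorial ≤ (T * K) ^ k / k.factorial := by gcongr
    _ = T ^ k * ((K : ℝ) ^ k / k.factorial) := by rw [mul_pow]; ring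
    _ ≤ _ := by
      gcongr
      exact Real.pow_div_factorial_le_exp _ (by positivity) _

lemma log_factorial_le (M : ℕ) : Real.log M.factorial ≤ M * Real.log M := by
  rcases Nat.eq_zero_or_pos M with rfl | hM
  · simp
  rw [← Real.log_pow]
  refine Real.log_le_log (by positivity) ?_
  exact_mod_cast Nat.factorial_le_pow M

set_option maxHeartbeats 1000000 in
/-- The inequality obtained from comparing the arithmetic and the analytic estimates for a
nonvanishing interpolation determinant. -/
theorem interpolation_inequality (S : Subring (Fin 4 → ℝ))
    (hS : ∀ f ∈ S, f 0 ≠ 0 → 1 ≤ ∏ i, |f i|)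
    {X U A B : Fin 4 → ℝ} (hX : X ∈ S) (hX' : X⁻¹ ∈ S) (hU : U ∈ S) (hU' : U⁻¹ ∈ S)
    (hA : A ∈ S) (hB : B ∈ S) (hX0 : ∀ i, 0 < X i) (hU0 : ∀ i, 0 < U i)
    (hX1 : X 0 ≠ 1) (hA0 : 0 < A 0) (hB0 : 0 < B 0) {h : ℝ} (hAh : ∀ i, |A i| ≤ Real.exp h)
    (hBh : ∀ i, |B i| ≤ Real.exp h) {E T : ℝ} (hE : 1 ≤ E) (hT : 1 ≤ T)
    {K L' R' S' R₂ q : ℕ} (hR₂ : R₂ + 2 * L' = 2 * R' + 1) (hRq : R₂ ≤ q)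
    (hK : (K - 1) * (2 * L' + 1) < R₂ * (2 * S' + 1)) (hKZ : K ≤ R' + S' * q)
    (hTK : (E + 1) * (R' + S' * q) ≤ T * K)
    (hΛ : 2 * (L' * S' * |q * Real.log (X 0) - Real.log (U 0 * A 0 / B 0)|) *
      E ^ (K * (2 * L' + 1)) ≤ 1) :
    (K * (2 * L' + 1) : ℝ) * (K * (2 * L' + 1) - 1) / 2 * Real.log E ≤
      4 * (K * (2 * L' + 1) * Real.log (K * (2 * L' + 1))) + K * (2 * L' + 1) * Real.log 2 +
      2 * ((2 * L' + 1) * (K * (K - 1))) * Real.log T + 4 * (K * (K * (2 * L' + 1))) +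
      K * (L' * (L' + 1)) * (E * |Real.log (X 0)| * (R' + S' * q) +
        R' * ∑ i : Fin 3, |Real.log (X i.succ)| +
        S' * (∑ i : Fin 3, |Real.log (U i.succ)| + 8 * h)) := by
  classical
  let P := Fin K × Fin (2 * L' + 1)
  let l : P → ℤ := fun p => (p.2 : ℕ) - L'
  let k : P → ℕ := fun p => p.1
  set M := K * (2 * L' + 1) with hMdef
  set Z := R' + S' * q with hZdef
  set δ := K * (L' * (L' + 1)) with hδ
  have hcard : Fintype.card P = M := by simp [P, hMdef]
  have hα₂ : 0 < U 0 * A 0 / B 0 := by have := hU0 0; positivity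
  set α₁ := X 0 with hα₁def
  set α₂ := U 0 * A 0 / B 0 with hα₂def
  have hα₁ : 0 < α₁ := hX0 0
  let Wf : Matrix P (Fin (2 * R' + 1) × Fin (2 * S' + 1)) ℝ := Matrix.of fun p j =>
    (((j.1 : ℕ) + (j.2 : ℕ) * q).choose (k p) : ℝ) *
      (α₁ ^ (l p * ((j.1 : ℕ) - R' : ℤ)) * α₂ ^ (l p * ((j.2 : ℕ) - S' : ℤ)))
  obtain ⟨g, hg⟩ := exists_minor_ne_zero Wf (by
    intro c hc
    let w : ℕ → ℕ → ℝ := fun r s => α₁ ^ ((r : ℤ) - R') * α₂ ^ ((s : ℤ) - S')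
    have hw0 : ∀ r s, w r s ≠ 0 := fun r s =>
      (mul_pos (zpow_pos hα₁ _) (zpow_pos hα₂ _)).ne'
    have := coeff_eq_zero_of_zeros (K := K) (L := 2 * L' + 1) (R := R₂) (S := 2 * S' + 1) (q := q)
      hα₁ hX1 (fun k j => c (k, j)) w ?_ hw0 hRq hK ?_
    · funext p
      exact congrFun (congrFun this p.1) p.2
    · intro r s i
      simp only [w]
      rw [show ((r + i : ℕ) : ℤ) - R' = i + (r - R') by push_cast; ring, zpow_add₀ hα₁.ne',
        zpow_natCast, mul_assoc]
    · intro r s hr hs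
      have h1 := hc (⟨r, by omega⟩, ⟨s, hs⟩)
      rw [Fintype.sum_prod_type] at h1
      have h2 : ∑ x : Fin K, ∑ y : Fin (2 * L' + 1), c (x, y) *
          (((r + s * q).choose x : ℝ) * w r s ^ (y : ℕ)) =
          w r s ^ L' * ∑ x, ∑ y, c (x, y) * Wf (x, y) (⟨r, by omega⟩, ⟨s, hs⟩) := by
        rw [Finset.mul_sum]
        refine Finset.sum_congr rfl fun x _ => ?_
        rw [Finset.mul_sum]
        refine Finset.sum_congr rfl fun y _ => ?_
        have h3 : α₁ ^ (((y : ℕ) - L' : ℤ) * (r - R')) * α₂ ^ (((y : ℕ) - L' : ℤ) * (s - S')) *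
            w r s ^ L' = w r s ^ (y : ℕ) := by
          rw [mul_comm ((y : ℕ) - L' : ℤ), mul_comm ((y : ℕ) - L' : ℤ), zpow_mul, zpow_mul,
            ← mul_zpow, ← zpow_natCast (w r s) L', ← zpow_add₀ (hw0 r s), sub_add_cancel,
            zpow_natCast]
        simp only [Wf, Matrix.of_apply, k, l]
        rw [← h3]
        ring
      rw [h2, h1, mul_zero])
  let n : P → ℕ := fun p => ((g p).1 : ℕ) + ((g p).2 : ℕ) * q
  let r : P → ℤ := fun p => ((g p).1 : ℕ) - R'
  let s : P → ℤ := fun p => ((g p).2 : ℕ) - S'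
  have hgW : Wf.submatrix id g = Matrix.of fun p p' => ((n p').choose (k p) : ℝ) *
      (α₁ ^ (l p * r p') * α₂ ^ (l p * s p')) := by
    ext p p'
    simp only [Wf, Matrix.submatrix_apply, Matrix.of_apply, id, n, r, s]
  rw [hgW] at hg
  have hr : ∀ p, |r p| ≤ R' := fun p => by
    have := (g p).1.2
    simp only [r]; rw [abs_le]; constructor <;> omega
  have hs : ∀ p, |s p| ≤ S' := fun p => by
    have := (g p).2.2
    simp only [s]; rw [abs_le]; constructor <;> omega
  have hl : ∀ p, |l p| ≤ L' := fun p => by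
    have := p.2.2
    simp only [l]; rw [abs_le]; constructor <;> omega
  have hn : ∀ p, (n p : ℤ) = r p + s p * q + Z := fun p => by
    simp only [n, r, s, Z]; push_cast; ring
  have hx : ∀ p, |r p + s p * q| ≤ Z := fun p => by
    refine (abs_add_le _ _).trans ?_
    rw [abs_mul, Nat.abs_cast, hZdef]
    push_cast
    exact add_le_add (hr p) (mul_le_mul_of_nonneg_right (hs p) (by positivity))
  have hnN : ∀ p, n p ≤ 2 * Z := fun p => by
    have h1 := hn p
    have h2 := (abs_le.1 (hx p)).2
    omega
  have hlsum : ∑ p, |l p| = δ := by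
    rw [Fintype.sum_prod_type]
    simp only [l, sum_abs_sub_center]
    simp [hδ]
  have hlsumR : ∑ p, |(l p : ℝ)| = δ := by exact_mod_cast hlsum
  have hkZ : ∀ p, k p ≤ Z := fun p => p.1.2.le.trans hKZ
  have hup := abs_det_mul_le (P := P) hα₁ hα₂ hE n k l r s hcard hn hx hkZ hl hs hΛ
  have hlow := one_le_abs_det_mul S hS hX hX' hU hU' hA hB hX0 hU0 hA0 hB0 hAh hBh n k l r s
    hnN hr hs hlsum.le hg
  rw [hcard] at hlow
  set det := |(Matrix.of fun p p' => ((n p').choose (k p) : ℝ) *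
      (α₁ ^ (l p * r p') * α₂ ^ (l p * s p'))).det| with hdet
  have hT0 : 0 ≤ T := by linarith
  have hZ0 : (0 : ℝ) ≤ Z := by positivity
  let D : ℝ := ∏ p : P, T ^ k p * Real.exp K
  have hD0 : 0 < D := Finset.prod_pos fun p _ => by positivity
  have hTK' : (E + 1) * Z ≤ T * K := by rw [hZdef]; push_cast; exact hTK
  have hC : ∏ p, ((2 * Z : ℕ) : ℝ) ^ k p / (k p).factorial ≤ D := by
    refine Finset.prod_le_prod (fun _ _ => by positivity) fun p _ => ?_
    refine pow_div_factorial_le (by positivity) hT0 (le_trans ?_ hTK') _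
    push_cast
    nlinarith
  have hC' : ∏ p, (2 * (((E + 1) * Z) ^ k p / (k p).factorial *
      Real.exp (|(l p : ℝ)| * |Real.log α₁| * (E * Z)))) ≤
      2 ^ M * (D * Real.exp (δ * |Real.log α₁| * (E * Z))) := by
    have h1 : Real.exp (δ * |Real.log α₁| * (E * Z)) =
        ∏ p, Real.exp (|(l p : ℝ)| * |Real.log α₁| * (E * Z)) := by
      rw [← Real.exp_sum, ← Finset.sum_mul, ← Finset.sum_mul, hlsumR]
    rw [h1, Finset.prod_mul_distrib, Finset.prod_const, Finset.card_univ, hcard,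
      ← Finset.prod_mul_distrib (f := fun p : P => T ^ k p * Real.exp K)]
    refine mul_le_mul_of_nonneg_left (Finset.prod_le_prod (fun _ _ => by positivity)
      fun p _ => ?_) (by positivity)
    refine mul_le_mul_of_nonneg_right ?_ (by positivity)
    exact pow_div_factorial_le (by positivity) hT0 hTK' _
  let x : Fin 3 → ℝ := fun i => R' * δ * |Real.log (X i.succ)| + S' * δ * |Real.log (U i.succ)| +
          2 * (S' * δ) * h
  have hfin : E ^ ∑ i ∈ Finset.range M, i ≤ (M.factorial * (2 ^ M * (D *
      Real.exp (δ * |Real.log α₁| * (E * Z))))) * Real.exp (2 * (S' * δ) * h) *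
      ∏ i : Fin 3, (M.factorial * D * Real.exp (x i)) := by
    have hdet0 : 0 ≤ det := abs_nonneg _
    have hprod : (0 : ℝ) ≤ ∏ i : Fin 3, (M.factorial * D * Real.exp (x i)) :=
      Finset.prod_nonneg fun _ _ => by positivity
    have hprod' : ∏ i : Fin 3, ((M.factorial : ℝ) *
        (∏ p, ((2 * Z : ℕ) : ℝ) ^ k p / (k p).factorial) * Real.exp (x i)) ≤
        ∏ i : Fin 3, (M.factorial * D * Real.exp (x i)) := by
      refine Finset.prod_le_prod (fun _ _ => ?_) fun i _ => ?_
      · have : (0 : ℝ) ≤ ∏ p, ((2 * Z : ℕ) : ℝ) ^ k p / (k p).factorial :=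
          Finset.prod_nonneg fun _ _ => by positivity
        positivity
      · gcongr
    calc E ^ ∑ i ∈ Finset.range M, i = E ^ (∑ i ∈ Finset.range M, i) * 1 := (mul_one _).symm
      _ ≤ E ^ (∑ i ∈ Finset.range M, i) * (det * Real.exp (2 * (S' * δ) * h) *
          ∏ i : Fin 3, (M.factorial * D * Real.exp (x i))) := by
          refine mul_le_mul_of_nonneg_left (hlow.trans ?_) (by positivity)
          exact mul_le_mul_of_nonneg_left hprod' (by positivity)
      _ = det * E ^ (∑ i ∈ Finset.range M, i) * Real.exp (2 * (S' * δ) * h) *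
          ∏ i : Fin 3, (M.factorial * D * Real.exp (x i)) := by ring
      _ ≤ _ := by
          refine mul_le_mul_of_nonneg_right (mul_le_mul_of_nonneg_right (hup.trans ?_)
            (by positivity)) hprod
          exact mul_le_mul_of_nonneg_left hC' (by positivity)
  have hE0 : 0 < E := by linarith
  have hlogD : Real.log D = (2 * L' + 1) * (K * (K - 1) / 2) * Real.log T + K * M := by
    have h1 : D = T ^ ((2 * L' + 1) * ∑ i ∈ Finset.range K, i) * Real.exp (K * M) := by
      simp only [D]
      rw [Finset.prod_mul_distrib, Finset.prod_pow_eq_pow_sum, Finset.prod_const,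
        Finset.card_univ, hcard, ← Real.exp_nat_mul, Fintype.sum_prod_type]
      simp only [k, Finset.sum_const, Finset.card_univ, Fintype.card_fin, smul_eq_mul]
      rw [← Finset.mul_sum, Fin.sum_univ_eq_sum_range (fun i => i)]
      ring_nf
    rw [h1, Real.log_mul (by positivity) (by positivity), Real.log_exp, Real.log_pow,
      Nat.cast_mul, sum_range_cast]
    push_cast
    ring
  have hlog := Real.log_le_log (by positivity) hfin
  have hfac : (M.factorial : ℝ) ≠ 0 := by positivity
  have hex : ∀ y, Real.exp y ≠ 0 := fun y => (Real.exp_pos y).ne'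
  rw [Real.log_pow, sum_range_cast, Fin.prod_univ_three] at hlog
  have h2M : (2 : ℝ) ^ M ≠ 0 := by positivity
  have hD1 := hD0.ne'
  rw [Real.log_mul (by simp [hfac, hD1]) (by simp [hfac, hD1]),
    Real.log_mul (by simp [hfac, hD1]) (by simp),
    Real.log_mul hfac (by simp [hD1]), Real.log_mul h2M (by simp [hD1]), Real.log_mul hD1 (hex _),
    Real.log_mul (by simp [hfac, hD1]) (by simp [hfac, hD1]),
    Real.log_mul (by simp [hfac, hD1]) (by simp [hfac, hD1])] at hlog
  simp only [Real.log_mul (mul_ne_zero hfac hD1) (hex _), Real.log_mul hfac hD1, Real.log_exp,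
    Real.log_pow, hlogD, x] at hlog
  have hf := log_factorial_le M
  rw [Fin.sum_univ_three, Fin.sum_univ_three]
  have hMc : (M : ℝ) = K * (2 * L' + 1) := by simp [hMdef]
  have hδc : (δ : ℝ) = K * (L' * (L' + 1)) := by simp [hδ]
  have hZc : (Z : ℝ) = R' + S' * q := by simp [hZdef]
  rw [← hMc, ← hδc, ← hZc]
  linear_combination hlog + 4 * hf

set_option maxHeartbeats 2000000 in
/-- The interpolation inequality is violated for a suitable choice of the auxiliary parameters. -/
theorem not_interpolation (S : Subring (Fin 4 → ℝ))
    (hS : ∀ f ∈ S, f 0 ≠ 0 → 1 ≤ ∏ i, |f i|)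
    {X U A B : Fin 4 → ℝ} (hX : X ∈ S) (hX' : X⁻¹ ∈ S) (hU : U ∈ S) (hU' : U⁻¹ ∈ S)
    (hA : A ∈ S) (hB : B ∈ S) (hX0 : ∀ i, 0 < X i) (hU0 : ∀ i, 0 < U i)
    (hX1 : X 0 ≠ 1) (hA0 : 0 < A 0) (hB0 : 0 < B 0) {h : ℝ} (hAh : ∀ i, |A i| ≤ Real.exp h)
    (hBh : ∀ i, |B i| ≤ Real.exp h) {L s t q : ℕ} (hL : Odd L) (hL3 : 3 ≤ L)
    (hs : Odd s) (ht : Odd t)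
    (hK : 1000 ≤ s * t * L) (hq : 33 ≤ q) (hLt : L * t ≤ q) (hh : 0 ≤ h)
    (hP : 32 * |Real.log (X 0)| + ∑ i : Fin 3, |Real.log (X i.succ)| ≤ s * Real.log 32)
    (hW : 32 * |Real.log (X 0)| * q + (∑ i : Fin 3, |Real.log (U i.succ)| + 8 * h) ≤
      t * Real.log 32)
    (hΛ : (L ^ 2 * s * |q * Real.log (X 0) - Real.log (U 0 * A 0 / B 0)|) *
      32 ^ (s * t * L * L) ≤ 1)
    (hfin : 2 * Real.log (17 * q / t) + 4.1 < L * Real.log 32 / 4 * (1 - 1 / (2 * t))) :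
    False := by
  have hL' := hL
  obtain ⟨L', hLdef⟩ := hL
  obtain ⟨S', hS'⟩ : ∃ S', 2 * S' + 1 = L * s := by
    obtain ⟨S', h⟩ := hL'.mul hs
    exact ⟨S', h.symm⟩
  obtain ⟨R', hR'⟩ : ∃ R', 2 * R' + 1 = L * t + 2 * L' := by
    obtain ⟨R', h⟩ := hL'.mul ht
    exact ⟨R' + L', by omega⟩
  obtain ⟨K, hKdef⟩ : ∃ K, K = s * t * L := ⟨_, rfl⟩
  rw [← hKdef] at hK hΛ
  have hs1 : 1 ≤ s := hs.pos
  have ht1 : 1 ≤ t := ht.pos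
  have hLs : 1 ≤ L := by omega
  have hcL : (L : ℝ) = 2 * L' + 1 := by simp [hLdef]
  have cS : (2 : ℝ) * S' + 1 = L * s := by exact_mod_cast hS'
  have cR : (2 : ℝ) * R' + 1 = L * t + (L - 1) := by
    rw [hcL]; have : (2 : ℝ) * R' + 1 = L * t + 2 * L' := by exact_mod_cast hR'
    rw [this, hcL]; ring
  have cK : (K : ℝ) = s * t * L := by simp [hKdef]
  have cL1 : (1 : ℝ) ≤ L := by exact_mod_cast hLs
  have cL3 : (3 : ℝ) ≤ L := by exact_mod_cast hL3
  have cs1 : (1 : ℝ) ≤ s := by exact_mod_cast hs1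
  have ct1 : (1 : ℝ) ≤ t := by exact_mod_cast ht1
  have cq : (33 : ℝ) ≤ q := by exact_mod_cast hq
  have cLt : (L : ℝ) * t ≤ q := by exact_mod_cast hLt
  have ctq : (t : ℝ) ≤ q := (le_mul_of_one_le_left (by linarith) cL1).trans cLt
  have cK1 : (1000 : ℝ) ≤ K := by exact_mod_cast hK
  have cZ : (R' : ℝ) + S' * q ≤ L * (s * q + 1) / 2 := by
    have h1 : (S' : ℝ) * q = (L * s - 1) / 2 * q := by rw [← cS]; ring
    rw [h1]
    linarith
  have hst : (1 : ℝ) ≤ s * q := one_le_mul_of_one_le_of_one_le cs1 (by linarith)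
  have key := interpolation_inequality S hS hX hX' hU hU' hA hB hX0 hU0 hX1 hA0 hB0 hAh hBh
    (E := 32) (T := 17 * q / t) (K := K) (L' := L') (R' := R') (S' := S') (R₂ := L * t) (q := q)
    (by norm_num) ?_ (by omega) hLt ?_ ?_ ?_ ?_
  · rw [← hcL] at key
    set lE := Real.log 32 with hlE
    set lT := Real.log (17 * q / t) with hlT
    have hlE0 : 0 < lE := Real.log_pos (by norm_num)
    have hlE5 : lE = 5 * Real.log 2 := by
      rw [hlE, show (32 : ℝ) = 2 ^ 5 by norm_num, Real.log_pow]; norm_num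
    have hl2 := Real.log_two_lt_d9
    have hlT0 : 0 ≤ lT := Real.log_nonneg (by
      rw [le_div_iff₀ (by linarith)]; linarith)
    set lam := |Real.log (X 0)| with hlam
    set a₁ := ∑ i : Fin 3, |Real.log (X i.succ)| with ha₁
    set u₁ := ∑ i : Fin 3, |Real.log (U i.succ)| with hu₁
    have hlam0 : 0 ≤ lam := abs_nonneg _
    have ha0 : 0 ≤ a₁ := Finset.sum_nonneg fun _ _ => abs_nonneg _
    have hu0 : 0 ≤ u₁ := Finset.sum_nonneg fun _ _ => abs_nonneg _
    have hL4 : (L' : ℝ) * (L' + 1) ≤ L ^ 2 / 4 := by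
      have : (L : ℝ) ^ 2 / 4 = L' * (L' + 1) + 1 / 4 := by rw [hcL]; ring
      linarith
    have hterm : 32 * lam * (R' + S' * q) + R' * a₁ + S' * (u₁ + 8 * h) ≤
        L / 2 * (s * (2 * t + 1) * lE) := by
      have h1 : (R' : ℝ) ≤ L * (t + 1) / 2 := by linarith
      have h2 : (S' : ℝ) ≤ L * s / 2 := by linarith
      calc _ ≤ 32 * lam * (L * (s * q + 1) / 2) + L * (t + 1) / 2 * a₁ +
            L * s / 2 * (u₁ + 8 * h) := by gcongr
        _ = L / 2 * (s * (32 * lam * q + (u₁ + 8 * h)) + (32 * lam + (t + 1) * a₁)) := by ring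
        _ ≤ L / 2 * (s * (t * lE) + (t + 1) * (s * lE)) := by
            gcongr
            calc 32 * lam + (t + 1) * a₁ ≤ (t + 1) * (32 * lam + a₁) := by
                  linarith [show 0 ≤ t * (32 * lam) by positivity]
              _ ≤ _ := by gcongr
        _ = _ := by ring
    have hterm2 : K * (L' * (L' + 1)) * (32 * lam * (R' + S' * q) + R' * a₁ + S' * (u₁ + 8 * h)) ≤
        K * (L ^ 2 / 4) * (L / 2 * (s * (2 * t + 1) * lE)) := by
      gcongr
    have hlogM : 4 * Real.log (K * L) + Real.log 2 + lE / 2 ≤ 0.1 * K := by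
      have h1 : (L : ℝ) ≤ K := by
        rw [cK]
        exact le_mul_of_one_le_left (by linarith) (one_le_mul_of_one_le_of_one_le cs1 ct1)
      have h2 : Real.log (K * L) ≤ 2 * Real.log K := by
        rw [two_mul, Real.log_mul (by linarith) (by linarith)]
        gcongr
      have h3 : Real.log K ≤ K / 1000 + 6 := by
        have h4 : Real.log K = Real.log (K / 1000) + Real.log 1000 := by
          rw [Real.log_div (by linarith) (by norm_num)]; ring
        have h5 := Real.log_le_sub_one_of_pos (show (0 : ℝ) < K / 1000 by linarith)
        have h6 : Real.log 1000 ≤ 7 := by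
          rw [Real.log_le_iff_le_exp (by norm_num), ← mul_one (7 : ℝ), ← Nat.cast_ofNat (n := 7),
            Real.exp_nat_mul]
          calc (1000 : ℝ) ≤ 2.7 ^ 7 := by norm_num
            _ ≤ _ := by gcongr; exact (by norm_num : (2.7 : ℝ) ≤ 2.7182818283).trans
                          Real.exp_one_gt_d9.le
        linarith
      linarith
    have hTK : 2 * ((L : ℝ) * (K * (K - 1))) * lT ≤ 2 * (L * (K * K)) * lT := by
      gcongr; linarith
    have hmain : (L * K * K : ℝ) * (L * lE / 4 * (1 - 1 / (2 * t))) ≤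
        (L * K * K : ℝ) * (2 * lT + 4.1) := by
      have h1 : K * ((L : ℝ) ^ 2 / 4) * (L / 2 * (s * (2 * t + 1) * lE)) =
          (L * K * K : ℝ) * (L * lE / 4 + L * lE / 4 * (1 / (2 * t))) := by
        have : (s : ℝ) * L = K / t := by rw [cK]; field_simp
        calc _ = K * (L : ℝ) ^ 2 / 8 * ((2 * t + 1) * lE) * (s * L) := by ring
          _ = _ := by rw [this]; field_simp; ring
      have h2 : (L * K : ℝ) * (4 * Real.log (K * L) + Real.log 2 + lE / 2) ≤
        L * K * (0.1 * K) := by gcongr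
      linarith
    have hpos : (0 : ℝ) < L * K * K := by positivity
    have := le_of_mul_le_mul_left hmain hpos
    linarith
  · rw [le_div_iff₀ (by linarith)]; linarith
  · rw [hS', hKdef, ← hLdef]
    calc (s * t * L - 1) * L < (s * t * L) * L :=
          Nat.mul_lt_mul_of_pos_right (by omega) (by omega)
      _ = _ := by ring
  · have h1 : (K : ℝ) ≤ R' + S' * q := by
      rw [cK]
      have h2 : (2 : ℝ) * s ≤ L * s - 1 := by
        linarith [mul_le_mul_of_nonneg_right cL3 (zero_le_one.trans cs1)]
      have h3 : (2 : ℝ) * s * (L * t) ≤ (L * s - 1) * q := by gcongr; linarith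
      have h4 : (S' : ℝ) * q = (L * s - 1) * q / 2 := by rw [← cS]; ring
      rw [h4]
      linarith
    exact_mod_cast h1
  · rw [cK]
    calc (32 + 1 : ℝ) * (R' + S' * q) ≤ 33 * (L * (s * q + 1) / 2) := by linarith
      _ ≤ 17 * q * (s * L) := by
        have h1 : (33 : ℝ) ≤ s * q := cq.trans (le_mul_of_one_le_left (by linarith) cs1)
        linarith [mul_nonneg (zero_le_one.trans cL1) (sub_nonneg.2 h1)]
      _ = _ := by field_simp
  · refine le_trans ?_ hΛ
    set Λ := q * Real.log (X 0) - Real.log (U 0 * A 0 / B 0)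
    have h1 : 2 * (L' * S' * |Λ|) ≤ L ^ 2 * s * |Λ| := by
      have h3 : (L' : ℝ) ≤ L / 2 := by linarith
      have h4 : (S' : ℝ) ≤ L * s := by linarith
      calc 2 * (L' * S' * |Λ|) ≤ 2 * (L / 2 * (L * s) * |Λ|) := by gcongr
        _ = _ := by ring
    rw [← hLdef]
    gcongr

namespace Triple

lemma pos {Δ : ℤ} (hΔ : 6 ≤ Δ) : 0 < a Δ ∧ 0 < b Δ ∧ 0 < c Δ := by
  obtain ⟨ha, hr, hb, hs, ht, hc⟩ := order_chain hΔ
  refine ⟨?_, ?_, ?_⟩ <;> rify <;> linarith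

/-- The ring generated by the square roots attached to the triple. -/
noncomputable def ring {Δ : ℤ} (hΔ : 6 ≤ Δ) : Subring (Fin 4 → ℝ) :=
  biquadRing (a Δ) (b Δ) (c Δ) (pos hΔ).1 (pos hΔ).2.1 (pos hΔ).2.2

lemma one_le_prod {Δ : ℤ} (hΔ : 6 ≤ Δ) (f : Fin 4 → ℝ) (hf : f ∈ ring hΔ) (h0 : f 0 ≠ 0) :
    1 ≤ ∏ i, |f i| := by
  obtain ⟨ha, hb, hc⟩ := pos hΔ
  exact one_le_prod_abs ha hb hc
    (fun p q h => eq_zero_of_sq_eq_mul_sq (mul_pos ha hb) (ab_add_one Δ) h)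
    (fun p q h => eq_zero_of_sq_eq_mul_sq (mul_pos ha hc) (ac_add_one Δ) h)
    (fun p q h => eq_zero_of_sq_eq_mul_sq (mul_pos hb hc) (bc_add_one Δ) h) hf h0

/-- The conjugates of `α`. -/
noncomputable def conjα (Δ : ℤ) (i : Fin 4) : ℝ := s Δ + sgnAC i * √(a Δ * c Δ)
/-- The conjugates of `ρ`. -/
noncomputable def conjρ (Δ : ℤ) (i : Fin 4) : ℝ := r Δ + sgnAB i * √(a Δ * b Δ)

lemma α_mul_conj {Δ : ℤ} (hΔ : 6 ≤ Δ) : α Δ * (s Δ - √(a Δ * c Δ)) = 1 := by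
  obtain ⟨ha, hb, hc⟩ := pos hΔ
  have h := Real.sq_sqrt (show (0 : ℝ) ≤ a Δ * c Δ by exact_mod_cast (mul_pos ha hc).le)
  have h2 : (a Δ * c Δ + 1 : ℝ) = s Δ ^ 2 := by exact_mod_cast ac_add_one Δ
  unfold α; linarith

lemma ρ_mul_conj {Δ : ℤ} (hΔ : 6 ≤ Δ) : ρ Δ * (r Δ - √(a Δ * b Δ)) = 1 := by
  obtain ⟨ha, hb, hc⟩ := pos hΔ
  have h := Real.sq_sqrt (show (0 : ℝ) ≤ a Δ * b Δ by exact_mod_cast (mul_pos ha hb).le)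
  have h2 : (a Δ * b Δ + 1 : ℝ) = r Δ ^ 2 := by exact_mod_cast ab_add_one Δ
  unfold ρ; linarith

lemma one_lt_ρ {Δ : ℤ} (hΔ : 6 ≤ Δ) : 1 < ρ Δ := by
  obtain ⟨ha, hr, hb, hs, ht, hc⟩ := order_chain hΔ
  have := Real.sqrt_nonneg (a Δ * b Δ)
  unfold ρ; linarith

lemma ρ_lt_α {Δ : ℤ} (hΔ : 6 ≤ Δ) : ρ Δ < α Δ := by
  obtain ⟨ha, hr, hb, hs, ht, hc⟩ := order_chain hΔ
  have : √(a Δ * b Δ : ℝ) ≤ √(a Δ * c Δ) := Real.sqrt_le_sqrt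
    (mul_le_mul_of_nonneg_left (by linarith) (by linarith))
  unfold ρ α; linarith

lemma conjα_pos_log {Δ : ℤ} (hΔ : 6 ≤ Δ) (i : Fin 4) :
    0 < conjα Δ i ∧ Real.log (conjα Δ i) = sgnAC i * Real.log (α Δ) := by
  have h := α_mul_conj hΔ
  have h1 : 0 < α Δ := by linarith [one_lt_ρ hΔ, ρ_lt_α hΔ]
  have h2 : s Δ - √(a Δ * c Δ) = (α Δ)⁻¹ := eq_inv_of_mul_eq_one_right h
  have h3 : 0 < (α Δ)⁻¹ := inv_pos.2 h1
  fin_cases i <;> simp only [conjα, sgnAC, Fin.zero_eta, Matrix.cons_val_zero, Fin.mk_one,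
    Matrix.cons_val_one, Fin.reduceFinMk, Matrix.cons_val, one_mul, neg_mul, ← sub_eq_add_neg, h2,
    Real.log_inv, and_true, h3] <;> exact ⟨h1, rfl⟩

lemma conjρ_pos_log {Δ : ℤ} (hΔ : 6 ≤ Δ) (i : Fin 4) :
    0 < conjρ Δ i ∧ Real.log (conjρ Δ i) = sgnAB i * Real.log (ρ Δ) := by
  have h := ρ_mul_conj hΔ
  have h1 : 0 < ρ Δ := by linarith [one_lt_ρ hΔ]
  have h2 : r Δ - √(a Δ * b Δ) = (ρ Δ)⁻¹ := eq_inv_of_mul_eq_one_right h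
  have h3 : 0 < (ρ Δ)⁻¹ := inv_pos.2 h1
  fin_cases i <;> simp only [conjρ, sgnAB, Fin.zero_eta, Matrix.cons_val_zero, Fin.mk_one,
    Matrix.cons_val_one, Fin.reduceFinMk, Matrix.cons_val, one_mul, neg_mul, ← sub_eq_add_neg, h2,
    Real.log_inv, and_true, h3] <;> exact ⟨h1, rfl⟩

lemma conjα_mem {Δ : ℤ} (hΔ : 6 ≤ Δ) : conjα Δ ∈ ring hΔ ∧ (conjα Δ)⁻¹ ∈ ring hΔ := by
  refine ⟨⟨s Δ, 0, 1, 0, ?_⟩, ⟨s Δ, 0, -1, 0, ?_⟩⟩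
  · ext i; simp [conjα, biquad]
  · obtain ⟨ha, hb, hc⟩ := pos hΔ
    have h := Real.sq_sqrt (show (0 : ℝ) ≤ a Δ * c Δ by exact_mod_cast (mul_pos ha hc).le)
    have h2 : (a Δ * c Δ + 1 : ℝ) = s Δ ^ 2 := by exact_mod_cast ac_add_one Δ
    ext i
    refine inv_eq_of_mul_eq_one_right ?_
    have h3 := sgnAC_mul_self i
    simp only [conjα, biquad, Int.cast_zero, zero_mul, add_zero, Int.cast_neg, Int.cast_one]
    linear_combination (-√(a Δ * c Δ : ℝ) ^ 2) * h3 - h - h2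

lemma conjρ_mem {Δ : ℤ} (hΔ : 6 ≤ Δ) : conjρ Δ ∈ ring hΔ ∧ (conjρ Δ)⁻¹ ∈ ring hΔ := by
  refine ⟨⟨r Δ, 1, 0, 0, ?_⟩, ⟨r Δ, -1, 0, 0, ?_⟩⟩
  · ext i; simp [conjρ, biquad]
  · obtain ⟨ha, hb, hc⟩ := pos hΔ
    have h := Real.sq_sqrt (show (0 : ℝ) ≤ a Δ * b Δ by exact_mod_cast (mul_pos ha hb).le)
    have h2 : (a Δ * b Δ + 1 : ℝ) = r Δ ^ 2 := by exact_mod_cast ab_add_one Δ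
    ext i
    refine inv_eq_of_mul_eq_one_right ?_
    have h3 := sgnAB_mul_self i
    simp only [conjρ, biquad, Int.cast_zero, zero_mul, add_zero, Int.cast_neg, Int.cast_one]
    linear_combination (-√(a Δ * b Δ : ℝ) ^ 2) * h3 - h - h2

lemma zpow_mem_of_inv_mem {S : Subring (Fin 4 → ℝ)} {Y : Fin 4 → ℝ} (h : Y ∈ S ∧ Y⁻¹ ∈ S)
    (e : ℤ) : Y ^ e ∈ S := by
  rcases e with m | m
  · simpa using S.pow_mem h.1 m
  · rw [zpow_negSucc, ← inv_pow]; exact S.pow_mem h.2 _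

/-- The vector of conjugates of `α ^ i * ρ ^ j`. -/
noncomputable def conjUnit (Δ i j : ℤ) : Fin 4 → ℝ := conjα Δ ^ i * conjρ Δ ^ j

lemma conjUnit_mem {Δ : ℤ} (hΔ : 6 ≤ Δ) (i j : ℤ) :
    conjUnit Δ i j ∈ ring hΔ ∧ (conjUnit Δ i j)⁻¹ ∈ ring hΔ := by
  refine ⟨(ring hΔ).mul_mem (zpow_mem_of_inv_mem (conjα_mem hΔ) i)
    (zpow_mem_of_inv_mem (conjρ_mem hΔ) j), ?_⟩
  rw [conjUnit, mul_inv, ← zpow_neg, ← zpow_neg]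
  exact (ring hΔ).mul_mem (zpow_mem_of_inv_mem (conjα_mem hΔ) _)
    (zpow_mem_of_inv_mem (conjρ_mem hΔ) _)

lemma conjUnit_pos_log {Δ : ℤ} (hΔ : 6 ≤ Δ) (i j : ℤ) (k : Fin 4) : 0 < conjUnit Δ i j k ∧
    Real.log (conjUnit Δ i j k) =
      i * (sgnAC k * Real.log (α Δ)) + j * (sgnAB k * Real.log (ρ Δ)) := by
  obtain ⟨h1, h2⟩ := conjα_pos_log hΔ k
  obtain ⟨h3, h4⟩ := conjρ_pos_log hΔ k
  simp only [conjUnit, Pi.mul_apply, Pi.pow_apply]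
  refine ⟨by positivity, ?_⟩
  rw [Real.log_mul (by positivity) (by positivity), Real.log_zpow, Real.log_zpow, h2, h4]

lemma conjUnit_ne_one {Δ : ℤ} (hΔ : 6 ≤ Δ) {i j : ℤ} (hi : 0 < i) (hj : j < 0) :
    conjUnit Δ i j 0 ≠ 1 := by
  intro h
  have hf : conjUnit Δ i j - 1 ∈ ring hΔ :=
    (ring hΔ).sub_mem (conjUnit_mem hΔ i j).1 (ring hΔ).one_mem
  obtain ⟨p, q, r, u, hb⟩ := hf
  let τ : Fin 4 → Fin 4 := ![1, 0, 3, 2]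
  have hg : (conjUnit Δ i j - 1) ∘ τ ∈ ring hΔ := by
    refine ⟨p, q, -r, -u, ?_⟩
    rw [hb]
    ext k
    fin_cases k <;> simp [biquad, τ, sgnAB, sgnAC]
  have hlog1 : 0 < Real.log (ρ Δ) := Real.log_pos (one_lt_ρ hΔ)
  have hlog2 : 0 < Real.log (α Δ) := Real.log_pos ((one_lt_ρ hΔ).trans (ρ_lt_α hΔ))
  have h1 : conjUnit Δ i j 1 ≠ 1 := by
    intro h1
    have h2 := (conjUnit_pos_log hΔ i j 1).2
    rw [h1, Real.log_one] at h2
    simp only [sgnAC, sgnAB, Matrix.cons_val_one, Matrix.cons_val_zero] at h2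
    have hi' : (0 : ℝ) < i := by exact_mod_cast hi
    have hj' : (j : ℝ) < 0 := by exact_mod_cast hj
    nlinarith [mul_pos hi' hlog2, mul_pos_of_neg_of_neg hj' (neg_lt_zero.2 hlog1)]
  have := one_le_prod hΔ _ hg (by simpa [τ, sub_eq_zero] using h1)
  rw [Finset.prod_eq_zero (Finset.mem_univ (1 : Fin 4)) (by simp [τ, h])] at this
  linarith

/-- The conjugates of `den`. -/
noncomputable def conjDen (Δ : ℤ) : Fin 4 → ℝ := biquad (a Δ) (b Δ) (c Δ) 0 0 1 1
/-- The conjugates of `num`. -/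
noncomputable def conjNum (Δ ε : ℤ) : Fin 4 → ℝ := biquad (a Δ) (b Δ) (c Δ) 0 ε 0 1

lemma conjDen_zero (Δ : ℤ) : conjDen Δ 0 = den Δ := by
  simp [conjDen, den, biquad, sgnAB, sgnAC]; ring

lemma conjNum_zero (Δ ε : ℤ) : conjNum Δ ε 0 = num Δ ε := by
  simp [conjNum, num, biquad, sgnAB, sgnAC]; ring

lemma den_pos {Δ : ℤ} (hΔ : 6 ≤ Δ) : 0 < den Δ := by
  obtain ⟨ha, hb, hc⟩ := pos hΔ
  have ha' : (0 : ℝ) < a Δ := by exact_mod_cast ha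
  have hb' : (0 : ℝ) < b Δ := by exact_mod_cast hb
  have hc' : (0 : ℝ) < c Δ := by exact_mod_cast hc
  unfold den; positivity

lemma sqrt_lt_sqrt_bc {Δ : ℤ} (hΔ : 6 ≤ Δ) :
    √(a Δ * b Δ : ℝ) < √(b Δ * c Δ) ∧ √(a Δ * c Δ : ℝ) < √(b Δ * c Δ) := by
  obtain ⟨ha, hr, hb, hs, ht, hc⟩ := order_chain hΔ
  constructor <;> refine Real.sqrt_lt_sqrt (mul_nonneg (by linarith) (by linarith)) ?_
  · rw [mul_comm]; exact mul_lt_mul_of_pos_left (by linarith) (by linarith)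
  · exact mul_lt_mul_of_pos_right (by linarith) (by linarith)

lemma num_pos {Δ ε : ℤ} (hΔ : 6 ≤ Δ) (hε : ε = 1 ∨ ε = -1) : 0 < num Δ ε := by
  have := (sqrt_lt_sqrt_bc hΔ).1
  have h0 := Real.sqrt_nonneg (a Δ * b Δ : ℝ)
  rcases hε with rfl | rfl <;> simp only [num] <;> push_cast <;> linarith

lemma two_mul_sqrt_le {Δ : ℤ} (hΔ : 6 ≤ Δ) :
    2 * √(b Δ * c Δ : ℝ) ≤ Real.exp (6 * Real.log Δ + Real.log 2) := by
  have hΔ' : (6 : ℝ) ≤ Δ := by exact_mod_cast hΔ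
  rw [Real.exp_add, Real.exp_log two_pos, mul_comm, ← Nat.cast_ofNat (n := 6), Real.exp_nat_mul,
    Real.exp_log (by linarith)]
  gcongr
  have h : (b Δ * c Δ + 1 : ℝ) = t Δ ^ 2 := by exact_mod_cast bc_add_one Δ
  have ht : (t Δ : ℝ) ≤ Δ ^ 6 := by
    simp only [t]; push_cast; nlinarith [pow_pos (show (0 : ℝ) < Δ by linarith) 3,
      pow_pos (show (0 : ℝ) < Δ by linarith) 2]
  have ht0 : (0 : ℝ) ≤ t Δ := by
    obtain ⟨ha, hr, hb, hs, ht, hc⟩ := order_chain hΔ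
    linarith
  rw [Real.sqrt_le_left (by positivity)]
  have := pow_le_pow_left₀ ht0 ht 2
  linarith

lemma abs_conj_le {Δ ε : ℤ} (hΔ : 6 ≤ Δ) (hε : ε = 1 ∨ ε = -1) (i : Fin 4) :
    |conjDen Δ i| ≤ Real.exp (6 * Real.log Δ + Real.log 2) ∧
      |conjNum Δ ε i| ≤ Real.exp (6 * Real.log Δ + Real.log 2) := by
  obtain ⟨h1, h2⟩ := sqrt_lt_sqrt_bc hΔ
  have h3 := two_mul_sqrt_le hΔ
  have h4 := Real.sqrt_nonneg (a Δ * b Δ : ℝ)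
  have h5 := Real.sqrt_nonneg (a Δ * c Δ : ℝ)
  constructor
  · refine le_trans ?_ h3
    rw [abs_le]
    fin_cases i <;> simp [conjDen, biquad, sgnAB, sgnAC] <;> constructor <;> linarith
  · refine le_trans ?_ h3
    rw [abs_le]
    rcases hε with rfl | rfl <;>
    fin_cases i <;> simp [conjNum, biquad, sgnAB, sgnAC] <;> constructor <;> linarith

/-- A small value of the linear form is incompatible with the interpolation estimates. -/
theorem form_contradiction {Δ ε : ℤ} (hΔ : 6 ≤ Δ) (hε : ε = 1 ∨ ε = -1) {l m : ℕ}
    {p₁ p₂ l₀ m₀ : ℤ} {q L s t : ℕ} (hl : (l : ℤ) = q * p₁ + l₀) (hm : (m : ℤ) = q * p₂ + m₀)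
    (hp₁ : 0 < p₁) (hp₂ : 0 < p₂) (hL : Odd L) (hL3 : 3 ≤ L) (hs : Odd s) (ht : Odd t)
    (hK : 1000 ≤ s * t * L) (hq : 33 ≤ q) (hLt : L * t ≤ q)
    (hP : 33 * |p₁ * Real.log (α Δ) - p₂ * Real.log (ρ Δ)| +
      2 * (p₁ * Real.log (α Δ) + p₂ * Real.log (ρ Δ)) ≤ s * Real.log 32)
    (hW : 32 * |p₁ * Real.log (α Δ) - p₂ * Real.log (ρ Δ)| * q +
      3 * (|(l₀ : ℝ)| * Real.log (α Δ) + |(m₀ : ℝ)| * Real.log (ρ Δ)) +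
      8 * (6 * Real.log Δ + Real.log 2) ≤ t * Real.log 32)
    (hΛ : (L ^ 2 * s * |form Δ ε l m|) * 32 ^ (s * t * L * L) ≤ 1)
    (hfin : 2 * Real.log (17 * q / t) + 4.1 < L * Real.log 32 / 4 * (1 - 1 / (2 * t))) :
    False := by
  have hlog1 : 0 < Real.log (ρ Δ) := Real.log_pos (one_lt_ρ hΔ)
  have hlog2 : 0 < Real.log (α Δ) := Real.log_pos ((one_lt_ρ hΔ).trans (ρ_lt_α hΔ))
  have hlΔ : 0 ≤ Real.log Δ := Real.log_nonneg (by exact_mod_cast (by omega : (1 : ℤ) ≤ Δ))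
  have hl2 := Real.log_pos one_lt_two
  have hp1 : (0 : ℝ) < p₁ := by exact_mod_cast hp₁
  have hp2 : (0 : ℝ) < p₂ := by exact_mod_cast hp₂
  have hX := conjUnit_mem hΔ p₁ (-p₂)
  have hU := conjUnit_mem hΔ (-l₀) m₀
  have hA : conjDen Δ ∈ ring hΔ := ⟨_, _, _, _, rfl⟩
  have hB : conjNum Δ ε ∈ ring hΔ := ⟨_, _, _, _, rfl⟩
  have hX0 := conjUnit_pos_log hΔ p₁ (-p₂)
  have hU0 := conjUnit_pos_log hΔ (-l₀) m₀
  have hlX : Real.log (conjUnit Δ p₁ (-p₂) 0) =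
      p₁ * Real.log (α Δ) - p₂ * Real.log (ρ Δ) := by
    rw [(hX0 0).2]; simp [sgnAB, sgnAC]; ring
  have hden := den_pos hΔ
  have hnum := num_pos hΔ hε
  have hlU : Real.log (conjUnit Δ (-l₀) m₀ 0 * conjDen Δ 0 / conjNum Δ ε 0) =
      -l₀ * Real.log (α Δ) + m₀ * Real.log (ρ Δ) + Real.log (den Δ) - Real.log (num Δ ε) := by
    rw [conjDen_zero, conjNum_zero, Real.log_div (mul_pos (hU0 0).1 hden).ne' hnum.ne',
      Real.log_mul (hU0 0).1.ne' hden.ne', (hU0 0).2]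
    simp [sgnAB, sgnAC]
  refine not_interpolation (ring hΔ) (one_le_prod hΔ) hX.1 hX.2 hU.1 hU.2 hA hB
    (fun i => (hX0 i).1) (fun i => (hU0 i).1) (conjUnit_ne_one hΔ hp₁ (neg_lt_zero.2 hp₂))
    (by rw [conjDen_zero]; exact hden) (by rw [conjNum_zero]; exact hnum)
    (fun i => (abs_conj_le hΔ hε i).1) (fun i => (abs_conj_le hΔ hε i).2)
    hL hL3 hs ht hK hq hLt (by linarith) ?_ ?_ ?_ hfin
  · rw [hlX, Fin.sum_univ_three, (hX0 _).2, (hX0 _).2, (hX0 _).2]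
    refine le_trans ?_ hP
    simp only [sgnAB, sgnAC, Fin.succ_zero_eq_one, Fin.succ_one_eq_two, Matrix.cons_val]
    have e1 : |(p₁ : ℝ) * (-1 * Real.log (α Δ)) + ((-p₂ : ℤ) : ℝ) * (1 * Real.log (ρ Δ))| =
        p₁ * Real.log (α Δ) + p₂ * Real.log (ρ Δ) := by
      rw [← abs_neg, ← abs_of_pos (show 0 < p₁ * Real.log (α Δ) + p₂ * Real.log (ρ Δ) by
        positivity)]
      congr 1; push_cast; ring
    have e2 : |(p₁ : ℝ) * (1 * Real.log (α Δ)) + ((-p₂ : ℤ) : ℝ) * (-1 * Real.log (ρ Δ))| =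
        p₁ * Real.log (α Δ) + p₂ * Real.log (ρ Δ) := by
      rw [← abs_of_pos (show 0 < p₁ * Real.log (α Δ) + p₂ * Real.log (ρ Δ) by
        positivity)]
      congr 1; push_cast; ring
    have e3 : |(p₁ : ℝ) * (-1 * Real.log (α Δ)) + ((-p₂ : ℤ) : ℝ) * (-1 * Real.log (ρ Δ))| =
        |p₁ * Real.log (α Δ) - p₂ * Real.log (ρ Δ)| := by
      rw [← abs_neg]
      congr 1; push_cast; ring
    rw [e1, e2]
    have e4 : ((Fin.succ 2 : Fin 4)) = 3 := rfl
    rw [e4]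
    simp only [Matrix.cons_val]
    rw [e3]
    linarith
  · rw [hlX, Fin.sum_univ_three, (hU0 _).2, (hU0 _).2, (hU0 _).2]
    refine le_trans ?_ hW
    have key : ∀ k : Fin 4, |((-l₀ : ℤ) : ℝ) * (sgnAC k * Real.log (α Δ)) +
        m₀ * (sgnAB k * Real.log (ρ Δ))| ≤
        |(l₀ : ℝ)| * Real.log (α Δ) + |(m₀ : ℝ)| * Real.log (ρ Δ) := by
      intro k
      have e1 : |sgnAC k| = 1 := by fin_cases k <;> simp [sgnAC]
      have e2 : |sgnAB k| = 1 := by fin_cases k <;> simp [sgnAB]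
      refine (abs_add_le _ _).trans (le_of_eq ?_)
      rw [abs_mul, abs_mul, abs_mul, abs_mul, e1, e2, abs_of_pos hlog1, abs_of_pos hlog2]
      push_cast
      rw [abs_neg, one_mul, one_mul]
    linarith [key (Fin.succ 0), key (Fin.succ 1), key (Fin.succ 2)]
  · have hform : q * Real.log (conjUnit Δ p₁ (-p₂) 0) -
        Real.log (conjUnit Δ (-l₀) m₀ 0 * conjDen Δ 0 / conjNum Δ ε 0) = form Δ ε l m := by
      have e1 : (l : ℝ) = q * p₁ + l₀ := by exact_mod_cast hl
      have e2 : (m : ℝ) = q * p₂ + m₀ := by exact_mod_cast hm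
      rw [hlX, hlU, form, e1, e2]; ring
    rw [hform]
    exact hΛ

lemma α_sub_ρ_bounds {Δ : ℤ} (hΔ : 6 ≤ Δ) :
    2 * (a Δ : ℝ) ≤ α Δ - ρ Δ ∧ α Δ - ρ Δ ≤ 2 * a Δ + 1 := by
  have h1 := one_lt_ρ hΔ
  have h2 := ρ_lt_α hΔ
  have h3 : s Δ - √(a Δ * c Δ) = (α Δ)⁻¹ := eq_inv_of_mul_eq_one_right (α_mul_conj hΔ)
  have h4 : r Δ - √(a Δ * b Δ) = (ρ Δ)⁻¹ := eq_inv_of_mul_eq_one_right (ρ_mul_conj hΔ)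
  have h5 : (α Δ)⁻¹ ≤ (ρ Δ)⁻¹ := inv_anti₀ (by linarith) h2.le
  have h6 : (ρ Δ)⁻¹ ≤ 1 := inv_le_one_of_one_le₀ h1.le
  have h7 : 0 < (α Δ)⁻¹ := inv_pos.2 (by linarith)
  have h8 : (s Δ : ℝ) = a Δ + r Δ := by exact_mod_cast s_eq Δ
  have e1 : α Δ = s Δ + √(a Δ * c Δ) := rfl
  have e2 : ρ Δ = r Δ + √(a Δ * b Δ) := rfl
  constructor <;> linarith

lemma ρ_lower {Δ : ℤ} (hΔ : 6 ≤ Δ) : 2 * (r Δ : ℝ) - 1 ≤ ρ Δ := by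
  have h1 := one_lt_ρ hΔ
  have h4 : r Δ - √(a Δ * b Δ) = (ρ Δ)⁻¹ := eq_inv_of_mul_eq_one_right (ρ_mul_conj hΔ)
  have h6 : (ρ Δ)⁻¹ ≤ 1 := inv_le_one_of_one_le₀ h1.le
  have e2 : ρ Δ = r Δ + √(a Δ * b Δ) := rfl
  linarith

lemma α_upper {Δ : ℤ} (hΔ : 6 ≤ Δ) : α Δ ≤ 2 * s Δ := by
  have h1 := (one_lt_ρ hΔ).trans (ρ_lt_α hΔ)
  have h3 : s Δ - √(a Δ * c Δ) = (α Δ)⁻¹ := eq_inv_of_mul_eq_one_right (α_mul_conj hΔ)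
  have h7 : 0 < (α Δ)⁻¹ := inv_pos.2 (by linarith)
  have e1 : α Δ = s Δ + √(a Δ * c Δ) := rfl
  linarith

lemma thousand_le_ρ {Δ : ℤ} (hΔ : 6 ≤ Δ) : 1000 ≤ ρ Δ := by
  obtain ⟨ha, hr, hb, hs, ht, hc⟩ := order_chain hΔ
  linarith [ρ_lower hΔ]

lemma logα_sub_logρ_bounds {Δ : ℤ} (hΔ : 6 ≤ Δ) :
    a Δ / s Δ ≤ Real.log (α Δ) - Real.log (ρ Δ) ∧
      Real.log (α Δ) - Real.log (ρ Δ) ≤ (2 * a Δ + 1) / (2 * r Δ - 1) := by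
  obtain ⟨ha, hr, hb, hs, ht, hc⟩ := order_chain hΔ
  obtain ⟨h1, h2⟩ := α_sub_ρ_bounds hΔ
  have h3 := ρ_lower hΔ
  have h4 := α_upper hΔ
  have h5 := thousand_le_ρ hΔ
  have h6 := ρ_lt_α hΔ
  have hα : 0 < α Δ := by linarith
  have hρ : 0 < ρ Δ := by linarith
  constructor
  · have h := Real.log_le_sub_one_of_pos (div_pos hρ hα)
    rw [Real.log_div hρ.ne' hα.ne'] at h
    have : (a Δ : ℝ) / s Δ ≤ 1 - ρ Δ / α Δ := by
      rw [one_sub_div hα.ne', div_le_div_iff₀ (by linarith) hα]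
      nlinarith
    linarith
  · have h := Real.log_le_sub_one_of_pos (div_pos hα hρ)
    rw [Real.log_div hα.ne' hρ.ne'] at h
    refine h.trans ?_
    rw [div_sub_one hρ.ne']
    apply div_le_div₀ <;> linarith

lemma logα_sub_logρ_le {Δ : ℤ} (hΔ : 6 ≤ Δ) :
    0 < Real.log (α Δ) - Real.log (ρ Δ) ∧ Real.log (α Δ) - Real.log (ρ Δ) ≤ 1 / 30 := by
  obtain ⟨ha, hr, hb, hs, ht, hc⟩ := order_chain hΔ
  obtain ⟨h1, h2⟩ := logα_sub_logρ_bounds hΔ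
  refine ⟨lt_of_lt_of_le (div_pos (by linarith) (by linarith)) h1, h2.trans ?_⟩
  rw [div_le_div_iff₀ (by linarith) (by norm_num)]
  linarith

lemma logα_bounds {Δ : ℤ} (hΔ : 6 ≤ Δ) :
    4 * Real.log Δ ≤ Real.log (α Δ) ∧ Real.log (α Δ) ≤ 4 * Real.log Δ + Real.log 2 := by
  obtain ⟨ha, hr, hb, hs, ht, hc⟩ := order_chain hΔ
  have hΔ' : (6 : ℝ) ≤ Δ := by exact_mod_cast hΔ
  have h0 : (0 : ℝ) < Δ ^ 4 := by positivity
  have e : 4 * Real.log Δ = Real.log (Δ ^ 4) := by rw [Real.log_pow]; norm_num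
  have hsd : (s Δ : ℝ) = Δ ^ 4 - Δ ^ 2 - Δ := by simp only [s]; push_cast; ring
  have hrd : (r Δ : ℝ) = Δ ^ 4 - 2 * Δ ^ 2 - Δ + 1 := by simp only [r]; push_cast; ring
  rw [e, ← Real.log_mul h0.ne' two_ne_zero]
  constructor
  · refine Real.log_le_log h0 (le_trans ?_ (ρ_lt_α hΔ).le)
    refine le_trans ?_ (ρ_lower hΔ)
    rw [hrd]
    nlinarith [pow_le_pow_left₀ (by norm_num) hΔ' 2]
  · refine Real.log_le_log (by linarith [thousand_le_ρ hΔ, ρ_lt_α hΔ]) ((α_upper hΔ).trans ?_)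
    rw [hsd]
    nlinarith

lemma abs_log_num_sub_log_den_le {Δ ε : ℤ} (hΔ : 6 ≤ Δ) (hε : ε = 1 ∨ ε = -1) :
    |Real.log (num Δ ε) - Real.log (den Δ)| ≤ 1 / 16 := by
  obtain ⟨ha, hr, hb, hs, ht, hc⟩ := order_chain hΔ
  have hn := num_pos hΔ hε
  have hd := den_pos hΔ
  have hn1 : √(a Δ * b Δ : ℝ) ≤ √(b Δ * c Δ) / 33 := by
    rw [le_div_iff₀ (by norm_num), Real.le_sqrt (by positivity), mul_pow, Real.sq_sqrt]
    · nlinarith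
    · nlinarith
    · nlinarith
  have hn2 : √(a Δ * c Δ : ℝ) ≤ √(b Δ * c Δ) / 33 := by
    rw [le_div_iff₀ (by norm_num), Real.le_sqrt (by positivity), mul_pow, Real.sq_sqrt]
    · nlinarith
    · nlinarith
    · nlinarith
  have h4 := Real.sqrt_nonneg (a Δ * b Δ : ℝ)
  have h5 := Real.sqrt_nonneg (a Δ * c Δ : ℝ)
  have hnum : 32 / 33 * √(b Δ * c Δ : ℝ) ≤ num Δ ε ∧ num Δ ε ≤ 34 / 33 * √(b Δ * c Δ) := by
    rcases hε with rfl | rfl <;> simp only [num] <;> push_cast <;> constructor <;> linarith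
  have hden : √(b Δ * c Δ : ℝ) ≤ den Δ ∧ den Δ ≤ 34 / 33 * √(b Δ * c Δ) := by
    simp only [den]; constructor <;> linarith
  rw [abs_le]
  constructor
  · have h := Real.log_le_sub_one_of_pos (div_pos hd hn)
    rw [Real.log_div hd.ne' hn.ne'] at h
    have : den Δ / num Δ ε ≤ 17 / 16 := by
      rw [div_le_iff₀ hn]; linarith
    linarith
  · have h := Real.log_le_sub_one_of_pos (div_pos hn hd)
    rw [Real.log_div hn.ne' hd.ne'] at h
    have : num Δ ε / den Δ ≤ 17 / 16 := by
      rw [div_le_iff₀ hd]; linarith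
    linarith

lemma form_window {Δ ε : ℤ} (hΔ : 6 ≤ Δ) (hε : ε = 1 ∨ ε = -1) {l m : ℕ} (hm : 1 ≤ m)
    (hf : |form Δ ε l m| ≤ 4 / ρ Δ ^ (2 * m)) :
    |m * (Real.log (α Δ) - Real.log (ρ Δ)) - (m - l) * Real.log (α Δ)| ≤ 1 / 10 := by
  have h1 := abs_le.1 (abs_log_num_sub_log_den_le hΔ hε)
  have h2 : 4 / ρ Δ ^ (2 * m) ≤ 1 / 100 := by
    have h3 := thousand_le_ρ hΔ
    rw [div_le_div_iff₀ (by positivity) (by norm_num)]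
    have : ρ Δ ^ 1 ≤ ρ Δ ^ (2 * m) := pow_le_pow_right₀ (by linarith) (by omega)
    linarith
  have h3 := abs_le.1 (hf.trans h2)
  unfold form at h3
  rw [abs_le]
  constructor <;> linarith

lemma exists_odd_nat {x : ℝ} (hx : 1 ≤ x) : ∃ n : ℕ, Odd n ∧ x ≤ n ∧ n ≤ x + 2 := by
  refine ⟨2 * ⌈(x - 1) / 2⌉₊ + 1, odd_two_mul_add_one _, ?_, ?_⟩
  · push_cast; linarith [Nat.le_ceil ((x - 1) / 2)]
  · push_cast; linarith [Nat.ceil_lt_add_one (show 0 ≤ (x - 1) / 2 by linarith)]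

lemma log_32_bounds : 3.4657 < Real.log 32 ∧ Real.log 32 < 3.4658 := by
  have e : Real.log 32 = 5 * Real.log 2 := by
    rw [show (32 : ℝ) = 2 ^ 5 by norm_num, Real.log_pow]; norm_num
  have h1 := Real.log_two_gt_d9
  have h2 := Real.log_two_lt_d9
  rw [e]; constructor <;> linarith

lemma smallness_of_log_le {Δ ε : ℤ} (hΔ : 6 ≤ Δ) {l m L s t : ℕ}
    (hf : |form Δ ε l m| ≤ 4 / ρ Δ ^ (2 * m)) (hs : 1 ≤ s) (hL : 1 ≤ L)
    (h : s * L ^ 2 * (4 + t * Real.log 32) ≤ 2 * m * Real.log (ρ Δ)) :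
    (L ^ 2 * s * |form Δ ε l m|) * 32 ^ (s * t * L * L) ≤ 1 := by
  have hρ : 0 < ρ Δ := by linarith [thousand_le_ρ hΔ]
  have hs' : (1 : ℝ) ≤ s := by exact_mod_cast hs
  have hL' : (1 : ℝ) ≤ L := by exact_mod_cast hL
  have h1 : (4 * (L : ℝ) ^ 2 * s) * 32 ^ (s * t * L * L) ≤ ρ Δ ^ (2 * m) := by
    rw [← Real.log_le_log_iff (by positivity) (by positivity),
      Real.log_mul (by positivity) (by positivity), Real.log_pow, Real.log_pow]
    have := Real.log_le_sub_one_of_pos (show 0 < 4 * (L : ℝ) ^ 2 * s by positivity)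
    push_cast
    linarith
  calc (L ^ 2 * s * |form Δ ε l m|) * 32 ^ (s * t * L * L)
      ≤ (L ^ 2 * s * (4 / ρ Δ ^ (2 * m))) * 32 ^ (s * t * L * L) := by gcongr
    _ = ((4 * (L : ℝ) ^ 2 * s) * 32 ^ (s * t * L * L)) / ρ Δ ^ (2 * m) := by ring
    _ ≤ 1 := by rwa [div_le_one (by positivity)]

lemma log_large {Δ : ℝ} (hΔ : 300 ≤ Δ) :
    5.5 ≤ Real.log Δ ∧ Real.log Δ ≤ Δ / 300 + 4.72 := by
  have h1 := Real.log_two_gt_d9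
  have h2 := Real.log_two_lt_d9
  constructor
  · have : Real.log (2 ^ 8) ≤ Real.log Δ := Real.log_le_log (by norm_num) (by linarith)
    rw [Real.log_pow] at this
    push_cast at this; linarith
  · have h3 : Real.log (300 ^ 4) ≤ Real.log (2 ^ 33) := Real.log_le_log (by norm_num) (by norm_num)
    rw [Real.log_pow, Real.log_pow] at h3
    have h4 := Real.log_le_sub_one_of_pos (show 0 < Δ / 300 by positivity)
    rw [Real.log_div (by linarith) (by norm_num)] at h4
    push_cast at h3; linarith

lemma logα_sub_logρ_large {Δ : ℤ} (hΔ : 300 ≤ Δ) :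
    0.99 ≤ (Real.log (α Δ) - Real.log (ρ Δ)) * Δ ^ 2 ∧
      (Real.log (α Δ) - Real.log (ρ Δ)) * Δ ^ 2 ≤ 1.01 := by
  have hΔ6 : 6 ≤ Δ := by linarith
  have hΔ' : (300 : ℝ) ≤ Δ := by exact_mod_cast hΔ
  obtain ⟨hl2, hl3⟩ := logα_sub_logρ_bounds hΔ6
  have hasd : (a Δ : ℝ) = Δ ^ 2 - 1 := by simp only [a]; push_cast; ring
  have hsd : (s Δ : ℝ) = Δ ^ 4 - Δ ^ 2 - Δ := by simp only [s]; push_cast; ring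
  have hrd : (r Δ : ℝ) = Δ ^ 4 - 2 * Δ ^ 2 - Δ + 1 := by simp only [r]; push_cast; ring
  have hΔ1 : 300 * (Δ : ℝ) ≤ Δ ^ 2 := by rw [sq]; gcongr
  have hΔ4 : 90000 * (Δ : ℝ) ^ 2 ≤ Δ ^ 4 := by
    have : (300 : ℝ) ^ 2 * Δ ^ 2 ≤ Δ ^ 2 * Δ ^ 2 := by gcongr
    linarith
  constructor
  · refine le_trans ?_ (mul_le_mul_of_nonneg_right hl2 (by positivity))
    rw [hasd, hsd, div_mul_eq_mul_div, le_div_iff₀ (by linarith)]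
    linarith
  · refine le_trans (mul_le_mul_of_nonneg_right hl3 (by positivity)) ?_
    rw [hasd, hrd, div_mul_eq_mul_div, div_le_iff₀ (by linarith)]
    linarith

lemma size_bounds {m N κ D : ℝ} (hm : 0 < m) (hN : 20 ≤ N) (hD : 0 ≤ D) (h1 : 0.99 ≤ κ * D)
    (h2 : κ * D ≤ 1.01) (hw1 : -(1 / 10) ≤ m * κ - N) (hw2 : m * κ - N ≤ 1 / 10) :
    0.985 * N * D ≤ m ∧ m ≤ 1.016 * N * D := by
  have h3 : 0 ≤ N * D := by positivity
  have h4 : 0.995 * N * D ≤ m * κ * D :=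
    mul_le_mul_of_nonneg_right (by linarith) hD
  have h5 : m * κ * D ≤ 1.005 * N * D :=
    mul_le_mul_of_nonneg_right (by linarith) hD
  have h6 := mul_le_mul_of_nonneg_left h1 hm.le
  have h7 := mul_le_mul_of_nonneg_left h2 hm.le
  constructor <;> linarith

/-- For large `Δ` the linear form cannot be small. -/
theorem large_contradiction {Δ ε : ℤ} (hΔ : 300 ≤ Δ) (hε : ε = 1 ∨ ε = -1) {l m : ℕ}
    (hlm : l < m) (hf : |form Δ ε l m| ≤ 4 / ρ Δ ^ (2 * m)) : False := by
  have hΔ6 : 6 ≤ Δ := by linarith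
  have hΔ' : (300 : ℝ) ≤ Δ := by exact_mod_cast hΔ
  obtain ⟨hlog1, hlog2⟩ := log_large hΔ'
  obtain ⟨hα1, hα2⟩ := logα_bounds hΔ6
  obtain ⟨hl0, hl1⟩ := logα_sub_logρ_le hΔ6
  obtain ⟨hl2, hl3⟩ := logα_sub_logρ_bounds hΔ6
  have hw := abs_le.1 (form_window hΔ6 hε (by omega) hf)
  obtain ⟨hc1, hc2⟩ := log_32_bounds
  have hlog2a := Real.log_two_gt_d9
  have hlog2b := Real.log_two_lt_d9
  have hν : (1 : ℝ) ≤ m - l := by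
    have : (l : ℝ) + 1 ≤ m := by exact_mod_cast hlm
    linarith
  obtain ⟨hlam1, hlam2⟩ := logα_sub_logρ_large hΔ
  have hm0 : (0 : ℝ) < m := by
    have : (0 : ℝ) ≤ l := Nat.cast_nonneg _
    linarith
  have hℓ22 : 22 ≤ Real.log (α Δ) := by linarith
  have hνℓ : Real.log (α Δ) ≤ (m - l) * Real.log (α Δ) :=
    le_mul_of_one_le_left (by linarith) hν
  obtain ⟨hm1, hm2⟩ := size_bounds hm0 (by linarith) (by positivity) hlam1 hlam2 hw.1 hw.2
  have hw2 := hw.2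
  clear hlam1 hlam2 hw hl2 hl3
  generalize hℓ : Real.log (α Δ) = ℓ at *
  generalize hlρ : Real.log (ρ Δ) = lρ at *
  generalize hνdef : (m : ℝ) - l = ν at *
  generalize hc₀ : Real.log 32 = c₀ at *
  obtain ⟨s, hs, hs1, hs2⟩ := exists_odd_nat (x := (33 * (ℓ - lρ) + 4 * ℓ) / c₀)
    ((one_le_div (by linarith)).2 (by linarith))
  obtain ⟨t, ht, ht1, ht2⟩ := exists_odd_nat (x := (35 * (ν * ℓ) + 12 * ℓ + 8.8) / c₀)
    ((one_le_div (by linarith)).2 (by linarith))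
  obtain ⟨L, hL, hL1, hL2⟩ := exists_odd_nat (x := (Δ : ℝ) / 7 - 2) (by linarith)
  rw [div_le_iff₀ (by linarith)] at hs1 ht1
  replace hs2 : s * c₀ ≤ 4.37 * ℓ := by
    have := mul_le_mul_of_nonneg_right hs2 (show 0 ≤ c₀ by linarith)
    rw [add_mul, div_mul_cancel₀ _ (by linarith)] at this
    linarith
  replace ht2 : t * c₀ ≤ 47.8 * (ν * ℓ) := by
    have := mul_le_mul_of_nonneg_right ht2 (show 0 ≤ c₀ by linarith)
    rw [add_mul, div_mul_cancel₀ _ (by linarith)] at this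
    linarith
  have ht298 : (298 : ℝ) ≤ t := by
    by_contra! h
    have := mul_lt_mul_of_pos_right h (show 0 < c₀ by linarith)
    linarith
  have hL40 : (40 : ℝ) ≤ L := by linarith
  have hs1' : 1 ≤ s := hs.pos
  have hL40' : 40 ≤ L := by exact_mod_cast hL40
  have ht298' : 298 ≤ t := by exact_mod_cast ht298
  have hX : 0 ≤ (ν * ℓ) * Δ ^ 2 := mul_nonneg (by linarith) (by positivity)
  have hc₀' : 0 < c₀ := by linarith
  have hN0 : 0 < ν * ℓ := by linarith
  have hLt1 : 40 * 298 ≤ L * t := Nat.mul_le_mul hL40' ht298'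
  have hK : 1000 ≤ s * t * L := by
    have := Nat.mul_le_mul hs1' hLt1
    rw [mul_assoc, mul_comm t]; omega
  have hLt : L * t ≤ m := by
    have h1 : (L : ℝ) * (t * c₀) ≤ (Δ / 7) * (47.8 * (ν * ℓ)) := by
      apply mul_le_mul (by linarith) ht2 (by positivity) (by positivity)
    have h3 : (L : ℝ) * t * 3 ≤ L * (t * c₀) := by rw [mul_assoc]; gcongr; linarith
    have h4 : Δ * (ν * ℓ) * 300 ≤ (ν * ℓ) * Δ ^ 2 := by
      have := mul_le_mul_of_nonneg_left hΔ' (show 0 ≤ Δ * (ν * ℓ) by positivity)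
      linarith
    have h2 : (L * t : ℝ) ≤ m := by linarith
    exact_mod_cast h2
  have hq : 33 ≤ m := by omega
  refine form_contradiction hΔ6 hε (l := l) (m := m) (p₁ := 1) (p₂ := 1) (l₀ := l - m) (m₀ := 0)
    (q := m) (L := L) (s := s) (t := t) (by ring) (by ring) one_pos one_pos hL (by omega) hs ht
    hK hq hLt ?_ ?_ ?_ ?_
  · rw [hℓ, hlρ, hc₀]
    push_cast
    rw [one_mul, one_mul, abs_of_pos hl0]
    linarith
  · rw [hℓ, hlρ, hc₀]
    push_cast
    rw [one_mul, one_mul, abs_of_pos hl0, abs_zero, abs_sub_comm, hνdef,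
      abs_of_pos (show 0 < ν by linarith)]
    linarith
  · refine smallness_of_log_le hΔ6 hf hs1' (by omega) ?_
    rw [hlρ, hc₀]
    have h1 : (s : ℝ) ≤ 1.261 * ℓ := by
      have : s * 3.4657 ≤ s * c₀ := by gcongr
      linarith
    have h2 : (L : ℝ) ^ 2 ≤ (Δ / 7) ^ 2 := pow_le_pow_left₀ (by linarith) (by linarith) 2
    have h3 : 4 + t * c₀ ≤ 48 * (ν * ℓ) := by linarith
    have h4 : 0.99 * ℓ ≤ lρ := by linarith
    calc s * (L : ℝ) ^ 2 * (4 + t * c₀) ≤ (1.261 * ℓ) * (Δ / 7) ^ 2 * (48 * (ν * ℓ)) := by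
          gcongr
      _ ≤ 2 * (0.985 * (ν * ℓ) * Δ ^ 2) * (0.99 * ℓ) := by
          have : 0 ≤ (ν * ℓ) * Δ ^ 2 * ℓ := mul_nonneg hX (by linarith)
          linarith
      _ ≤ 2 * m * lρ := by gcongr
  · rw [hc₀]
    have h1 : 17 * (m : ℝ) / t ≤ 2 * Δ ^ 2 := by
      rw [div_le_iff₀ (by linarith)]
      have h2 : 10 * (ν * ℓ) ≤ t := by
        have : t * c₀ ≤ t * 3.4658 := by gcongr
        linarith
      have := mul_le_mul_of_nonneg_left h2 (show 0 ≤ 2 * (Δ : ℝ) ^ 2 by positivity)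
      linarith
    have h2 : Real.log (17 * m / t) ≤ Real.log 2 + 2 * Real.log Δ := by
      refine (Real.log_le_log (by positivity) h1).trans (le_of_eq ?_)
      rw [Real.log_mul two_ne_zero (by positivity), Real.log_pow]; norm_num
    have h3 : (0.99 : ℝ) ≤ 1 - 1 / (2 * t) := by
      have : 1 / (2 * (t : ℝ)) ≤ 1 / 100 := by
        apply one_div_le_one_div_of_le <;> linarith
      linarith
    have h4 : (Δ / 7 - 2) * 3.4657 / 4 * 0.99 ≤ L * c₀ / 4 * (1 - 1 / (2 * t)) := by
      have : (0 : ℝ) ≤ Δ / 7 - 2 := by linarith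
      gcongr
    refine lt_of_lt_of_le ?_ h4
    linarith

lemma logα_small {Δ : ℤ} (hΔ : 6 ≤ Δ) (hΔ2 : Δ < 300) :
    6.9 ≤ Real.log (α Δ) ∧ Real.log (α Δ) ≤ 23.6 := by
  have hΔ' : (6 : ℝ) ≤ Δ := by exact_mod_cast hΔ
  have hΔ2' : (Δ : ℝ) < 300 := by exact_mod_cast hΔ2
  obtain ⟨h1, h2⟩ := logα_bounds hΔ
  have h3 := Real.log_two_gt_d9
  have h4 := Real.log_two_lt_d9
  constructor
  · have : Real.log (2 ^ 10) ≤ Real.log (Δ ^ 4) := Real.log_le_log (by norm_num)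
      (le_trans (by norm_num) (pow_le_pow_left₀ (by norm_num) hΔ' 4))
    rw [Real.log_pow, Real.log_pow] at this
    push_cast at this; linarith
  · have : Real.log (Δ ^ 4) ≤ Real.log (2 ^ 33) := Real.log_le_log (by positivity)
      (le_trans (pow_le_pow_left₀ (by linarith) hΔ2'.le 4) (by norm_num))
    rw [Real.log_pow, Real.log_pow] at this
    push_cast at this; linarith

/-- For `Δ` in the intermediate range the index is bounded. -/
theorem index_bound {Δ ε : ℤ} (hΔ : 6 ≤ Δ) (hΔ2 : Δ < 300) (hε : ε = 1 ∨ ε = -1) {l m : ℕ}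
    (hm : 1 ≤ m) (hf : |form Δ ε l m| ≤ 4 / ρ Δ ^ (2 * m)) : m < 10 ^ 19 := by
  by_contra! hmbig
  obtain ⟨hℓ1, hℓ2⟩ := logα_small hΔ hΔ2
  obtain ⟨hl0, hl1⟩ := logα_sub_logρ_le hΔ
  obtain ⟨hα1, -⟩ := logα_bounds hΔ
  have hw := form_window hΔ hε hm hf
  obtain ⟨hc1, hc2⟩ := log_32_bounds
  have hlog2 := Real.log_two_lt_d9
  obtain ⟨p₁, p₂, hp₂, hp₂', hδ⟩ := Real.exists_int_int_abs_mul_sub_le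
    (Real.log (ρ Δ) / Real.log (α Δ)) (show 0 < 10 ^ 6 by norm_num)
  lift p₂ to ℕ using hp₂.le
  have hp₂1 : 1 ≤ p₂ := by exact_mod_cast hp₂
  have hp₂2 : p₂ ≤ 10 ^ 6 := by exact_mod_cast hp₂'
  obtain ⟨q, m₀, hqm, hm₀⟩ : ∃ q m₀ : ℕ, m = q * p₂ + m₀ ∧ m₀ < p₂ :=
    ⟨m / p₂, m % p₂, (Nat.div_add_mod' m p₂).symm, Nat.mod_lt _ hp₂1⟩
  have hq13 : 99 * 10 ^ 11 ≤ q := by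
    by_contra! h
    have := Nat.mul_le_mul h.le hp₂2
    omega
  have hml : (m : ℝ) * (Real.log (α Δ) - Real.log (ρ Δ)) - (m - l) * Real.log (α Δ) =
    l * Real.log (α Δ) - m * Real.log (ρ Δ) := by ring
  rw [hml, abs_le] at hw
  have hmR : (m : ℝ) = q * p₂ + m₀ := by exact_mod_cast hqm
  have hm₀R : (m₀ : ℝ) ≤ 10 ^ 6 := by exact_mod_cast hm₀.le.trans hp₂2
  have hp₂R : (p₂ : ℝ) ≤ 10 ^ 6 := by exact_mod_cast hp₂2
  have hp₂R' : (1 : ℝ) ≤ p₂ := by exact_mod_cast hp₂1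
  have hqR : (99 * 10 ^ 11 : ℝ) ≤ q := by exact_mod_cast hq13
  have hδ' : |p₁ * Real.log (α Δ) - p₂ * Real.log (ρ Δ)| ≤ Real.log (α Δ) / 10 ^ 6 := by
    have h1 : p₁ * Real.log (α Δ) - p₂ * Real.log (ρ Δ) =
      -(((p₂ : ℤ) : ℝ) * (Real.log (ρ Δ) / Real.log (α Δ)) - p₁) * Real.log (α Δ) := by
      have : Real.log (α Δ) ≠ 0 := (show 0 < Real.log (α Δ) by linarith).ne'
      field_simp; push_cast; ring
    rw [h1, abs_mul, abs_neg, abs_of_pos (show 0 < Real.log (α Δ) by linarith),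
      div_eq_inv_mul (Real.log (α Δ)) (10 ^ 6)]
    exact mul_le_mul_of_nonneg_right (hδ.trans (by norm_num)) (by linarith)
  have hΛ := fun s t hs h =>
    smallness_of_log_le (L := 33) (s := s) (t := t) hΔ hf hs (by norm_num) h
  have main := fun s t => form_contradiction hΔ hε (l := l) (m := m) (p₁ := p₁) (p₂ := p₂)
    (l₀ := l - q * p₁) (m₀ := m₀) (q := q) (L := 33) (s := s) (t := t) (by ring)
    (by exact_mod_cast hqm)
  clear hml hδ hp₂' hmbig hf
  generalize Real.log (α Δ) = ℓ at *
  generalize Real.log (ρ Δ) = lρ at *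
  generalize Real.log 32 = c₀ at *
  have hκ : 0.99 * ℓ ≤ lρ := by linarith
  obtain ⟨hδ1, hδ2⟩ := abs_le.1 hδ'
  have hp₁ : 0 < p₁ := by
    by_contra! h
    have h1 : (p₁ : ℝ) * ℓ ≤ 0 :=
      mul_nonpos_of_nonpos_of_nonneg (by exact_mod_cast h) (by linarith)
    have h2 : lρ ≤ p₂ * lρ := le_mul_of_one_le_left (by linarith) hp₂R'
    linarith
  have hp₁R : (0 : ℝ) < p₁ := by exact_mod_cast hp₁
  have hpℓ : ℓ ≤ p₂ * ℓ := le_mul_of_one_le_left (by linarith) hp₂R'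
  have hpl : p₂ * lρ ≤ p₂ * ℓ := by gcongr; linarith
  have hpl' : lρ ≤ p₂ * lρ := le_mul_of_one_le_left (by linarith) hp₂R'
  obtain ⟨u, hu⟩ : ∃ u : ℝ, q = 10 ^ 6 * u := ⟨q / 10 ^ 6, by ring⟩
  have hu1 : 9.9 * 10 ^ 6 ≤ u := by linarith
  have hc₀ : 0 < c₀ := by linarith
  obtain ⟨s, hs, hs1, hs2⟩ := exists_odd_nat
    (x := (35 * (ℓ / 10 ^ 6) + 4 * (p₂ * ℓ)) / c₀) ((one_le_div hc₀).2 (by linarith))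
  obtain ⟨t, ht, ht1, ht2⟩ := exists_odd_nat (x := 243 * u) (by linarith)
  rw [div_le_iff₀ hc₀] at hs1
  replace hs2 : s * c₀ ≤ 5.01 * (p₂ * ℓ) := by
    have := mul_le_mul_of_nonneg_right hs2 hc₀.le
    rw [add_mul, div_mul_cancel₀ _ hc₀.ne'] at this
    linarith
  have ht1000 : 1000 ≤ t := by
    have : (1000 : ℝ) ≤ t := by linarith
    exact_mod_cast this
  have htc : 842 * u ≤ t * c₀ := by
    have : 243 * u * 3.4657 ≤ t * c₀ := by gcongr
    linarith
  have htc2 : t * c₀ ≤ 845.8 * u := by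
    have : t * c₀ ≤ (244 * u) * 3.4658 := by gcongr; linarith
    linarith
  have hLt : 33 * t ≤ q := by
    have : (33 * t : ℝ) ≤ q := by linarith
    exact_mod_cast this
  have hK : 1000 ≤ s * t * 33 := by
    have := Nat.mul_le_mul hs.pos ht1000
    omega
  refine main s t hp₁ (by exact_mod_cast hp₂) (by decide) (by norm_num) hs ht hK (by omega) hLt
    ?_ ?_ (hΛ s t hs.pos ?_) ?_
  · push_cast
    linarith
  · have h0 : (((l : ℤ) - q * p₁ : ℤ) : ℝ) * ℓ =
        (l * ℓ - m * lρ) + m₀ * lρ - q * (p₁ * ℓ - p₂ * lρ) := by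
      push_cast; rw [hmR]; ring
    have h1 : |(((l : ℤ) - q * p₁ : ℤ) : ℝ)| * ℓ ≤ 1 / 10 + m₀ * lρ + q * (ℓ / 10 ^ 6) := by
      rw [← abs_of_pos (show 0 < ℓ by linarith), ← abs_mul, abs_of_pos (show 0 < ℓ by linarith), h0]
      refine (abs_sub _ _).trans (add_le_add ((abs_add_le _ _).trans (add_le_add ?_ ?_)) ?_)
      · rw [abs_le]; exact hw
      · rw [abs_of_nonneg (mul_nonneg (Nat.cast_nonneg _) (by linarith))]
      · rw [abs_mul, abs_of_nonneg (Nat.cast_nonneg q : (0 : ℝ) ≤ q)]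
        gcongr
    have h2 : |(((m₀ : ℤ)) : ℝ)| = m₀ := by push_cast; exact abs_of_nonneg (Nat.cast_nonneg _)
    have h3 : m₀ * lρ ≤ 10 ^ 6 * 23.6 :=
      mul_le_mul hm₀R (by linarith) (by linarith) (by norm_num)
    have h4 : q * (ℓ / 10 ^ 6) ≤ 23.6 * u := by
      rw [hu]
      have := mul_le_mul_of_nonneg_left hℓ2 (show 0 ≤ u by linarith)
      linarith
    have h5 := mul_le_mul_of_nonneg_right hδ' (Nat.cast_nonneg q : (0 : ℝ) ≤ q)
    rw [h2]
    push_cast at h1 h5 ⊢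
    linarith
  · have h1 : (s : ℝ) ≤ 1.446 * (p₂ * ℓ) := by
      have : s * 3.4657 ≤ s * c₀ := by gcongr
      linarith
    have h2 : (4 + t * c₀) ≤ 846 * u := by linarith
    have h3 : (q * p₂ : ℝ) ≤ m := by rw [hmR]; linarith [(Nat.cast_nonneg m₀ : (0 : ℝ) ≤ m₀)]
    calc s * ((33 : ℕ) : ℝ) ^ 2 * (4 + t * c₀)
        ≤ (1.446 * (p₂ * ℓ)) * ((33 : ℕ) : ℝ) ^ 2 * (846 * u) := by gcongr
      _ ≤ 2 * (q * p₂) * (0.99 * ℓ) := by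
          rw [hu]
          have : 0 ≤ p₂ * ℓ * u := mul_nonneg (by linarith) (by linarith)
          push_cast
          linarith
      _ ≤ 2 * m * lρ := by gcongr
  · have h1 : 17 * (q : ℝ) / t ≤ 2 ^ 17 := by
      rw [div_le_iff₀ (by linarith)]
      linarith
    have h2 : Real.log (17 * q / t) ≤ 17 * Real.log 2 := by
      have := Real.log_le_log (div_pos (by linarith) (by linarith)) h1
      rw [Real.log_pow] at this
      exact_mod_cast this
    have h3 : (0.999 : ℝ) ≤ 1 - 1 / (2 * t) := by
      have : 1 / (2 * (t : ℝ)) ≤ 1 / 1000 := by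
        apply one_div_le_one_div_of_le <;> linarith
      linarith
    have h4 : (33 : ℝ) * 3.4657 / 4 * 0.999 ≤ (33 : ℕ) * c₀ / 4 * (1 - 1 / (2 * t)) := by
      push_cast
      gcongr
    refine lt_of_lt_of_le ?_ h4
    linarith

/-- The series of `artanh √y / √y`, starting from the term of index `i`. -/
noncomputable def artanhTail (y : ℝ) (i : ℕ) : ℝ := ∑' k : ℕ, y ^ k / (2 * (i + k : ℕ) + 1)

lemma artanhTail_term_le {y : ℝ} (hy : 0 ≤ y) (i k : ℕ) :
    y ^ k / (2 * (i + k : ℕ) + 1) ≤ y ^ k :=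
  div_le_self (by positivity) (by linarith [(Nat.cast_nonneg (i + k) : (0 : ℝ) ≤ (i + k : ℕ))])

lemma summable_artanhTail {y : ℝ} (hy : 0 ≤ y) (hy1 : y < 1) (i : ℕ) :
    Summable fun k : ℕ => y ^ k / (2 * (i + k : ℕ) + 1) :=
  Summable.of_nonneg_of_le (fun _ => by positivity) (artanhTail_term_le hy i)
    (summable_geometric_of_lt_one hy hy1)

lemma artanhTail_nonneg {y : ℝ} (hy : 0 ≤ y) (i : ℕ) : 0 ≤ artanhTail y i :=
  tsum_nonneg fun _ => by positivity

lemma artanhTail_le {y : ℝ} (hy : 0 ≤ y) (hy1 : y ≤ 1 / 9) (i : ℕ) : artanhTail y i ≤ 9 / 8 := by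
  have h1 : y < 1 := by linarith
  refine (Summable.tsum_le_tsum (artanhTail_term_le hy i) (summable_artanhTail hy h1 i)
    (summable_geometric_of_lt_one hy h1)).trans ?_
  rw [tsum_geometric_of_lt_one hy h1, inv_le_comm₀ (by linarith) (by norm_num)]
  linarith

lemma artanhTail_succ {y : ℝ} (hy : 0 ≤ y) (hy1 : y < 1) (i : ℕ) :
    artanhTail y i = 1 / (2 * i + 1) + y * artanhTail y (i + 1) := by
  rw [artanhTail, (summable_artanhTail hy hy1 i).tsum_eq_zero_add, artanhTail, ← tsum_mul_left]
  simp only [pow_zero, add_zero]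
  congr 2
  ext k
  rw [pow_succ', mul_div_assoc, add_assoc, add_comm 1 k]

lemma log_eq_artanhTail {x : ℝ} (hx : 0 ≤ x) (hx1 : x < 1) :
    Real.log ((1 + x) / (1 - x)) = 2 * x * artanhTail (x ^ 2) 0 := by
  rw [Real.log_div (by linarith) (by linarith)]
  rw [← (Real.hasSum_log_sub_log_of_abs_lt_one (abs_lt.2 ⟨by linarith, hx1⟩)).tsum_eq, artanhTail,
    ← tsum_mul_left]
  congr 1
  ext k
  rw [zero_add, pow_succ, pow_mul]; ring

/-- The denominator of the fixed-point arithmetic. -/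
def scale : ℕ := 2 ^ 300

/-- Fixed-point Horner evaluation of `artanhTail`. -/
def horner (Y : ℕ) : ℕ → ℕ → ℕ
  | 0, _ => 0
  | K + 1, i => scale / (2 * i + 1) + Y * horner Y K (i + 1) / scale

/-- Fixed-point value of `2 * artanh`. -/
def artanhApprox (X K : ℕ) : ℕ := 2 * X * horner (X * X / scale) K 0 / scale

/-- Fixed-point value of `log (A / B)`. -/
def logApprox (A B : ℕ) : ℕ :=
  artanhApprox ((A - B) * scale / (A + B)) (150 / Nat.log2 ((A + B) / (A - B)) + 1)

lemma scale_pos : (0 : ℝ) < scale := by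
  exact_mod_cast (Nat.two_pow_pos 300 : 0 < scale)

lemma natDiv_bounds (n : ℕ) {d : ℕ} (hd : 0 < d) :
    ((n / d : ℕ) : ℝ) ≤ (n : ℝ) / d ∧ (n : ℝ) / d ≤ ((n / d : ℕ) : ℝ) + 1 := by
  refine ⟨Nat.cast_div_le, ?_⟩
  rw [div_le_iff₀ (by exact_mod_cast hd)]
  have := (Nat.lt_div_mul_add (a := n) hd).le
  have h : n ≤ (n / d + 1) * d := by rw [add_mul, one_mul]; exact this
  exact_mod_cast h

lemma scale_pos' : 0 < scale := Nat.two_pow_pos 300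

lemma horner_bounds {y : ℝ} {Y : ℕ} (hy : 0 ≤ y) (hy1 : y ≤ 1 / 9) (hY1 : (Y : ℝ) ≤ y * scale)
    (hY2 : y * scale ≤ Y + 2) (K : ℕ) : ∀ i : ℕ,
    (horner Y K i : ℝ) ≤ scale * artanhTail y i ∧
      scale * artanhTail y i ≤ horner Y K i + 5 + y ^ K * (9 / 8) * scale := by
  have hS := scale_pos
  induction K with
  | zero =>
    intro i
    have h1 := mul_le_mul_of_nonneg_left (artanhTail_le hy hy1 i) hS.le
    have h2 := mul_nonneg hS.le (artanhTail_nonneg hy i)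
    simp only [horner, Nat.cast_zero, pow_zero]
    constructor <;> linarith
  | succ K ih =>
    intro i
    obtain ⟨ih1, ih2⟩ := ih (i + 1)
    have hF := artanhTail_nonneg hy (i + 1)
    have hF1 := artanhTail_le hy hy1 (i + 1)
    obtain ⟨a1, a2⟩ := natDiv_bounds scale (show 0 < 2 * i + 1 by omega)
    obtain ⟨b1, b2⟩ := natDiv_bounds (Y * horner Y K (i + 1)) scale_pos'
    have hH : (0 : ℝ) ≤ horner Y K (i + 1) := Nat.cast_nonneg _
    rw [artanhTail_succ hy (by linarith)]
    simp only [horner]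
    push_cast at *
    generalize (horner Y K (i + 1) : ℝ) = H at *
    generalize artanhTail y (i + 1) = F at *
    have e : scale * (1 / (2 * (i : ℝ) + 1) + y * F) =
        scale / (2 * i + 1) + y * (scale * F) := by ring
    rw [e]
    constructor
    · have : (Y : ℝ) * H / scale ≤ y * (scale * F) := by
        rw [div_le_iff₀ hS]
        calc (Y : ℝ) * H ≤ (y * scale) * (scale * F) := by gcongr
          _ = _ := by ring
      linarith
    · have h1 : y * (scale * F) ≤ y * (H + 5 + y ^ K * (9 / 8) * scale) := by gcongr
      have h2 : y * H ≤ (Y : ℝ) * H / scale + 9 / 4 := by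
        rw [div_add' _ _ _ hS.ne', le_div_iff₀ hS]
        have h3 : H ≤ 9 / 8 * scale := by
          have := mul_le_mul_of_nonneg_left hF1 hS.le
          linarith
        have h4 := mul_le_mul_of_nonneg_right hY2 hH
        linarith
      rw [pow_succ]
      linarith

lemma artanhApprox_bounds {x : ℝ} {X K : ℕ} (hx : 0 ≤ x) (hx1 : x ≤ 1 / 3)
    (hX1 : (X : ℝ) ≤ x * scale) (hX2 : x * scale ≤ X + 1) (hK : (x ^ 2) ^ K * scale ≤ 1) :
    (artanhApprox X K : ℝ) ≤ scale * (2 * x * artanhTail (x ^ 2) 0) ∧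
      scale * (2 * x * artanhTail (x ^ 2) 0) ≤ artanhApprox X K + 8 := by
  have hS := scale_pos
  have hX : (0 : ℝ) ≤ X := Nat.cast_nonneg _
  have hy : 0 ≤ x ^ 2 := by positivity
  have hy1 : x ^ 2 ≤ 1 / 9 := (pow_le_pow_left₀ hx hx1 2).trans (by norm_num)
  obtain ⟨c1, c2⟩ := natDiv_bounds (X * X) scale_pos'
  have hF := artanhTail_nonneg hy 0
  have hF1 := artanhTail_le hy hy1 0
  have hsq1 : ((X * X : ℕ) : ℝ) / scale ≤ x ^ 2 * scale := by
    rw [div_le_iff₀ hS]; push_cast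
    calc (X * X : ℝ) ≤ (x * scale) * (x * scale) := by gcongr
      _ = _ := by ring
  have hsq2 : x ^ 2 * scale ≤ ((X * X : ℕ) : ℝ) / scale + 1 := by
    rw [div_add' _ _ _ hS.ne', le_div_iff₀ hS]; push_cast
    have h1 : (x * scale) * (x * scale) ≤ (X + 1) * (x * scale) := by gcongr
    have h2 : (X : ℝ) * (x * scale) ≤ X * (X + 1) := by gcongr
    have h3 : x * scale ≤ 1 / 3 * scale := by gcongr
    linarith
  obtain ⟨h1, h2⟩ := horner_bounds hy hy1 (c1.trans hsq1) (by linarith) K 0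
  obtain ⟨d1, d2⟩ := natDiv_bounds (2 * X * horner (X * X / scale) K 0) scale_pos'
  have hH : (0 : ℝ) ≤ horner (X * X / scale) K 0 := Nat.cast_nonneg _
  unfold artanhApprox
  push_cast at d1 d2 ⊢
  generalize (horner (X * X / scale) K 0 : ℝ) = H at *
  generalize artanhTail (x ^ 2) 0 = F at *
  constructor
  · refine d1.trans ?_
    rw [div_le_iff₀ hS]
    calc 2 * (X : ℝ) * H ≤ 2 * (x * scale) * (scale * F) := by gcongr
      _ = _ := by ring
  · have h3 : scale * F ≤ H + 5 + 9 / 8 := by linarith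
    have h4 : x * (scale * F) ≤ x * (H + 5 + 9 / 8) := by gcongr
    have h5 : x * H ≤ (X : ℝ) * H / scale + 9 / 8 := by
      rw [div_add' _ _ _ hS.ne', le_div_iff₀ hS]
      have h6 : H ≤ 9 / 8 * scale := by
        have := mul_le_mul_of_nonneg_left hF1 hS.le
        linarith
      have h7 := mul_le_mul_of_nonneg_right hX2 hH
      linarith
    have h8 : 2 * (X : ℝ) * H / scale = 2 * (X * H / scale) := by ring
    linarith

lemma logApprox_bounds {A B : ℕ} (hB : 0 < B) (hAB : B < A) (hA : A ≤ 2 * B) :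
    (logApprox A B : ℝ) ≤ scale * Real.log (A / B) ∧
      scale * Real.log (A / B) ≤ logApprox A B + 8 := by
  obtain ⟨d, rfl⟩ := Nat.exists_eq_add_of_lt hAB
  have hd : B + d + 1 - B = d + 1 := by omega
  have hB' : (0 : ℝ) < B := by exact_mod_cast hB
  set x : ℝ := (d + 1 : ℕ) / (B + d + 1 + B : ℕ) with hxdef
  have hx : 0 ≤ x := by positivity
  have hN : (0 : ℝ) < (B + d + 1 + B : ℕ) := by positivity
  have hx1 : x ≤ 1 / 3 := by
    rw [hxdef, div_le_div_iff₀ hN (by norm_num)]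
    have : (d + 1) * 3 ≤ 1 * (B + d + 1 + B) := by omega
    exact_mod_cast this
  have hlog : Real.log ((B + d + 1 : ℕ) / B) = 2 * x * artanhTail (x ^ 2) 0 := by
    rw [← log_eq_artanhTail hx (by linarith)]
    congr 1
    rw [hxdef]; push_cast at hN ⊢
    have : (B : ℝ) + d + 1 + B - (d + 1) ≠ 0 := by
      have : (B : ℝ) + d + 1 + B - (d + 1) = 2 * B := by ring
      rw [this]; positivity
    field_simp
    ring
  have e : (((d + 1) * scale : ℕ) : ℝ) / (B + d + 1 + B : ℕ) = x * scale := by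
    rw [hxdef]; push_cast; ring
  obtain ⟨h1, h2⟩ := natDiv_bounds ((d + 1) * scale) (show 0 < B + d + 1 + B by omega)
  rw [e] at h1 h2
  rw [hlog]
  unfold logApprox
  rw [hd]
  refine artanhApprox_bounds hx hx1 h1 h2 ?_
  set Q := (B + d + 1 + B) / (d + 1) with hQ
  have hQ3 : 3 ≤ Q := by
    rw [hQ, Nat.le_div_iff_mul_le (by omega)]; omega
  have hj1 : 1 ≤ Nat.log2 Q := (Nat.le_log2 (by omega)).2 (by omega)
  have hj2 : 2 ^ Nat.log2 Q ≤ Q := Nat.log2_self_le (by omega)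
  have hxQ : x ≤ 1 / 2 ^ Nat.log2 Q := by
    rw [hxdef, div_le_div_iff₀ hN (by positivity), one_mul]
    have : (d + 1) * 2 ^ Nat.log2 Q ≤ B + d + 1 + B :=
      (Nat.mul_le_mul_left _ hj2).trans (Nat.mul_div_le _ _)
    exact_mod_cast this
  have hjK : 150 ≤ Nat.log2 Q * (150 / Nat.log2 Q + 1) :=
    (Nat.lt_mul_div_succ 150 hj1).le
  generalize 150 / Nat.log2 Q + 1 = K at *
  generalize Nat.log2 Q = j at *
  calc (x ^ 2) ^ K * scale ≤ ((1 / 2 ^ j) ^ 2) ^ K * scale := by gcongr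
    _ = 2 ^ 300 / 2 ^ (2 * (j * K)) := by
        rw [scale, one_div, inv_pow, inv_pow, ← pow_mul, ← pow_mul,
          show j * (2 * K) = 2 * (j * K) by ring, div_eq_inv_mul, Nat.cast_pow, Nat.cast_ofNat]
    _ ≤ 1 := by
        rw [div_le_one (by positivity)]
        exact pow_le_pow_right₀ (by norm_num) (by omega)

lemma scale_mul_abs (x : ℝ) : scale * |x| = |scale * x| := by
  rw [abs_mul, Nat.abs_cast]

lemma scale_mul_abs_log_sub_le {u A : ℝ} (hA : 2 * scale ≤ A) (hu : |u - A| ≤ 2) :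
    scale * |Real.log u - Real.log A| ≤ 2 := by
  have h2 : (2 : ℝ) ≤ scale := by
    have : 2 ≤ scale := by decide +kernel
    exact_mod_cast this
  obtain ⟨h3, h4⟩ := abs_le.1 hu
  have hA0 : 0 < A := by linarith
  have hu0 : 0 < u := by linarith
  have key : ∀ p q : ℝ, scale ≤ p → 0 < q → q - p ≤ 2 →
      scale * (Real.log q - Real.log p) ≤ 2 := by
    intro p q hp hq hqp
    have hp0 : 0 < p := by linarith
    have h := Real.log_le_sub_one_of_pos (div_pos hq hp0)
    rw [Real.log_div hq.ne' hp0.ne', div_sub_one hp0.ne'] at h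
    calc scale * (Real.log q - Real.log p) ≤ scale * (2 / p) := by
          gcongr
          exact h.trans (by gcongr)
      _ ≤ p * (2 / p) := by gcongr
      _ = 2 := by field_simp
  rcases abs_cases (Real.log u - Real.log A) with ⟨h, -⟩ | ⟨h, -⟩ <;> rw [h]
  · exact key _ _ (by linarith) hu0 h4
  · rw [neg_sub]; exact key _ _ (by linarith) hA0 (by linarith)

/-- The hypotheses under which `logApprox` is used. -/
def ratioOK (A B : ℕ) : Bool :=
  Nat.ble (2 * scale) B && (Nat.ble (B + 1) A && Nat.ble A (2 * B))

lemma abs_sub_logApprox_le {A B : ℕ} {u v : ℝ} (h : ratioOK A B = true) (hu : |u - A| ≤ 2)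
    (hv : |v - B| ≤ 2) : |scale * (Real.log u - Real.log v) - logApprox A B| ≤ 12 := by
  simp only [ratioOK, Bool.and_eq_true, Nat.ble_eq] at h
  obtain ⟨h1, h2, h3⟩ := h
  have hB : 0 < B := by have := scale_pos'; omega
  have hBR : (2 * scale : ℝ) ≤ B := by exact_mod_cast h1
  have hAR : (2 * scale : ℝ) ≤ A := by exact_mod_cast h1.trans (by omega)
  have hS := scale_pos
  obtain ⟨h4, h5⟩ := logApprox_bounds hB h2 h3
  rw [Real.log_div (by linarith) (by linarith)] at h4 h5
  have h6 := scale_mul_abs_log_sub_le hAR hu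
  have h7 := scale_mul_abs_log_sub_le hBR hv
  rw [scale_mul_abs, abs_le] at h6 h7
  rw [abs_le]
  constructor <;> linarith

/-- The reduction test for a candidate fraction `v / w`. -/
def reduces (a r g w v : ℕ) : Bool :=
  Nat.ble (10 ^ 19 * ((w * r - v * a) + (v * a - w * r) + 2 * (w + v) * 10000) + 20000 * w + 1)
    (min (w * g % a) (a - w * g % a))

lemma min_mod_le_abs (a k : ℕ) (ha : 0 < a) (n : ℤ) :
    ((min (k % a) (a - k % a) : ℕ) : ℤ) ≤ |a * n - k| := by
  have h1 := Nat.mod_lt k ha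
  have h2 : (k : ℤ) = a * (k / a : ℕ) + (k % a : ℕ) := by exact_mod_cast (Nat.div_add_mod k a).symm
  generalize k / a = e at *
  generalize k % a = R at *
  rcases le_or_gt n e with h | h
  · have h3 : (a : ℤ) * n ≤ a * e := by gcongr
    have h4 : ((min R (a - R) : ℕ) : ℤ) ≤ R := by exact_mod_cast min_le_left _ _
    refine h4.trans ((?_ : (R : ℤ) ≤ -(a * n - k)).trans (neg_le_abs _))
    linarith
  · have h3 : (a : ℤ) * (e + 1) ≤ a * n := by gcongr; omega
    have h4 : ((min R (a - R) : ℕ) : ℤ) ≤ a - R := by omega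
    refine h4.trans ((?_ : (a : ℤ) - R ≤ a * n - k).trans (le_abs_self _))
    linarith

lemma reduces_sound {x y z : ℝ} {a r g w v l m : ℕ} (ha : |scale * x - a| ≤ 10000)
    (hr : |scale * y - r| ≤ 10000) (hg : |scale * z - g| ≤ 10000) (ha0 : 0 < a)
    (hlm : l ≤ m) (hm : m ≤ 10 ^ 19) (hf : scale * |l * x - m * y - z| ≤ 1) :
    reduces a r g w v = false := by
  rw [Bool.eq_false_iff]
  intro h
  simp only [reduces, Nat.ble_eq] at h
  have h1 := min_mod_le_abs a (w * g) ha0 (w * l - v * m)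
  have hS := scale_pos
  rw [scale_mul_abs] at hf
  have e : (((a : ℤ) * (w * l - v * m) - (w * g : ℕ) : ℤ) : ℝ) =
      w * (scale * (l * x - m * y - z)) + m * (w * r - v * a) + m * (w * (scale * y - r))
        - m * (v * (scale * x - a)) - (w * l - v * m) * (scale * x - a) + w * (scale * z - g) := by
    push_cast; ring
  have hmR : (m : ℝ) ≤ 10 ^ 19 := by exact_mod_cast hm
  have hn : |(w : ℝ) * l - v * m| ≤ m * (w + v) := by
    have hl : (l : ℝ) ≤ m := by exact_mod_cast hlm
    have : (w : ℝ) * l ≤ w * m := by gcongr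
    have : (0 : ℝ) ≤ w * l := by positivity
    have : (0 : ℝ) ≤ w * m := by positivity
    have : (0 : ℝ) ≤ v * m := by positivity
    rw [abs_le]; constructor <;> linarith
  have hd : |(w : ℝ) * r - v * a| ≤ ((w * r - v * a) + (v * a - w * r) : ℕ) := by
    have : |((w * r : ℕ) : ℤ) - (v * a : ℕ)| ≤ ((w * r - v * a) + (v * a - w * r) : ℕ) := by
      rw [abs_le]; omega
    exact_mod_cast this
  have h2 : |(((a : ℤ) * (w * l - v * m) - (w * g : ℕ) : ℤ) : ℝ)| ≤
      w * 1 + m * ((w * r - v * a) + (v * a - w * r) : ℕ) + m * (w * 10000)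
        + m * (v * 10000) + (m * (w + v)) * 10000 + w * 10000 := by
    rw [e]
    refine (abs_add_le _ _).trans (add_le_add ((abs_sub _ _).trans (add_le_add
      ((abs_sub _ _).trans (add_le_add ((abs_add_le _ _).trans (add_le_add
      ((abs_add_le _ _).trans (add_le_add ?_ ?_)) ?_)) ?_)) ?_)) ?_) <;>
    simp only [abs_mul, Nat.abs_cast] <;> gcongr
    rw [scale_mul_abs]; exact hf
  have h3 : ((10 ^ 19 * ((w * r - v * a) + (v * a - w * r) + 2 * (w + v) * 10000) +
      20000 * w + 1 : ℕ) : ℝ) ≤ |(((a : ℤ) * (w * l - v * m) - (w * g : ℕ) : ℤ) : ℝ)| := by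
    have : ((10 ^ 19 * ((w * r - v * a) + (v * a - w * r) + 2 * (w + v) * 10000) +
      20000 * w + 1 : ℕ) : ℤ) ≤ |(a : ℤ) * (w * l - v * m) - (w * g : ℕ)| :=
      le_trans (by exact_mod_cast h) h1
    rw [← Int.cast_abs]
    exact_mod_cast this
  generalize (w * r - v * a) + (v * a - w * r) = d at *
  have h4 : (m : ℝ) * (d + 2 * (w + v) * 10000) ≤ 10 ^ 19 * (d + 2 * (w + v) * 10000) := by gcongr
  have hw : (0 : ℝ) ≤ w := Nat.cast_nonneg _
  push_cast at h3 h2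
  linarith

/-- Search for a successful reduction among the convergents of `r / a`. -/
def search (a r g : ℕ) : ℕ → ℕ → ℕ → ℕ → ℕ → ℕ → ℕ → Bool
  | 0, _, _, _, _, _, _ => false
  | k + 1, x, y, p₀, q₀, p, q =>
    (Nat.ble (10 ^ 20) q && reduces a r g q p) ||
      search a r g k y (x % y) p q (x / y * p + p₀) (x / y * q + q₀)

lemma search_sound {a r g : ℕ} : ∀ {k x y p₀ q₀ p q : ℕ},
    search a r g k x y p₀ q₀ p q = true → ∃ w v, reduces a r g w v = true := by
  intro k
  induction k with
  | zero => intro x y p₀ q₀ p q h; simp [search] at h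
  | succ k ih =>
    intro x y p₀ q₀ p q h
    simp only [search, Bool.or_eq_true, Bool.and_eq_true] at h
    rcases h with h | h
    · exact ⟨_, _, h.2⟩
    · exact ih h

/-- Newton iteration for the integer square root of `n`. -/
def newton (n : ℕ) : ℕ → ℕ → ℕ
  | 0, y => y
  | k + 1, y => newton n k ((y + n / y) / 2)

/-- The assertion that `y` is the integer square root of `n`. -/
def sqrtOK (n y : ℕ) : Bool := Nat.ble (y * y) n && Nat.ble n ((y + 1) * (y + 1))

lemma abs_sqrt_mul_scale_sub_le {n y : ℕ} (h : sqrtOK (n * scale ^ 2) y = true) :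
    |√(n : ℝ) * scale - y| ≤ 1 := by
  simp only [sqrtOK, Bool.and_eq_true, Nat.ble_eq] at h
  have h1 : (y : ℝ) * y ≤ n * scale ^ 2 := by exact_mod_cast h.1
  have h2 : (n : ℝ) * scale ^ 2 ≤ (y + 1) * (y + 1) := by exact_mod_cast h.2
  have hS := scale_pos
  have e : √(n : ℝ) * scale = √(n * scale ^ 2) := by
    rw [Real.sqrt_mul (Nat.cast_nonneg _), Real.sqrt_sq hS.le]
  rw [e, abs_le]
  constructor
  · have : (y : ℝ) ≤ √(n * scale ^ 2) := Real.le_sqrt_of_sq_le (by linarith)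
    linarith
  · have : √(n * scale ^ 2 : ℝ) ≤ y + 1 := Real.sqrt_le_iff.2 ⟨by positivity, by linarith⟩
    linarith

/-- The verification for one value of `Δ`, given approximations of the square roots. -/
def verifyRoots (N e r s p q u : ℕ) : Bool :=
  ratioOK N (s * scale + q) && ratioOK N (r * scale + p) &&
  ratioOK (u + q) (u + p) && ratioOK (u + q) (u - p) &&
  Nat.ble 1 (e - logApprox N (s * scale + q)) && Nat.ble 1 (e - logApprox N (r * scale + p)) &&
  search (e - logApprox N (s * scale + q)) (e - logApprox N (r * scale + p))
    (logApprox (u + q) (u + p)) 100 (e - logApprox N (r * scale + p))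
    (e - logApprox N (s * scale + q)) 0 1 1 0 &&
  search (e - logApprox N (s * scale + q)) (e - logApprox N (r * scale + p))
    (logApprox (u + q) (u - p)) 100 (e - logApprox N (r * scale + p))
    (e - logApprox N (s * scale + q)) 0 1 1 0

/-- The verification for one value of `Δ`, given candidates for the square roots. -/
def verifySqrt (N e r s ab ac bc p q u : ℕ) : Bool :=
  sqrtOK (ab * scale ^ 2) p && sqrtOK (ac * scale ^ 2) q && sqrtOK (bc * scale ^ 2) u &&
    verifyRoots N e r s p q u

/-- The verification for one value of `Δ`, given the coefficients of the triple. -/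
def verifyTriple (N e r s t ab ac bc : ℕ) : Bool :=
  verifySqrt N e r s ab ac bc (newton (ab * scale ^ 2) 8 (r * scale))
    (newton (ac * scale ^ 2) 8 (s * scale)) (newton (bc * scale ^ 2) 8 (t * scale))

/-- The verification for `Δ = D`, where `e` approximates `log (2 * D ^ 4)`. -/
def verify (D e : ℕ) : Bool :=
  verifyTriple (2 * D ^ 4 * scale) e (r D).toNat (s D).toNat (t D).toNat
    (a D * b D).toNat (a D * c D).toNat (b D * c D).toNat

/-- The verification for `k` consecutive values of `Δ` starting with `j`. -/
def verifyRange (e : ℕ) : ℕ → ℕ → ℕ → Bool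
  | 0, _, _ => true
  | k + 1, j, f => (Nat.ble j 5 || verify j (e + 4 * f)) &&
      verifyRange e k (j + 1) (f + logApprox (j + 1) j)

set_option maxRecDepth 100000 in
lemma verifyRange_eq_true : verifyRange (logApprox 2 1) 299 1 0 = true := by decide +kernel

lemma four_mul_scale_le {Δ ε : ℤ} (hΔ : 6 ≤ Δ) (hΔ2 : Δ < 300) (hε : ε = 1 ∨ ε = -1) {l m : ℕ}
    (hlm : l < m) (hf : |form Δ ε l m| ≤ 4 / ρ Δ ^ (2 * m)) :
    scale * |l * Real.log (α Δ) - m * Real.log (ρ Δ)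
      - (Real.log (den Δ) - Real.log (num Δ ε))| ≤ 1 := by
  obtain ⟨hℓ1, -⟩ := logα_small hΔ hΔ2
  obtain ⟨-, hl1⟩ := logα_sub_logρ_le hΔ
  have hw := (abs_le.1 (form_window hΔ hε (by omega) hf)).1
  have hρ := thousand_le_ρ hΔ
  have h1 : (l : ℝ) + 1 ≤ m := by exact_mod_cast hlm
  have h2 : (m : ℝ) * (Real.log (α Δ) - Real.log (ρ Δ)) ≤ m * (1 / 30) := by gcongr
  have h3 : 1 * Real.log (α Δ) ≤ (m - l) * Real.log (α Δ) := by gcongr; linarith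
  have hm : (51 : ℝ) ≤ m := by linarith
  have hm : 51 ≤ m := by exact_mod_cast hm
  have h4 : (1000 : ℝ) ^ (2 * 51) ≤ ρ Δ ^ (2 * m) :=
    (pow_le_pow_left₀ (by norm_num) hρ _).trans
      (pow_le_pow_right₀ (by linarith) (by omega))
  have h5 : 4 * (scale : ℝ) ≤ 1000 ^ (2 * 51) := by
    have : 4 * scale ≤ 1000 ^ (2 * 51) := by decide +kernel
    exact_mod_cast this
  have e : l * Real.log (α Δ) - m * Real.log (ρ Δ)
      - (Real.log (den Δ) - Real.log (num Δ ε)) = form Δ ε l m := by unfold form; ring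
  rw [e]
  calc scale * |form Δ ε l m| ≤ scale * (4 / ρ Δ ^ (2 * m)) := by gcongr
    _ = 4 * scale / ρ Δ ^ (2 * m) := by ring
    _ ≤ 1 := by
      rw [div_le_one (by positivity)]
      exact h5.trans h4

lemma verifyRoots_sound {Δ ε : ℤ} {D e p q u : ℕ} (hΔ : 6 ≤ Δ) (hΔ2 : Δ < 300) (hD : Δ = D)
    (hε : ε = 1 ∨ ε = -1) {l m : ℕ} (hlm : l < m) (hm : m ≤ 10 ^ 19)
    (he : |scale * (Real.log 2 + 4 * Real.log D) - e| ≤ 9988)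
    (hf : |form Δ ε l m| ≤ 4 / ρ Δ ^ (2 * m)) (hp : |√(a Δ * b Δ : ℝ) * scale - p| ≤ 1)
    (hq : |√(a Δ * c Δ : ℝ) * scale - q| ≤ 1) (hu : |√(b Δ * c Δ : ℝ) * scale - u| ≤ 1) :
    verifyRoots (2 * D ^ 4 * scale) e (r Δ).toNat (s Δ).toNat p q u = false := by
  rw [Bool.eq_false_iff]
  intro h
  simp only [verifyRoots, Bool.and_eq_true, Nat.ble_eq] at h
  obtain ⟨⟨⟨⟨⟨⟨⟨h1, h2⟩, h3⟩, h4⟩, h5⟩, h6⟩, h7⟩, h8⟩ := h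
  obtain ⟨ha, hr, hb, hs, ht, hc⟩ := order_chain hΔ
  have hS := scale_pos
  have hD0 : (0 : ℝ) < D := by
    have : (0 : ℤ) < D := by omega
    exact_mod_cast this
  have hρ : 0 < ρ Δ := by linarith [thousand_le_ρ hΔ]
  have hα : 0 < α Δ := hρ.trans (ρ_lt_α hΔ)
  have hrc : (((r Δ).toNat : ℕ) : ℝ) = r Δ := by
    have : 0 ≤ r Δ := by rify; linarith
    exact_mod_cast Int.toNat_of_nonneg this
  have hsc : (((s Δ).toNat : ℕ) : ℝ) = s Δ := by
    have : 0 ≤ s Δ := by rify; linarith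
    exact_mod_cast Int.toNat_of_nonneg this
  have hN : |((2 * D ^ 4 * scale : ℕ) : ℝ) - (2 * D ^ 4 * scale : ℕ)| ≤ 2 := by simp
  have hlogN : Real.log ((2 * D ^ 4 * scale : ℕ) : ℝ) =
      Real.log 2 + 4 * Real.log D + Real.log scale := by
    push_cast
    rw [Real.log_mul (by positivity) hS.ne', Real.log_mul (by norm_num) (by positivity),
      Real.log_pow]
    norm_num
  have key : ∀ {x : ℝ} {B : ℕ}, 0 < x → ratioOK (2 * D ^ 4 * scale) B = true →
      1 ≤ e - logApprox (2 * D ^ 4 * scale) B → |x * scale - B| ≤ 2 →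
      |scale * Real.log x - (e - logApprox (2 * D ^ 4 * scale) B : ℕ)| ≤ 10000 := by
    intro x B hx hok hle hB
    have h := abs_le.1 (abs_sub_logApprox_le hok hN hB)
    rw [hlogN, Real.log_mul hx.ne' hS.ne'] at h
    obtain ⟨he1, he2⟩ := abs_le.1 he
    rw [Nat.cast_sub (by omega), abs_le]
    constructor <;> linarith [h.1, h.2]
  obtain ⟨hp1, hp2⟩ := abs_le.1 hp
  obtain ⟨hq1, hq2⟩ := abs_le.1 hq
  obtain ⟨hu1, hu2⟩ := abs_le.1 hu
  have hA := key hα h1 h5 (by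
    push_cast; rw [hsc, α, abs_le]; constructor <;> linarith)
  have hR := key hρ h2 h6 (by
    push_cast; rw [hrc, ρ, abs_le]; constructor <;> linarith)
  have hden : |den Δ * scale - (u + q : ℕ)| ≤ 2 := by
    push_cast; rw [den, abs_le]; constructor <;> linarith
  have hfin : ∀ {B : ℕ}, ratioOK (u + q) B = true → |num Δ ε * scale - B| ≤ 2 →
      search (e - logApprox (2 * D ^ 4 * scale) ((s Δ).toNat * scale + q))
        (e - logApprox (2 * D ^ 4 * scale) ((r Δ).toNat * scale + p))
        (logApprox (u + q) B) 100 (e - logApprox (2 * D ^ 4 * scale) ((r Δ).toNat * scale + p))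
        (e - logApprox (2 * D ^ 4 * scale) ((s Δ).toNat * scale + q)) 0 1 1 0 = true → False := by
    intro B hok hB hs
    have h := abs_le.1 (abs_sub_logApprox_le hok hden hB)
    rw [Real.log_mul (den_pos hΔ).ne' hS.ne', Real.log_mul (num_pos hΔ hε).ne' hS.ne'] at h
    obtain ⟨w, v, hwv⟩ := search_sound hs
    rw [reduces_sound hA hR (z := Real.log (den Δ) - Real.log (num Δ ε))
      (abs_le.2 ⟨by linarith [h.1], by linarith [h.2]⟩) h5 hlm.le hm
      (four_mul_scale_le hΔ hΔ2 hε hlm hf)] at hwv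
    exact Bool.noConfusion hwv
  rcases hε with rfl | rfl
  · refine hfin h3 ?_ h7
    push_cast; rw [num, abs_le]; push_cast; constructor <;> linarith
  · refine hfin h4 ?_ h8
    have hpu : p ≤ u := by
      simp only [ratioOK, Bool.and_eq_true, Nat.ble_eq] at h4
      have := scale_pos'
      omega
    rw [Nat.cast_sub hpu, num, abs_le]; push_cast; constructor <;> linarith

lemma verify_sound {Δ ε : ℤ} {D e : ℕ} (hΔ : 6 ≤ Δ) (hΔ2 : Δ < 300) (hD : Δ = D)
    (hε : ε = 1 ∨ ε = -1) {l m : ℕ} (hlm : l < m) (hm : m ≤ 10 ^ 19)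
    (he : |scale * (Real.log 2 + 4 * Real.log D) - e| ≤ 9988)
    (hf : |form Δ ε l m| ≤ 4 / ρ Δ ^ (2 * m)) : verify D e = false := by
  rw [Bool.eq_false_iff]
  intro h
  simp only [verify, verifyTriple, verifySqrt, Bool.and_eq_true, ← hD] at h
  obtain ⟨⟨⟨h1, h2⟩, h3⟩, h4⟩ := h
  obtain ⟨ha, hb, hc⟩ := pos hΔ
  have key : ∀ {x y : ℤ} {w : ℕ}, 0 < x → 0 < y → sqrtOK ((x * y).toNat * scale ^ 2) w = true →
      |√(x * y : ℝ) * scale - w| ≤ 1 := by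
    intro x y w hx hy h
    have e : ((x * y).toNat : ℝ) = x * y := by
      exact_mod_cast Int.toNat_of_nonneg (mul_pos hx hy).le
    rw [← e]
    exact abs_sqrt_mul_scale_sub_le h
  rw [verifyRoots_sound hΔ hΔ2 hD hε hlm hm he hf (key ha hb h1) (key ha hc h2)
    (key hb hc h3)] at h4
  exact Bool.noConfusion h4

lemma verifyRange_sound {e : ℕ} : ∀ {k j f : ℕ}, verifyRange e k j f = true → 1 ≤ j →
    |scale * Real.log j - f| ≤ 8 * j → ∀ D, j ≤ D → D < j + k → 6 ≤ D →
    ∃ f' : ℕ, |scale * Real.log D - f'| ≤ 8 * D ∧ verify D (e + 4 * f') = true := by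
  intro k
  induction k with
  | zero => intros; omega
  | succ k ih =>
    intro j f h hj hf D hjD hDk hD
    simp only [verifyRange, Bool.and_eq_true, Bool.or_eq_true, Nat.ble_eq] at h
    rcases hjD.eq_or_lt with rfl | hlt
    · exact ⟨f, hf, h.1.resolve_left (by omega)⟩
    · refine ih h.2 (by omega) ?_ D hlt (by omega) hD
      obtain ⟨h1, h2⟩ := logApprox_bounds (A := j + 1) (B := j) (by omega) (by omega) (by omega)
      have hj0 : (0 : ℝ) < j := by exact_mod_cast hj
      rw [Real.log_div (by positivity) hj0.ne'] at h1 h2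
      obtain ⟨h3, h4⟩ := abs_le.1 hf
      rw [abs_le]
      push_cast at *
      constructor <;> linarith

theorem small_contradiction {Δ ε : ℤ} (hΔ : 6 ≤ Δ) (hΔ2 : Δ < 300) (hε : ε = 1 ∨ ε = -1) {l m : ℕ}
    (hlm : l < m) (hf : |form Δ ε l m| ≤ 4 / ρ Δ ^ (2 * m)) : False := by
  obtain ⟨D, rfl⟩ := Int.eq_ofNat_of_zero_le (by linarith : 0 ≤ Δ)
  obtain ⟨f, h1, h2⟩ := verifyRange_sound verifyRange_eq_true le_rfl (by simp) D (by omega)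
    (by omega) (by omega)
  obtain ⟨h3, h4⟩ := logApprox_bounds (A := 2) (B := 1) (by norm_num) (by norm_num) (by norm_num)
  rw [Nat.cast_one, div_one, Nat.cast_ofNat] at h3 h4
  have hD : (D : ℝ) < 300 := by exact_mod_cast hΔ2
  obtain ⟨h5, h6⟩ := abs_le.1 h1
  rw [verify_sound hΔ hΔ2 rfl hε hlm (index_bound hΔ hΔ2 hε (by omega) hf).le ?_ hf] at h2
  · exact Bool.noConfusion h2
  · have : (D : ℝ) ≤ 299 := by
      have : D ≤ 299 := by omega
      exact_mod_cast this
    rw [abs_le]; push_cast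
    constructor <;> linarith

theorem eq_of_extension {Δ d : ℤ} (hΔ : 6 ≤ Δ) (hd : 0 < d) (hcd : c Δ ≠ d)
    (hx : IsSquare (a Δ * d + 1)) (hy : IsSquare (b Δ * d + 1)) (hz : IsSquare (c Δ * d + 1)) :
    d = 4 * (r Δ * s Δ * t Δ) := by
  obtain ⟨ha, hb, hc⟩ := pos hΔ
  have key : ∀ {e : ℤ}, 0 < e → IsSquare (e * d + 1) → ∃ x, 0 < x ∧ e * d + 1 = x ^ 2 := by
    rintro e he ⟨x, hx⟩
    refine ⟨|x|, abs_pos.2 ?_, by rw [sq_abs, hx, sq]⟩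
    rintro rfl
    have := mul_pos he hd
    linarith
  obtain ⟨x, hx0, hx⟩ := key ha hx
  obtain ⟨y, hy0, hy⟩ := key hb hy
  obtain ⟨z, hz0, hz⟩ := key hc hz
  by_contra hne
  obtain ⟨m, l, ε, hε, h1, h2⟩ := exists_pell_exponents hΔ hx0 hy0 hz0 hx hy hz
  have hlm := (exponent_bounds hΔ hd hcd hne hx hε h1 h2).2
  have hf := abs_form_le hΔ hx0 hy0 hz0 hε h1 h2
  rcases lt_or_ge Δ 300 with h | h
  · exact small_contradiction hΔ h hε hlm hf
  · exact large_contradiction h hε hlm hf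

end Triple

theorem stmt_18 (Δ d : ℤ) (hΔ : 6 ≤ Δ)
    (h : IsDiophQuadruple 1 (Δ ^ 2 - 1)
      (Δ ^ 6 - 3 * Δ ^ 4 - 2 * Δ ^ 3 + 3 * Δ ^ 2 + 2 * Δ)
      (Δ ^ 6 - Δ ^ 4 - 2 * Δ ^ 3 + 1) d) :
    d = 4 * Δ ^ 14 - 20 * Δ ^ 12 - 16 * Δ ^ 11 + 40 * Δ ^ 10 + 56 * Δ ^ 9 - 16 * Δ ^ 8
      - 72 * Δ ^ 7 - 32 * Δ ^ 6 + 24 * Δ ^ 5 + 32 * Δ ^ 4 + 8 * Δ ^ 3 - 4 * Δ ^ 2 - 4 * Δ := by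
  obtain ⟨-, -, -, hd, -, -, -, -, -, hcd, -, -, hx, -, hy, hz⟩ := h
  rw [← Triple.four_mul_rst]
  exact Triple.eq_of_extension hΔ hd hcd hx hy hz
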